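/- arXiv:1209.5786 — 5 statements merged into one kernel-verified Lean document; each statement's English description precedes it below -/
import Mathlib

section
/- Let (X,d) be a complete separable length metric space, let C ≥ 0, and let κ be a map from X to Borel probability measures on X, measurable for the weak topology, such that: (i) for every bounded Lipschitz f : X → ℝ the function P̃f(x) := ∫_X f dκ(x) is Lipschitz with constant at most C·Lip(f); (ii) for every bounded Lipschitz f : X → ℝ one has |D(P̃f)|²(x) ≤ C²·P̃(|Df|²)(x) for every x ∈ X. Then W₂(κ(x), κ(y)) ≤ C·d(x,y) for all x, y ∈ X, and consequently W₂(μκ, νκ) ≤ C·W₂(μ, ν) for all Borel probability measures μ, ν on X. -/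
open MeasureTheory Filter Topology
open scoped ENNReal NNReal

/-- The slope `|Df|(x) = limsup_{y→x} |f(y)-f(x)|/d(y,x)` (junk value `0` at isolated
points, where the punctured neighbourhood filter is trivial). -/
noncomputable def slopeAt {X : Type*} [MetricSpace X] (f : X → ℝ) (x : X) : ℝ :=
  limsup (fun y => |f y - f x| / dist y x) (𝓝[≠] x)

/-- `(X,d)` is a length space: `d(x,y)` is the infimum of the lengths of Lipschitz curves
`γ : [0,1] → X` from `x` to `y`, where the length is the supremum over partitions of sums of
distances of consecutive points (i.e. the total variation of `γ` on `[0,1]`). -/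
def IsLengthSpace (X : Type*) [MetricSpace X] : Prop :=
  ∀ x y : X,
    ENNReal.ofReal (dist x y) =
      ⨅ (γ : ℝ → X) (_ : ∃ L : ℝ≥0, LipschitzOnWith L γ (Set.Icc 0 1)) (_ : γ 0 = x)
        (_ : γ 1 = y), eVariationOn γ (Set.Icc 0 1)

/-- The `L^p`-Wasserstein extended distance between two Borel measures on a metric space:
the infimum of `(∫ d(x₁,x₂)^p dγ)^{1/p}` over all couplings `γ` of `μ` and `ν`. -/
noncomputable def wassersteinDist {X : Type*} [MetricSpace X] [MeasurableSpace X]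
    (p : ℝ) (μ ν : Measure X) : ℝ≥0∞ :=
  ⨅ (γ : Measure (X × X)) (_ : γ.map Prod.fst = μ ∧ γ.map Prod.snd = ν),
    (∫⁻ z, edist z.1 z.2 ^ p ∂γ) ^ (1 / p)

section Slope

variable {X : Type*} [MetricSpace X]

theorem isBoundedUnder_slope {f : X → ℝ} {L : ℝ≥0} (hf : LipschitzWith L f) (x : X) :
    IsBoundedUnder (· ≤ ·) (𝓝[≠] x) (fun y => |f y - f x| / dist y x) := by
  refine isBoundedUnder_of ⟨L, fun y => ?_⟩
  have h := hf.dist_le_mul y x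
  rw [Real.dist_eq] at h
  exact div_le_of_le_mul₀ dist_nonneg L.2 h

theorem slopeAt_nonneg (f : X → ℝ) (x : X) (hf : ∃ L : ℝ≥0, LipschitzWith L f) :
    0 ≤ slopeAt f x := by
  obtain ⟨L, hL⟩ := hf
  rcases (𝓝[≠] x).eq_or_neBot with h | h
  · simp [slopeAt, h, limsup, limsSup]
  · refine le_limsup_of_frequently_le (Eventually.frequently (Eventually.of_forall fun y => ?_))
      (isBoundedUnder_slope hL x)
    positivity

theorem slopeAt_le {f : X → ℝ} {x : X} {D : ℝ} (hD : 0 ≤ D)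
    (h : ∀ ε > 0, ∀ᶠ y in 𝓝 x, |f y - f x| ≤ (D + ε) * dist y x) : slopeAt f x ≤ D := by
  rcases (𝓝[≠] x).eq_or_neBot with h0 | h0
  · simpa [slopeAt, h0, limsup, limsSup] using hD
  · refine le_of_forall_pos_le_add fun ε hε => limsup_le_of_le ?_ ?_
    · exact IsBoundedUnder.isCoboundedUnder_le
        (isBoundedUnder_of ⟨0, fun y => by positivity⟩)
    · filter_upwards [(h ε hε).filter_mono nhdsWithin_le_nhds] with y hy
      exact div_le_of_le_mul₀ dist_nonneg (by positivity) hy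

theorem eventually_abs_sub_le_of_slopeAt_lt {f : X → ℝ} (hf : ∃ L : ℝ≥0, LipschitzWith L f)
    {x : X} {D : ℝ} (hD : slopeAt f x < D) : ∀ᶠ y in 𝓝 x, |f y - f x| ≤ D * dist y x := by
  obtain ⟨L, hL⟩ := hf
  have h := eventually_lt_of_limsup_lt hD (isBoundedUnder_slope hL x)
  rw [eventually_nhdsWithin_iff] at h
  filter_upwards [h] with y hy
  rcases eq_or_ne y x with rfl | hne
  · simp
  · have := hy hne
    rw [div_lt_iff₀ (dist_pos.2 hne)] at this
    exact this.le

/-- Mean value inequality for a Lipschitz function along a Lipschitz curve. -/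
theorem sub_le_of_slopeAt_le_along {G : X → ℝ} (hG : ∃ L : ℝ≥0, LipschitzWith L G) {c : ℝ → X}
    {l : ℝ≥0} (hc : LipschitzWith l c) {a b D : ℝ} (hab : a ≤ b)
    (hD : ∀ s ∈ Set.Ico a b, slopeAt G (c s) ≤ D) :
    G (c b) - G (c a) ≤ D * l * (b - a) := by
  have hGc : Continuous fun s => G (c s) := by
    obtain ⟨L, hL⟩ := hG
    exact hL.continuous.comp hc.continuous
  have key := image_le_of_liminf_slope_right_le_deriv_boundary (f := fun s => G (c s))
    (B := fun s => G (c a) + D * l * (s - a)) (B' := fun _ => D * l) (a := a) (b := b)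
    hGc.continuousOn (by simp) (by fun_prop) ?_ ?_ (Set.right_mem_Icc.2 hab)
  · linarith
  · intro s _
    have := ((((hasDerivAt_id s).sub_const a).const_mul (D * (l : ℝ))).const_add (G (c a)))
    simpa using this.hasDerivWithinAt
  · intro s hs r hr
    obtain ⟨ε, hε, hεr⟩ : ∃ ε > 0, (D + ε) * l < r := by
      refine ⟨(r - D * l) / (2 * (l + 1)), by have := sub_pos.2 hr; positivity, ?_⟩
      have h2 : (r - D * l) / (2 * (l + 1)) * l ≤ (r - D * l) / 2 := by
        rw [div_mul_eq_mul_div, div_le_div_iff₀ (by positivity) (by positivity)]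
        nlinarith [sub_pos.2 hr, l.2]
      nlinarith
    have hev := hc.continuous.continuousAt.eventually
      (eventually_abs_sub_le_of_slopeAt_lt hG ((hD s hs).trans_lt (lt_add_of_pos_right D hε)))
    refine Eventually.frequently ?_
    filter_upwards [hev.filter_mono nhdsWithin_le_nhds, self_mem_nhdsWithin] with z hz hsz
    have hsz' : 0 < z - s := sub_pos.2 hsz
    rw [slope_def_field, div_lt_iff₀ hsz']
    have h0 : 0 ≤ D := (slopeAt_nonneg G (c s) hG).trans (hD s hs)
    have h1 := hc.dist_le_mul z s
    rw [Real.dist_eq, abs_of_pos hsz'] at h1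
    calc G (c z) - G (c s) ≤ (D + ε) * dist (c z) (c s) := (le_abs_self _).trans hz
      _ ≤ (D + ε) * (l * (z - s)) := by gcongr
      _ < r * (z - s) := by nlinarith

end Slope

section HopfLax

variable {X : Type*} [MetricSpace X]

/-- The Hopf–Lax evolution `Q_t f (x) = inf_y f(y) + d(x,y)²/(2t)`. -/
noncomputable def hopfLax (f : X → ℝ) (t : ℝ) (x : X) : ℝ :=
  ⨅ y, (f y + dist x y ^ 2 / (2 * t))

variable {f : X → ℝ} {M : ℝ} (hf : ∀ x, |f x| ≤ M)

include hf

theorem hopfLax_le {t : ℝ} (ht : 0 < t) (x y : X) :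
    hopfLax f t x ≤ f y + dist x y ^ 2 / (2 * t) := by
  refine ciInf_le ⟨-M, ?_⟩ y
  rintro _ ⟨z, rfl⟩
  have := (abs_le.1 (hf z)).1
  have : 0 ≤ dist x z ^ 2 / (2 * t) := by positivity
  simp only
  linarith

theorem hopfLax_le_self {t : ℝ} (ht : 0 < t) (x : X) : hopfLax f t x ≤ f x := by
  simpa using hopfLax_le hf ht x x

omit hf in
theorem exists_lt_hopfLax_add (f : X → ℝ) (t : ℝ) (x : X) {ε : ℝ} (hε : 0 < ε) :
    ∃ y, f y + dist x y ^ 2 / (2 * t) < hopfLax f t x + ε :=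
  have : Nonempty X := ⟨x⟩
  exists_lt_of_ciInf_lt (lt_add_of_pos_right _ hε)

theorem abs_hopfLax_le {t : ℝ} (ht : 0 < t) (x : X) : |hopfLax f t x| ≤ M := by
  refine abs_le.2 ⟨?_, (hopfLax_le_self hf ht x).trans (abs_le.1 (hf x)).2⟩
  have : Nonempty X := ⟨x⟩
  refine le_ciInf fun y => ?_
  have := (abs_le.1 (hf y)).1
  have : 0 ≤ dist x y ^ 2 / (2 * t) := by positivity
  linarith

theorem hopfLax_sub_le_of_near_minimizers {s : ℝ} (hs : 0 < s) {a b : ℝ} (ha : 0 < a) {x : X}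
    (h : ∀ y, ∀ ε > 0, f y + dist x y ^ 2 / (2 * s) ≤ hopfLax f s x + ε →
      a * dist x y ^ 2 ≤ b + ε) (z : X) :
    hopfLax f s z - hopfLax f s x ≤
      (2 * Real.sqrt (b / a) + dist x z) / (2 * s) * dist x z := by
  have hlim : Tendsto (fun ε : ℝ => ε +
      (2 * Real.sqrt ((b + ε) / a) + dist x z) / (2 * s) * dist x z) (𝓝[>] 0)
      (𝓝 (0 + (2 * Real.sqrt ((b + 0) / a) + dist x z) / (2 * s) * dist x z)) := by
    refine Tendsto.mono_left (Continuous.tendsto ?_ 0) nhdsWithin_le_nhds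
    fun_prop
  rw [zero_add, add_zero] at hlim
  refine ge_of_tendsto hlim ?_
  filter_upwards [self_mem_nhdsWithin] with ε (hε : 0 < ε)
  obtain ⟨y, hy⟩ := exists_lt_hopfLax_add f s x hε
  have h1 := hopfLax_le hf hs z y
  have h2 : dist x y ≤ Real.sqrt ((b + ε) / a) := by
    refine Real.le_sqrt_of_sq_le ?_
    rw [le_div_iff₀ ha]
    linarith [h y ε hε hy.le]
  have h3 : dist z y ≤ dist x z + dist x y := by
    simpa [dist_comm] using dist_triangle z x y
  have h4 : dist z y ^ 2 / (2 * s) - dist x y ^ 2 / (2 * s) ≤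
      (2 * Real.sqrt ((b + ε) / a) + dist x z) / (2 * s) * dist x z := by
    rw [← sub_div, div_mul_eq_mul_div]
    gcongr
    have := dist_nonneg (x := x) (y := z)
    have := dist_nonneg (x := z) (y := y)
    nlinarith
  linarith

theorem abs_hopfLax_sub_le {s : ℝ} (hs : 0 < s) (x z : X) :
    |hopfLax f s z - hopfLax f s x| ≤ 3 * Real.sqrt (M / s) * dist x z := by
  have hM : 0 ≤ M := (abs_nonneg _).trans (hf x)
  have key : ∀ x z : X, hopfLax f s z - hopfLax f s x ≤
      (2 * Real.sqrt (2 * M / (1 / (2 * s))) + dist x z) / (2 * s) * dist x z := by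
    intro x z
    refine hopfLax_sub_le_of_near_minimizers hf hs (by positivity) (fun y ε hε hy => ?_) z
    have := (abs_le.1 (hf y)).1
    have := (abs_le.1 (abs_hopfLax_le hf hs x)).2
    rw [div_mul_eq_mul_div, one_mul]
    linarith
  have hR : Real.sqrt (2 * M / (1 / (2 * s))) = 2 * s * Real.sqrt (M / s) := by
    rw [show 2 * M / (1 / (2 * s)) = (2 * s) ^ 2 * (M / s) by field_simp,
      Real.sqrt_mul (by positivity), Real.sqrt_sq (by positivity)]
  rw [hR] at key
  set R := Real.sqrt (M / s) with hRdef
  have hR0 : 0 ≤ R := Real.sqrt_nonneg _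
  have hR2 : R ^ 2 * s = M := by
    rw [hRdef, Real.sq_sqrt (by positivity)]; field_simp
  have hd := dist_nonneg (x := x) (y := z)
  rcases le_total (dist x z) (2 * s * R) with hle | hle
  · have : (2 * (2 * s * R) + dist x z) / (2 * s) * dist x z ≤ 3 * R * dist x z := by
      gcongr
      rw [div_le_iff₀ (by positivity)]
      linarith
    refine abs_le.2 ⟨?_, (key x z).trans this⟩
    have h2 := key z x
    rw [dist_comm z x] at h2
    linarith
  · have h1 := abs_le.1 (abs_hopfLax_le hf hs x)
    have h2 := abs_le.1 (abs_hopfLax_le hf hs z)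
    have h3 : |hopfLax f s z - hopfLax f s x| ≤ 2 * M := by
      rw [abs_le]; constructor <;> linarith
    nlinarith

theorem lipschitzWith_hopfLax {s δ : ℝ} (hδ : 0 < δ) (hs : δ ≤ s) :
    LipschitzWith (Real.toNNReal (3 * Real.sqrt (M / δ))) (hopfLax f s) := by
  refine LipschitzWith.of_dist_le_mul fun z x => ?_
  have hM : 0 ≤ M := (abs_nonneg _).trans (hf x)
  rw [Real.coe_toNNReal _ (by positivity), Real.dist_eq, dist_comm z x]
  refine (abs_hopfLax_sub_le hf (hδ.trans_le hs) x z).trans ?_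
  gcongr

theorem dist_sq_le_of_near_minimizer {s t : ℝ} (hs : 0 < s) (hst : s < t) {x y : X} {ε : ℝ}
    (hy : f y + dist x y ^ 2 / (2 * s) ≤ hopfLax f s x + ε) :
    (t - s) / (2 * t * s) * dist x y ^ 2 ≤ hopfLax f s x - hopfLax f t x + ε := by
  have ht := hs.trans hst
  have h1 := hopfLax_le hf ht x y
  have h2 : (t - s) / (2 * t * s) * dist x y ^ 2 =
      dist x y ^ 2 / (2 * s) - dist x y ^ 2 / (2 * t) := by
    field_simp
  linarith

theorem hopfLax_antitone {s t : ℝ} (hs : 0 < s) (hst : s ≤ t) (x : X) :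
    hopfLax f t x ≤ hopfLax f s x := by
  have : Nonempty X := ⟨x⟩
  refine le_ciInf fun y => (hopfLax_le hf (hs.trans_le hst) x y).trans ?_
  gcongr

theorem hopfLax_sub_le_mul {s t : ℝ} (hs : 0 < s) (hst : s ≤ t) (x : X) :
    hopfLax f s x - hopfLax f t x ≤ 2 * M / s * (t - s) := by
  have ht := hs.trans_le hst
  refine le_of_forall_pos_le_add fun ε hε => ?_
  have hM : 0 ≤ M := (abs_nonneg _).trans (hf x)
  have hq : 0 ≤ (t - s) / s := div_nonneg (sub_nonneg.2 hst) hs.le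
  have hη : 0 < ε / (1 + (t - s) / s) := by positivity
  obtain ⟨y, hy⟩ := exists_lt_hopfLax_add f t x hη
  have h1 := hopfLax_le hf hs x y
  have h3 := (abs_le.1 (abs_hopfLax_le hf ht x)).2
  have h4 := (abs_le.1 (hf y)).1
  have h5 : dist x y ^ 2 / (2 * s) - dist x y ^ 2 / (2 * t) =
      dist x y ^ 2 / (2 * t) * ((t - s) / s) := by field_simp
  have h6 : dist x y ^ 2 / (2 * t) ≤ 2 * M + ε / (1 + (t - s) / s) := by linarith
  have h7 := mul_le_mul_of_nonneg_right h6 hq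
  have h8 : ε / (1 + (t - s) / s) * (1 + (t - s) / s) = ε :=
    div_mul_cancel₀ _ (by positivity)
  have h9 : 2 * M / s * (t - s) = 2 * M * ((t - s) / s) := by ring
  rw [h9]
  nlinarith

theorem slopeAt_hopfLax_sq_le {s t : ℝ} (hs : 0 < s) (hst : s < t) (x : X) :
    slopeAt (hopfLax f s) x ^ 2 ≤
      2 * t / (s * (t - s)) * (hopfLax f s x - hopfLax f t x) := by
  have ht := hs.trans hst
  have hts := sub_pos.2 hst
  have hLip : ∀ r, s ≤ r → LipschitzWith _ (hopfLax f r) := fun r hr =>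
    lipschitzWith_hopfLax hf hs hr
  set R : X → ℝ := fun x =>
    Real.sqrt ((hopfLax f s x - hopfLax f t x) / ((t - s) / (2 * t * s))) with hR
  have hRc : Continuous R := by
    have h1 := (hLip s le_rfl).continuous
    have h2 := (hLip t hst.le).continuous
    fun_prop
  have key : ∀ x z : X, hopfLax f s z - hopfLax f s x ≤
      (2 * R x + dist x z) / (2 * s) * dist x z := fun x z =>
    hopfLax_sub_le_of_near_minimizers hf hs (by positivity)
      (fun y ε _ hy => dist_sq_le_of_near_minimizer hf hs hst hy) z
  have hR0 : ∀ x, 0 ≤ R x := fun x => Real.sqrt_nonneg _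
  have h1 : slopeAt (hopfLax f s) x ≤ R x / s := by
    refine slopeAt_le (div_nonneg (hR0 x) hs.le) fun ε hε => ?_
    have hc1 : Tendsto (fun z => (2 * R x + dist x z) / (2 * s)) (𝓝 x)
        (𝓝 ((2 * R x + dist x x) / (2 * s))) := Continuous.tendsto (by fun_prop) x
    have hc2 : Tendsto (fun z => (2 * R z + dist z x) / (2 * s)) (𝓝 x)
        (𝓝 ((2 * R x + dist x x) / (2 * s))) := Continuous.tendsto (by fun_prop) x
    have hval : (2 * R x + dist x x) / (2 * s) < R x / s + ε := by
      rw [dist_self, add_zero, mul_div_mul_left _ _ two_ne_zero]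
      linarith
    filter_upwards [hc1.eventually_lt_const hval, hc2.eventually_lt_const hval] with z h1 h2
    have k1 := key x z
    have k2 := key z x
    have m1 := mul_le_mul_of_nonneg_right h1.le (dist_nonneg (x := z) (y := x))
    have m2 := mul_le_mul_of_nonneg_right h2.le (dist_nonneg (x := z) (y := x))
    rw [dist_comm x z] at k1 m1
    rw [abs_le]
    constructor <;> linarith
  have h0 := slopeAt_nonneg (hopfLax f s) x ⟨_, hLip s le_rfl⟩
  calc slopeAt (hopfLax f s) x ^ 2 ≤ (R x / s) ^ 2 := by gcongr
    _ = _ := by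
      have := hopfLax_antitone hf hs hst.le x
      rw [div_pow, hR, Real.sq_sqrt (div_nonneg (by linarith) (by positivity))]
      field_simp

end HopfLax

section Kuwada

variable {X : Type*} [MetricSpace X] [MeasurableSpace X] [BorelSpace X]

theorem integrable_of_continuous_of_abs_le (μ : Measure X) [IsFiniteMeasure μ]
    {g : X → ℝ} (hg : Continuous g) {M : ℝ} (hM : ∀ x, |g x| ≤ M) : Integrable g μ :=
  Integrable.of_bound (hg.measurable.aestronglyMeasurable) M (Eventually.of_forall hM)

variable {f : X → ℝ} {M : ℝ} (hf : ∀ x, |f x| ≤ M)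

include hf

theorem integrable_hopfLax (μ : Measure X) [IsFiniteMeasure μ] {t : ℝ} (ht : 0 < t) :
    Integrable (hopfLax f t) μ :=
  integrable_of_continuous_of_abs_le μ (lipschitzWith_hopfLax hf ht le_rfl).continuous
    (abs_hopfLax_le hf ht)

theorem integral_hopfLax_antitone (μ : Measure X) [IsFiniteMeasure μ] {s t : ℝ}
    (hs : 0 < s) (hst : s ≤ t) : ∫ y, hopfLax f t y ∂μ ≤ ∫ y, hopfLax f s y ∂μ :=
  integral_mono (integrable_hopfLax hf μ (hs.trans_le hst)) (integrable_hopfLax hf μ hs)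
    (hopfLax_antitone hf hs hst)

theorem integral_hopfLax_sub_le (μ : Measure X) [IsProbabilityMeasure μ] {s t : ℝ}
    (hs : 0 < s) (hst : s ≤ t) :
    ∫ y, hopfLax f s y ∂μ - ∫ y, hopfLax f t y ∂μ ≤ 2 * M / s * (t - s) := by
  rw [← integral_sub (integrable_hopfLax hf μ hs) (integrable_hopfLax hf μ (hs.trans_le hst))]
  calc _ ≤ ∫ _, 2 * M / s * (t - s) ∂μ := by
        refine integral_mono ((integrable_hopfLax hf μ hs).sub
          (integrable_hopfLax hf μ (hs.trans_le hst))) (integrable_const _)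
          (hopfLax_sub_le_mul hf hs hst)
    _ = _ := by simp

variable {C : ℝ≥0} {κ : X → Measure X} (hκprob : ∀ x, IsProbabilityMeasure (κ x))
    (hLip : ∀ (f : X → ℝ) (L : ℝ≥0), LipschitzWith L f → (∃ M, ∀ x, |f x| ≤ M) →
      LipschitzWith (C * L) (fun x => ∫ y, f y ∂ κ x))
    (hBE : ∀ f : X → ℝ, (∃ L : ℝ≥0, LipschitzWith L f) → (∃ M, ∀ x, |f x| ≤ M) →
      ∀ x : X, slopeAt (fun z => ∫ y, f y ∂ κ z) x ^ 2 ≤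
        (C : ℝ) ^ 2 * ∫ y, slopeAt f y ^ 2 ∂ κ x)

include hκprob hLip hBE

omit hLip in
theorem slopeAt_integral_hopfLax_sq_le {s t : ℝ} (hs : 0 < s) (hst : s < t) (x : X) :
    slopeAt (fun z => ∫ y, hopfLax f s y ∂ κ z) x ^ 2 ≤
      (C : ℝ) ^ 2 * (2 * t / (s * (t - s)) *
        (∫ y, hopfLax f s y ∂ κ x - ∫ y, hopfLax f t y ∂ κ x)) := by
  have ht := hs.trans hst
  refine (hBE (hopfLax f s) ⟨_, lipschitzWith_hopfLax hf hs le_rfl⟩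
    ⟨M, abs_hopfLax_le hf hs⟩ x).trans ?_
  gcongr
  have := hκprob x
  have i1 := integrable_hopfLax hf (κ x) hs
  have i2 := integrable_hopfLax hf (κ x) ht
  rw [← integral_sub i1 i2, ← integral_const_mul]
  exact integral_mono_of_nonneg (Eventually.of_forall fun y => sq_nonneg _)
    ((i1.sub i2).const_mul _) (Eventually.of_forall fun y => slopeAt_hopfLax_sq_le hf hs hst y)

theorem integral_hopfLax_sub_along_le {c : ℝ → X} {l : ℝ≥0} (hc : LipschitzWith l c)
    {t z w : ℝ} (ht : 0 < t) (htz : t < z) (hzw : z < w) :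
    ∫ y, hopfLax f z y ∂ κ (c z) - ∫ y, hopfLax f z y ∂ κ (c t) ≤
      Real.sqrt ((C : ℝ) ^ 2 * (2 * w / (z * (w - z)) *
        ((∫ y, hopfLax f t y ∂ κ (c t) - ∫ y, hopfLax f w y ∂ κ (c t)) +
          2 * (C * (3 * Real.sqrt (M / t)) * l) * (z - t)))) * l * (z - t) := by
  have hz := ht.trans htz
  have hM : 0 ≤ M := (abs_nonneg _).trans (hf (c 0))
  have hPLip : ∀ r, t ≤ r → LipschitzWith _ (fun x => ∫ y, hopfLax f r y ∂ κ x) := fun r hr =>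
    hLip _ _ (lipschitzWith_hopfLax hf ht hr) ⟨M, abs_hopfLax_le hf (ht.trans_le hr)⟩
  refine sub_le_of_slopeAt_le_along (G := fun x => ∫ y, hopfLax f z y ∂ κ x)
    ⟨_, hPLip z htz.le⟩ hc htz.le fun s hs => ?_
  refine Real.le_sqrt_of_sq_le
    ((slopeAt_integral_hopfLax_sq_le hf hκprob hBE hz hzw (c s)).trans ?_)
  have hwz := sub_pos.2 hzw
  have hw := hz.trans hzw
  gcongr
  have hvar : ∀ r, t ≤ r → |∫ y, hopfLax f r y ∂ κ (c s) - ∫ y, hopfLax f r y ∂ κ (c t)| ≤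
      C * (3 * Real.sqrt (M / t)) * l * (z - t) := by
    intro r hr
    have h1 := (hPLip r hr).dist_le_mul (c s) (c t)
    have h2 := hc.dist_le_mul s t
    rw [Real.dist_eq, abs_of_nonneg (sub_nonneg.2 hs.1)] at h2
    rw [Real.dist_eq, NNReal.coe_mul, Real.coe_toNNReal _ (by positivity)] at h1
    refine h1.trans ?_
    rw [mul_assoc (_ * _)]
    gcongr
    refine h2.trans ?_
    gcongr
    exact hs.2.le
  have h1 := abs_le.1 (hvar t le_rfl)
  have h2 := abs_le.1 (hvar w (htz.trans hzw).le)
  have := hκprob (c s)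
  have h3 := integral_hopfLax_antitone hf (κ (c s)) ht htz.le
  linarith

theorem frequently_slope_integral_hopfLax_lt {c : ℝ → X} {l : ℝ≥0} (hc : LipschitzWith l c)
    {t r : ℝ} (ht : 0 < t) (hr : (C * l : ℝ) ^ 2 / 2 < r) :
    ∃ᶠ z in 𝓝[>] t, slope (fun s => ∫ y, hopfLax f s y ∂ κ (c s)) t z < r := by
  have hM : 0 ≤ M := (abs_nonneg _).trans (hf (c 0))
  set B : ℝ → ℝ := fun z =>
    (∫ y, hopfLax f t y ∂ κ (c t) - ∫ y, hopfLax f z y ∂ κ (c t)) / (z - t) with hB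
  have := hκprob (c t)
  have hBnn : ∀ᶠ z in 𝓝[>] t, 0 ≤ B z := by
    filter_upwards [self_mem_nhdsWithin] with z (hz : t < z)
    exact div_nonneg (sub_nonneg.2 (integral_hopfLax_antitone hf _ ht hz.le))
      (sub_nonneg.2 hz.le)
  have hBle : ∀ᶠ z in 𝓝[>] t, B z ≤ 2 * M / t := by
    filter_upwards [self_mem_nhdsWithin] with z (hz : t < z)
    rw [div_le_iff₀ (sub_pos.2 hz)]
    exact integral_hopfLax_sub_le hf _ ht hz.le
  set ε := (r - (C * l : ℝ) ^ 2 / 2) / 3 with hε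
  have hε0 : 0 < ε := by rw [hε]; linarith
  set b := limsup B (𝓝[>] t) with hb
  have hlt : ∀ᶠ w in 𝓝[>] t, B w < b + ε :=
    eventually_lt_of_limsup_lt (lt_add_of_pos_right _ hε0) ⟨_, hBle⟩
  have hgt : ∃ᶠ z in 𝓝[>] t, b - ε < B z :=
    frequently_lt_of_lt_limsup (IsBoundedUnder.isCoboundedUnder_le ⟨0, hBnn⟩)
      (sub_lt_self _ hε0)
  have hw1 : ∀ᶠ w in 𝓝[>] t, (C * l : ℝ) ^ 2 / 2 * (w / t) < (C * l : ℝ) ^ 2 / 2 + ε := by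
    have : Tendsto (fun w => (C * l : ℝ) ^ 2 / 2 * (w / t)) (𝓝[>] t)
        (𝓝 ((C * l : ℝ) ^ 2 / 2 * (t / t))) :=
      (Continuous.tendsto (by fun_prop) t).mono_left nhdsWithin_le_nhds
    refine this.eventually_lt_const ?_
    rw [div_self ht.ne']
    linarith
  obtain ⟨w, hwB, hw1, hwnn, htw⟩ :=
    (hlt.and (hw1.and (hBnn.and self_mem_nhdsWithin))).exists
  change t < w at htw
  have hwt := sub_pos.2 htw
  set A : ℝ → ℝ := fun z => Real.sqrt ((C : ℝ) ^ 2 * (2 * w / (z * (w - z)) *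
        ((∫ y, hopfLax f t y ∂ κ (c t) - ∫ y, hopfLax f w y ∂ κ (c t)) +
          2 * (C * (3 * Real.sqrt (M / t)) * l) * (z - t)))) * l with hA
  have hAt : A t = Real.sqrt (2 * (w / t) * B w) * (C * l) := by
    have : (∫ y, hopfLax f t y ∂ κ (c t) - ∫ y, hopfLax f w y ∂ κ (c t)) = B w * (w - t) := by
      rw [hB]; field_simp
    rw [hA]
    simp only [sub_self, mul_zero, add_zero]
    rw [this, Real.sqrt_mul (sq_nonneg _), Real.sqrt_sq C.coe_nonneg,
      show 2 * w / (t * (w - t)) * (B w * (w - t)) = 2 * (w / t) * B w by field_simp]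
    ring
  have hAt_lt : A t < (C * l : ℝ) ^ 2 / 2 + b + 2 * ε := by
    have hq : 0 ≤ w / t := by have := ht.trans htw; positivity
    have h1 : Real.sqrt (2 * (w / t) * B w) * (C * l) ≤
        (C * l : ℝ) ^ 2 / 2 * (w / t) + B w := by
      rw [show 2 * (w / t) * B w = (w / t) * (2 * B w) by ring, Real.sqrt_mul hq]
      nlinarith [sq_nonneg (Real.sqrt (w / t) * (C * l) - Real.sqrt (2 * B w)),
        Real.sq_sqrt hq, Real.sq_sqrt (show 0 ≤ 2 * B w by linarith)]
    rw [hAt]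
    linarith
  have hAc : ContinuousAt A t := by
    have : t * (w - t) ≠ 0 := by positivity
    rw [hA]
    fun_prop (disch := assumption)
  have hA_lt : ∀ᶠ z in 𝓝[>] t, A z < (C * l : ℝ) ^ 2 / 2 + b + 2 * ε :=
    (hAc.tendsto.eventually_lt_const hAt_lt).filter_mono nhdsWithin_le_nhds
  have hzw : ∀ᶠ z in 𝓝[>] t, z < w :=
    (eventually_lt_nhds htw).filter_mono nhdsWithin_le_nhds
  refine (hgt.and_eventually (hA_lt.and (hzw.and self_mem_nhdsWithin))).mono ?_
  rintro z ⟨h1, h2, h3, h4⟩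
  change t < z at h4
  have hzt := sub_pos.2 h4
  rw [slope_def_field, div_lt_iff₀ hzt]
  have k1 := integral_hopfLax_sub_along_le hf hκprob hLip hBE hc ht h4 h3
  change _ ≤ A z * (z - t) at k1
  have k2 : ∫ y, hopfLax f z y ∂ κ (c t) - ∫ y, hopfLax f t y ∂ κ (c t) =
      - B z * (z - t) := by
    rw [hB]; field_simp; ring
  have k3 : (A z - B z) * (z - t) < r * (z - t) := by
    gcongr
    linarith
  linarith

/-- The key estimate of Kuwada's duality, along a Lipschitz curve. -/
theorem integral_hopfLax_one_sub_le {L : ℝ≥0} (hfL : LipschitzWith L f) {c : ℝ → X} {l : ℝ≥0}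
    (hc : LipschitzWith l c) :
    ∫ y, hopfLax f 1 y ∂ κ (c 1) - ∫ y, f y ∂ κ (c 0) ≤ (C * l : ℝ) ^ 2 / 2 := by
  have hM : 0 ≤ M := (abs_nonneg _).trans (hf (c 0))
  have key : ∀ δ ∈ Set.Ioo (0 : ℝ) 1, ∫ y, hopfLax f 1 y ∂ κ (c 1) - ∫ y, f y ∂ κ (c 0) ≤
      (C * l : ℝ) ^ 2 / 2 * (1 - δ) + C * L * (l * δ) := by
    rintro δ ⟨hδ, hδ1⟩
    set F : ℝ → ℝ := fun s => ∫ y, hopfLax f s y ∂ κ (c s) with hF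
    have hFc : ContinuousOn F (Set.Icc δ 1) := by
      have hle : ∀ s ∈ Set.Icc δ 1, ∀ t ∈ Set.Icc δ 1, s ≤ t →
          |F s - F t| ≤ (C * (3 * Real.sqrt (M / δ)) * l + 2 * M / δ) * |s - t| := by
        intro s hs t ht hst
        have := hκprob (c t)
        have hs0 := hδ.trans_le hs.1
        have h1 := integral_hopfLax_antitone hf (κ (c t)) hs0 hst
        have h2 := integral_hopfLax_sub_le hf (κ (c t)) hs0 hst
        have h3 := (hLip _ _ (lipschitzWith_hopfLax hf hδ hs.1)
          ⟨M, abs_hopfLax_le hf hs0⟩).dist_le_mul (c s) (c t)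
        have h4 := hc.dist_le_mul s t
        rw [Real.dist_eq, NNReal.coe_mul, Real.coe_toNNReal _ (by positivity)] at h3
        have h5 := h3.trans (mul_le_mul_of_nonneg_left h4 (by positivity))
        have h6 : 2 * M / s * (t - s) ≤ 2 * M / δ * |s - t| := by
          rw [abs_sub_comm, abs_of_nonneg (sub_nonneg.2 hst)]
          have := hs.1
          have := sub_nonneg.2 hst
          gcongr
        have h7 := abs_le.1 h5
        rw [Real.dist_eq] at h7
        have h8 : 0 ≤ 2 * M / δ * |s - t| := by positivity
        rw [abs_le]
        simp only [hF]
        constructor <;> nlinarith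
      refine LipschitzOnWith.continuousOn
        (K := Real.toNNReal (C * (3 * Real.sqrt (M / δ)) * l + 2 * M / δ))
        (LipschitzOnWith.of_dist_le_mul fun s hs t ht => ?_)
      rw [Real.coe_toNNReal _ (by positivity), Real.dist_eq, Real.dist_eq]
      rcases le_total s t with hst | hst
      · exact hle s hs t ht hst
      · rw [abs_sub_comm, abs_sub_comm s]
        exact hle t ht s hs hst
    have h1 := image_le_of_liminf_slope_right_le_deriv_boundary hFc
      (B := fun s => F δ + (C * l : ℝ) ^ 2 / 2 * (s - δ)) (B' := fun _ => (C * l : ℝ) ^ 2 / 2)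
      (by simp) (by fun_prop) (fun s _ => by
        have := ((((hasDerivAt_id s).sub_const δ).const_mul ((C * l : ℝ) ^ 2 / 2))).const_add (F δ)
        simpa using this.hasDerivWithinAt)
      (fun s hs r hr => frequently_slope_integral_hopfLax_lt hf hκprob hLip hBE hc
        (hδ.trans_le hs.1) hr) (Set.right_mem_Icc.2 hδ1.le)
    have h2 : F δ ≤ ∫ y, f y ∂ κ (c δ) := by
      have := hκprob (c δ)
      exact integral_mono (integrable_hopfLax hf _ hδ)
        (integrable_of_continuous_of_abs_le _ hfL.continuous hf) (hopfLax_le_self hf hδ)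
    have h3 := (hLip f L hfL ⟨M, hf⟩).dist_le_mul (c δ) (c 0)
    have h4 := hc.dist_le_mul δ 0
    rw [Real.dist_eq, sub_zero, abs_of_pos hδ] at h4
    have h5 := h3.trans (mul_le_mul_of_nonneg_left h4 (by positivity))
    rw [Real.dist_eq] at h5
    have h6 := (abs_le.1 h5).2
    push_cast at h6
    simp only [hF] at h1 h2
    linarith
  have hlim : Tendsto (fun δ : ℝ => (C * l : ℝ) ^ 2 / 2 * (1 - δ) + C * L * (l * δ)) (𝓝[>] 0)
      (𝓝 ((C * l : ℝ) ^ 2 / 2 * (1 - 0) + C * L * (l * 0))) :=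
    (Continuous.tendsto (by fun_prop) 0).mono_left nhdsWithin_le_nhds
  rw [sub_zero, mul_one, mul_zero, mul_zero, add_zero] at hlim
  refine ge_of_tendsto hlim ?_
  filter_upwards [Ioo_mem_nhdsGT one_pos] with δ hδ using key δ hδ

end Kuwada

section LengthSpace

variable {X : Type*} [MetricSpace X]

/-- In a length space, points at distance `< l` are joined by an `l`-Lipschitz curve on `[0,1]`. -/
theorem IsLengthSpace.exists_lipschitzWith (hX : IsLengthSpace X) {x y : X} {l : ℝ≥0}
    (hl : dist x y < l) : ∃ c : ℝ → X, LipschitzWith l c ∧ c 0 = x ∧ c 1 = y := by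
  have h := hX x y
  have hlt : ENNReal.ofReal (dist x y) < l := by
    rwa [← ENNReal.ofReal_coe_nnreal, ENNReal.ofReal_lt_ofReal_iff (dist_nonneg.trans_lt hl)]
  rw [h] at hlt
  simp only [iInf_lt_iff] at hlt
  obtain ⟨γ, ⟨L, hL⟩, h0, h1, hγ⟩ := hlt
  set I : Set ℝ := Set.Icc 0 1
  have hbv : BoundedVariationOn γ I := (hγ.trans ENNReal.coe_lt_top).ne
  have hloc := hbv.locallyBoundedVariationOn
  have m0 : (0 : ℝ) ∈ I := ⟨le_rfl, zero_le_one⟩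
  have m1 : (1 : ℝ) ∈ I := ⟨zero_le_one, le_rfl⟩
  set v : ℝ → ℝ := variationOnFromTo γ I 0 with hv
  have hsub : ∀ s ∈ I, ∀ r ∈ I, s ≤ r →
      v r - v s = (eVariationOn γ (I ∩ Set.Icc s r)).toReal := by
    intro s hs r hr hsr
    rw [hv, ← variationOnFromTo.add hloc m0 hs hr, variationOnFromTo.eq_of_le _ _ hsr]
    ring
  have hfin : ∀ s r, eVariationOn γ (I ∩ Set.Icc s r) ≠ ⊤ := fun s r =>
    ne_top_of_le_ne_top hbv (eVariationOn.mono _ Set.inter_subset_left)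
  have hdist : ∀ s ∈ I, ∀ r ∈ I, dist (γ s) (γ r) ≤ |v s - v r| := by
    have : ∀ s ∈ I, ∀ r ∈ I, s ≤ r → dist (γ s) (γ r) ≤ |v s - v r| := by
      intro s hs r hr hsr
      rw [abs_sub_comm]
      refine le_trans ?_ (le_abs_self _)
      rw [hsub s hs r hr hsr, dist_edist]
      exact ENNReal.toReal_mono (hfin s r)
        (eVariationOn.edist_le _ ⟨hs, le_rfl, hsr⟩ ⟨hr, hsr, le_rfl⟩)
    intro s hs r hr
    rcases le_total s r with hsr | hsr
    · exact this s hs r hr hsr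
    · rw [dist_comm, abs_sub_comm]
      exact this r hr s hs hsr
  have hvLip : LipschitzOnWith L v I := by
    have : ∀ s ∈ I, ∀ r ∈ I, s ≤ r → |v r - v s| ≤ L * |r - s| := by
      intro s hs r hr hsr
      rw [hsub s hs r hr hsr, abs_of_nonneg ENNReal.toReal_nonneg,
        abs_of_nonneg (sub_nonneg.2 hsr)]
      refine ENNReal.toReal_le_of_le_ofReal (mul_nonneg L.2 (sub_nonneg.2 hsr)) ?_
      have h2 := hL.comp_eVariationOn_le (g := id) (s := I ∩ Set.Icc s r)
        (fun _ h => h.1)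
      rw [(monotone_id.monotoneOn I).eVariationOn_eq hs hr] at h2
      rwa [ENNReal.ofReal_mul L.coe_nonneg, ENNReal.ofReal_coe_nnreal]
    refine LipschitzOnWith.of_dist_le_mul fun s hs r hr => ?_
    rw [Real.dist_eq, Real.dist_eq]
    rcases le_total s r with hsr | hsr
    · rw [abs_sub_comm, abs_sub_comm s]
      exact this s hs r hr hsr
    · exact this r hr s hs hsr
  have hv0 : v 0 = 0 := variationOnFromTo.self _ _ _
  have hv1 : v 1 ≤ l := by
    rw [hv, variationOnFromTo.eq_of_le _ _ zero_le_one, Set.inter_self]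
    exact ENNReal.toReal_le_coe_of_le_coe hγ.le
  have hv1' : 0 ≤ v 1 := by
    rw [hv]
    exact variationOnFromTo.nonneg_of_le _ _ zero_le_one
  have hivt := intermediate_value_Icc (zero_le_one' ℝ) hvLip.continuousOn
  have hex : ∀ a : ℝ, ∃ s ∈ I, v s = v 1 * (Set.projIcc 0 1 zero_le_one a : ℝ) := by
    intro a
    have ha := (Set.projIcc (0 : ℝ) 1 zero_le_one a).2
    refine hivt ⟨?_, ?_⟩
    · rw [hv0]; exact mul_nonneg hv1' ha.1
    · exact mul_le_of_le_one_right hv1' ha.2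
  choose σ hσI hσ using hex
  refine ⟨fun a => γ (σ a), LipschitzWith.of_dist_le_mul fun a b => ?_, ?_, ?_⟩
  · refine (hdist _ (hσI a) _ (hσI b)).trans ?_
    rw [hσ, hσ, ← mul_sub, abs_mul, abs_of_nonneg hv1']
    have := (LipschitzWith.projIcc (zero_le_one' ℝ)).dist_le_mul a b
    rw [Subtype.dist_eq, Real.dist_eq, NNReal.coe_one, one_mul] at this
    exact mul_le_mul hv1 this (abs_nonneg _) l.2
  · rw [← h0]
    refine dist_le_zero.1 ((hdist _ (hσI 0) 0 m0).trans ?_)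
    rw [hσ, hv0]
    simp
  · rw [← h1]
    refine dist_le_zero.1 ((hdist _ (hσI 1) 1 m1).trans ?_)
    rw [hσ]
    simp

end LengthSpace

theorem integral_hopfLax_one_sub_integral_le {X : Type*} [MetricSpace X] [MeasurableSpace X]
    [BorelSpace X] (hX : IsLengthSpace X) {f : X → ℝ} {M : ℝ} (hf : ∀ x, |f x| ≤ M)
    {L : ℝ≥0} (hfL : LipschitzWith L f)
    {C : ℝ≥0} {κ : X → Measure X} (hκprob : ∀ x, IsProbabilityMeasure (κ x))
    (hLip : ∀ (f : X → ℝ) (L : ℝ≥0), LipschitzWith L f → (∃ M, ∀ x, |f x| ≤ M) →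
      LipschitzWith (C * L) (fun x => ∫ y, f y ∂ κ x))
    (hBE : ∀ f : X → ℝ, (∃ L : ℝ≥0, LipschitzWith L f) → (∃ M, ∀ x, |f x| ≤ M) →
      ∀ x : X, slopeAt (fun z => ∫ y, f y ∂ κ z) x ^ 2 ≤
        (C : ℝ) ^ 2 * ∫ y, slopeAt f y ^ 2 ∂ κ x) (x y : X) :
    ∫ z, hopfLax f 1 z ∂ κ x - ∫ z, f z ∂ κ y ≤ (C * dist x y : ℝ) ^ 2 / 2 := by
  have hlim : Tendsto (fun l : ℝ => (C * l : ℝ) ^ 2 / 2) (𝓝[>] (dist x y))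
      (𝓝 ((C * dist x y : ℝ) ^ 2 / 2)) :=
    (Continuous.tendsto (by fun_prop) _).mono_left nhdsWithin_le_nhds
  refine ge_of_tendsto hlim ?_
  filter_upwards [self_mem_nhdsWithin] with l (hl : dist x y < l)
  have hl0 := dist_nonneg.trans_lt hl
  lift l to ℝ≥0 using hl0.le
  rw [dist_comm] at hl
  obtain ⟨c, hc, h0, h1⟩ := hX.exists_lipschitzWith hl
  rw [← h0, ← h1]
  exact integral_hopfLax_one_sub_le hf hκprob hLip hBE hfL hc

theorem StrongDual.apply_pi_prod_pi_prod {ι : Type*} [Fintype ι] [DecidableEq ι]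
    (f : StrongDual ℝ ((ι → ℝ) × (ι → ℝ) × ℝ)) (a b : ι → ℝ) (r : ℝ) :
    f (a, b, r) = ∑ i, a i * f (Pi.single i 1, 0, 0) + ∑ i, b i * f (0, Pi.single i 1, 0)
      + r * f (0, 0, 1) := by
  have h1 : (a, b, r) = ∑ i, a i • ((Pi.single i 1, 0, 0) : (ι → ℝ) × (ι → ℝ) × ℝ)
      + ∑ i, b i • ((0, Pi.single i 1, 0) : (ι → ℝ) × (ι → ℝ) × ℝ)
      + r • ((0, 0, 1) : (ι → ℝ) × (ι → ℝ) × ℝ) := by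
    refine Prod.ext ?_ (Prod.ext ?_ ?_)
    · simpa [Prod.fst_sum] using pi_eq_sum_univ' a
    · simpa [Prod.fst_sum, Prod.snd_sum] using pi_eq_sum_univ' b
    · simp [Prod.snd_sum]
  conv_lhs => rw [h1]
  simp only [map_add, map_sum, map_smul, smul_eq_mul]

/-- Kantorovich duality for finite marginals. -/
theorem exists_transport_plan_of_dual_le {ι : Type*} [Fintype ι] {p q : ι → ℝ}
    (hp : ∀ i, 0 ≤ p i) (hp1 : ∑ i, p i = 1) (hq : ∀ i, 0 ≤ q i) (hq1 : ∑ i, q i = 1)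
    (c : ι → ι → ℝ) {K : ℝ}
    (h : ∀ u v : ι → ℝ, (∀ i j, u i + v j ≤ c i j) → ∑ i, u i * p i + ∑ j, v j * q j ≤ K) :
    ∃ π : ι → ι → ℝ, (∀ i j, 0 ≤ π i j) ∧ (∀ i, ∑ j, π i j = p i) ∧ (∀ j, ∑ i, π i j = q j) ∧
      ∑ i, ∑ j, c i j * π i j ≤ K := by
  classical
  let T : (ι × ι → ℝ) →ₗ[ℝ] (ι → ℝ) × (ι → ℝ) × ℝ :=
    { toFun := fun π => (fun i => ∑ j, π (i, j), fun j => ∑ i, π (i, j),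
        ∑ i, ∑ j, c i j * π (i, j))
      map_add' := fun π π' => by
        refine Prod.ext ?_ (Prod.ext ?_ ?_)
        · ext i; simp [Finset.sum_add_distrib]
        · ext i; simp [Finset.sum_add_distrib]
        · simp [Finset.sum_add_distrib, mul_add]
      map_smul' := fun r π => by
        refine Prod.ext ?_ (Prod.ext ?_ ?_)
        · ext i; simp [Finset.mul_sum]
        · ext i; simp [Finset.mul_sum]
        · simp [Finset.mul_sum, mul_left_comm] }
  have hT : Continuous T := T.continuous_of_finiteDimensional
  let S : Set ((ι → ℝ) × (ι → ℝ) × ℝ) := {p} ×ˢ {q} ×ˢ Set.Iic K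
  have hSconv : Convex ℝ S :=
    (convex_singleton p).prod ((convex_singleton q).prod (convex_Iic K))
  have hSclosed : IsClosed S := isClosed_singleton.prod (isClosed_singleton.prod isClosed_Iic)
  by_cases hdisj : Disjoint (T '' stdSimplex ℝ (ι × ι)) S
  · exfalso
    obtain ⟨f, α, β, hα, hαβ, hβ⟩ := geometric_hahn_banach_compact_closed
      ((convex_stdSimplex ℝ (ι × ι)).linear_image T) ((isCompact_stdSimplex ℝ (ι × ι)).image hT)
      hSconv hSclosed hdisj
    set u : ι → ℝ := fun i => f (Pi.single i 1, 0, 0) with hu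
    set v : ι → ℝ := fun j => f (0, Pi.single j 1, 0) with hv
    set w : ℝ := f (0, 0, 1) with hw
    have hS : ∀ r ≤ K, β < ∑ i, p i * u i + ∑ j, q j * v j + r * w := fun r hr => by
      have := hβ (p, q, r) ⟨rfl, rfl, hr⟩
      rwa [StrongDual.apply_pi_prod_pi_prod] at this
    have hw0 : w ≤ 0 := by
      by_contra! hpos
      have := hS (min K ((β - (∑ i, p i * u i + ∑ j, q j * v j)) / w)) (min_le_left _ _)
      have h2 := mul_le_mul_of_nonneg_right
        (min_le_right K ((β - (∑ i, p i * u i + ∑ j, q j * v j)) / w)) hpos.le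
      rw [div_mul_cancel₀ _ hpos.ne'] at h2
      linarith
    have hij : ∀ i j, u i + v j + c i j * w < α := fun i j => by
      have := hα (T (Pi.single (i, j) 1)) ⟨_, single_mem_stdSimplex ℝ (i, j), rfl⟩
      have e : T (Pi.single (i, j) 1) = (Pi.single i 1, Pi.single j 1, c i j) := by
        refine Prod.ext ?_ (Prod.ext ?_ ?_)
        · ext k; by_cases hk : k = i <;> simp [T, Pi.single_apply, hk, -Finset.sum_boole]
        · ext k; by_cases hk : k = j <;> simp [T, Pi.single_apply, hk, -Finset.sum_boole]
        · simp [T, Pi.single_apply, ite_and]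
      rw [e, StrongDual.apply_pi_prod_pi_prod] at this
      simpa [Pi.single_apply] using this
    have hKα := hS K le_rfl
    rcases hw0.lt_or_eq with hneg | hzero
    · have hl : 0 < -w := by linarith
      have := h (fun i => (u i - α) / -w) (fun j => v j / -w) fun i j => by
        rw [← add_div, div_le_iff₀ hl]; linarith [hij i j]
      have e1 : ∑ i, (u i - α) / -w * p i + ∑ j, v j / -w * q j
          = (∑ i, p i * u i + ∑ j, q j * v j - α) / -w := by
        rw [sub_eq_add_neg, add_right_comm, ← sub_eq_add_neg, add_div]
        congr 1
        · have : α = ∑ i, α * p i := by rw [← Finset.mul_sum, hp1, mul_one]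
          conv_rhs => rw [this]
          rw [← Finset.sum_sub_distrib, Finset.sum_div]
          exact Finset.sum_congr rfl fun i _ => by ring
        · rw [Finset.sum_div]
          exact Finset.sum_congr rfl fun i _ => by ring
      rw [e1, div_le_iff₀ hl] at this
      linarith
    · rw [hzero] at hKα hij
      have e1 : ∑ i, ∑ j, p i * q j * (u i + v j) = ∑ i, p i * u i + ∑ j, q j * v j := by
        have : ∀ i j, p i * q j * (u i + v j) = p i * u i * q j + p i * (q j * v j) :=
          fun i j => by ring
        simp_rw [this, Finset.sum_add_distrib, ← Finset.mul_sum, hq1, ← Finset.sum_mul, hp1]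
        simp
      have e2 : ∑ i, ∑ j, p i * q j * (u i + v j) ≤ ∑ i, ∑ j, p i * q j * α :=
        Finset.sum_le_sum fun i _ => Finset.sum_le_sum fun j _ =>
          mul_le_mul_of_nonneg_left (by linarith [hij i j]) (mul_nonneg (hp i) (hq j))
      simp_rw [← Finset.sum_mul, ← Finset.mul_sum, hq1, ← Finset.sum_mul] at e2
      rw [e1] at e2
      simp only [mul_one, hp1, one_mul] at e2
      linarith
  · obtain ⟨_, ⟨π, hπ, rfl⟩, h1, h2, h3⟩ := Set.not_disjoint_iff.1 hdisj
    exact ⟨fun i j => π (i, j), fun i j => hπ.1 _, fun i => congrFun h1 i,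
      fun j => congrFun h2 j, h3⟩

theorem sum_ofReal_smul_cond {X ι : Type*} [MeasurableSpace X] [Fintype ι] [MeasurableSpace ι]
    [DiscreteMeasurableSpace ι] {μ ν : Measure X} [IsProbabilityMeasure μ]
    [IsProbabilityMeasure ν] {q : X → ι} (hq : Measurable q) {π : ι → ι → ℝ}
    (hπ : ∀ i j, 0 ≤ π i j) (h1 : ∀ i, ∑ j, π i j = μ.real (q ⁻¹' {i}))
    (h2 : ∀ j, ∑ i, π i j = ν.real (q ⁻¹' {j})) :
    ∑ i, ∑ j, ENNReal.ofReal (π i j) •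
      (ProbabilityTheory.cond ν (q ⁻¹' {j})) Set.univ • ProbabilityTheory.cond μ (q ⁻¹' {i})
      = μ := by
  have key : ∀ i j, ENNReal.ofReal (π i j) •
      (ProbabilityTheory.cond ν (q ⁻¹' {j})) Set.univ • ProbabilityTheory.cond μ (q ⁻¹' {i})
      = ENNReal.ofReal (π i j) • ProbabilityTheory.cond μ (q ⁻¹' {i}) := fun i j => by
    by_cases h0 : ν (q ⁻¹' {j}) = 0
    · have : π i j = 0 := by
        have := h2 j
        rw [measureReal_def, h0, ENNReal.toReal_zero,
          Finset.sum_eq_zero_iff_of_nonneg fun i _ => hπ i j] at this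
        exact this i (Finset.mem_univ i)
      simp [this]
    · have := ProbabilityTheory.cond_isProbabilityMeasure h0
      simp
  simp_rw [key, ← Finset.sum_smul]
  conv_rhs => rw [← ProbabilityTheory.sum_meas_smul_cond_fiber hq μ]
  refine Finset.sum_congr rfl fun i _ => ?_
  rw [← ENNReal.ofReal_sum_of_nonneg fun j _ => hπ i j, h1, ofReal_measureReal]

/-- A coupling of the push-forwards of `μ` and `ν` to a finite set lifts to a coupling of `μ`
and `ν`. -/
theorem exists_coupling_of_finite {X ι : Type*} [MeasurableSpace X] [Fintype ι]
    [MeasurableSpace ι] [DiscreteMeasurableSpace ι] {μ ν : Measure X} [IsProbabilityMeasure μ]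
    [IsProbabilityMeasure ν] {q : X → ι} (hq : Measurable q) {π : ι → ι → ℝ}
    (hπ : ∀ i j, 0 ≤ π i j) (h1 : ∀ i, ∑ j, π i j = μ.real (q ⁻¹' {i}))
    (h2 : ∀ j, ∑ i, π i j = ν.real (q ⁻¹' {j})) :
    ∃ γ : Measure (X × X), (γ.map Prod.fst = μ ∧ γ.map Prod.snd = ν) ∧
      ∀ h : ι → ι → ℝ, ∫ z, h (q z.1) (q z.2) ∂γ = ∑ i, ∑ j, h i j * π i j := by
  classical
  let μ' : ι → Measure X := fun i => ProbabilityTheory.cond μ (q ⁻¹' {i})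
  let ν' : ι → Measure X := fun i => ProbabilityTheory.cond ν (q ⁻¹' {i})
  refine ⟨∑ i, ∑ j, ENNReal.ofReal (π i j) • (μ' i).prod (ν' j), ⟨?_, ?_⟩, fun h => ?_⟩
  · rw [Measure.map_finset_sum' measurable_fst.aemeasurable]
    simp_rw [Measure.map_finset_sum' measurable_fst.aemeasurable, Measure.map_smul,
      Measure.map_fst_prod]
    exact sum_ofReal_smul_cond hq hπ h1 h2
  · rw [Measure.map_finset_sum' measurable_snd.aemeasurable]
    simp_rw [Measure.map_finset_sum' measurable_snd.aemeasurable, Measure.map_smul,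
      Measure.map_snd_prod]
    rw [Finset.sum_comm]
    exact sum_ofReal_smul_cond hq (fun i j => hπ j i) h2 h1
  · have hmeas : ∀ i, MeasurableSet (q ⁻¹' {i}) := fun i => hq (measurableSet_singleton i)
    have hae : ∀ i j, (fun z : X × X => h (q z.1) (q z.2)) =ᵐ[(μ' i).prod (ν' j)]
        fun _ => h i j := fun i j => by
      filter_upwards
        [Measure.quasiMeasurePreserving_fst.ae (ProbabilityTheory.ae_cond_mem (hmeas i)),
        Measure.quasiMeasurePreserving_snd.ae (ProbabilityTheory.ae_cond_mem (hmeas j))]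
        with z h1 h2
      rw [show q z.1 = i from h1, show q z.2 = j from h2]
    have hint : ∀ i j, Integrable (fun z : X × X => h (q z.1) (q z.2))
        (ENNReal.ofReal (π i j) • (μ' i).prod (ν' j)) := fun i j =>
      ((integrable_const (h i j)).congr (hae i j).symm).smul_measure ENNReal.ofReal_ne_top
    rw [integral_finsetSum_measure fun i _ => integrable_finsetSum_measure.2 fun j _ => hint i j]
    refine Finset.sum_congr rfl fun i _ => ?_
    rw [integral_finsetSum_measure fun j _ => hint i j]
    refine Finset.sum_congr rfl fun j _ => ?_
    rw [integral_smul_measure, integral_congr_ae (hae i j), ENNReal.toReal_ofReal (hπ i j),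
      integral_const, smul_eq_mul, smul_eq_mul]
    by_cases h0 : π i j = 0
    · simp [h0]
    have hμ : μ (q ⁻¹' {i}) ≠ 0 := fun h0' => h0 <| by
      have := h1 i
      rw [measureReal_def, h0', ENNReal.toReal_zero,
        Finset.sum_eq_zero_iff_of_nonneg fun j _ => hπ i j] at this
      exact this j (Finset.mem_univ j)
    have hν : ν (q ⁻¹' {j}) ≠ 0 := fun h0' => h0 <| by
      have := h2 j
      rw [measureReal_def, h0', ENNReal.toReal_zero,
        Finset.sum_eq_zero_iff_of_nonneg fun i _ => hπ i j] at this
      exact this i (Finset.mem_univ i)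
    have : IsProbabilityMeasure (μ' i) := ProbabilityTheory.cond_isProbabilityMeasure hμ
    have : IsProbabilityMeasure (ν' j) := ProbabilityTheory.cond_isProbabilityMeasure hν
    simp [mul_comm]

theorem tendsto_integral_min_dist_nearestPt {X : Type*} [MetricSpace X] [MeasurableSpace X]
    [BorelSpace X] (μ : Measure X) [IsProbabilityMeasure μ] {e : ℕ → X} (he : DenseRange e)
    {L N : ℝ} (hL : 0 ≤ L) (hN : 0 ≤ N) :
    Tendsto (fun n => ∫ x, min (L * dist x (SimpleFunc.nearestPt e n x)) N ∂μ) atTop (𝓝 0) := by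
  have hm : ∀ n, Measurable fun x => min (L * dist x (SimpleFunc.nearestPt e n x)) N := fun n => by
    have h : Measurable fun x => edist x (SimpleFunc.nearestPt e n x) :=
      SimpleFunc.measurable_bind (SimpleFunc.nearestPt e n) (fun y x => edist x y)
        fun y => by fun_prop
    have h' : Measurable fun x => dist x (SimpleFunc.nearestPt e n x) := by
      simpa [dist_edist] using h.ennreal_toReal
    exact (h'.const_mul L).min measurable_const
  have := tendsto_integral_of_dominated_convergence (μ := μ)
    (F := fun n x => min (L * dist x (SimpleFunc.nearestPt e n x)) N) (f := fun _ => 0)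
    (fun _ => N) (fun n => (hm n).aestronglyMeasurable) (integrable_const N)
    (fun n => Eventually.of_forall fun x => by
      rw [Real.norm_of_nonneg (le_min (by positivity) hN)]; exact min_le_right _ _)
    (Eventually.of_forall fun x => by
      have h1 := (SimpleFunc.tendsto_nearestPt (he x))
      have h2 : Tendsto (fun n => dist x (SimpleFunc.nearestPt e n x)) atTop (𝓝 0) := by
        simpa using (tendsto_const_nhds (x := x)).dist h1
      simpa [hN] using (h2.const_mul L).min (tendsto_const_nhds (x := N)))
  simpa using this

/-- Kantorovich duality for a bounded Lipschitz cost. -/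
theorem exists_coupling_integral_le {X : Type*} [MetricSpace X]
    [TopologicalSpace.SeparableSpace X] [MeasurableSpace X] [BorelSpace X]
    {μ ν : Measure X} [IsProbabilityMeasure μ] [IsProbabilityMeasure ν] {c : X → X → ℝ}
    {L N K : ℝ} (hL : 0 ≤ L) (hN : 0 ≤ N) (hc0 : ∀ x y, 0 ≤ c x y) (hcN : ∀ x y, c x y ≤ N)
    (hcL : ∀ x y x' y', |c x y - c x' y'| ≤ L * dist x x' + L * dist y y')
    (hcm : Measurable (Function.uncurry c))
    (h : ∀ φ ψ : X → ℝ, Measurable φ → Measurable ψ → (∃ M, ∀ x, |φ x| ≤ M) →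
      (∃ M, ∀ x, |ψ x| ≤ M) → (∀ x y, φ x + ψ y ≤ c x y) → ∫ x, φ x ∂μ + ∫ y, ψ y ∂ν ≤ K)
    {ε : ℝ} (hε : 0 < ε) :
    ∃ γ : Measure (X × X), (γ.map Prod.fst = μ ∧ γ.map Prod.snd = ν) ∧
      ∫ z, c z.1 z.2 ∂γ ≤ K + ε := by
  have : Nonempty X := μ.nonempty_of_neZero
  have he := TopologicalSpace.denseRange_denseSeq X
  set e := TopologicalSpace.denseSeq X
  obtain ⟨n, hn1, hn2⟩ := ((((tendsto_integral_min_dist_nearestPt μ he hL hN).eventually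
    (gt_mem_nhds (show 0 < ε / 4 by positivity))).and
    ((tendsto_integral_min_dist_nearestPt ν he hL hN).eventually
    (gt_mem_nhds (show 0 < ε / 4 by positivity))))).exists
  have hr : Measurable (SimpleFunc.nearestPt e n) := (SimpleFunc.nearestPt e n).measurable
  set r : X → X := ⇑(SimpleFunc.nearestPt e n)
  set E : X → ℝ := fun x => min (L * dist x (r x)) N with hE
  have hE0 : ∀ x, 0 ≤ E x := fun x => le_min (by positivity) hN
  have hEN : ∀ x, |E x| ≤ N := fun x => by rw [abs_of_nonneg (hE0 x)]; exact min_le_right _ _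
  have hEm : Measurable E := ((measurable_id.dist hr).const_mul L).min measurable_const
  let q : X → Fin (n + 1) := fun x =>
    ⟨SimpleFunc.nearestPtInd e n x, Nat.lt_succ_of_le (SimpleFunc.nearestPtInd_le e n x)⟩
  have hq : Measurable q := measurable_to_countable' fun i => by
    have : q ⁻¹' {i} = SimpleFunc.nearestPtInd e n ⁻¹' {(i : ℕ)} := by
      ext x; simp [q, Fin.ext_iff]
    rw [this]
    exact (SimpleFunc.nearestPtInd e n).measurableSet_fiber _
  have hrq : ∀ x, r x = e (q x) := fun x => rfl
  have hcE : ∀ x y, |c x y - c (r x) (r y)| ≤ E x + E y := fun x y => by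
    have h1 := hcL x y (r x) (r y)
    have h2 : |c x y - c (r x) (r y)| ≤ N :=
      abs_sub_le_of_nonneg_of_le (hc0 _ _) (hcN _ _) (hc0 _ _) (hcN _ _)
    have h3 : 0 ≤ L * dist x (r x) := by positivity
    have h4 : 0 ≤ L * dist y (r y) := by positivity
    simp only [hE]
    rcases min_cases (L * dist x (r x)) N with h | h <;>
      rcases min_cases (L * dist y (r y)) N with h' | h' <;> linarith
  have hint : ∀ (ρ : Measure X) [IsProbabilityMeasure ρ] (u : Fin (n + 1) → ℝ),
      Integrable (fun x => u (q x)) ρ := fun ρ _ u =>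
    (Integrable.of_finite (μ := ρ.map q) (f := u)).comp_measurable hq
  have hsum : ∀ (ρ : Measure X) [IsProbabilityMeasure ρ] (u : Fin (n + 1) → ℝ),
      ∑ i, u i * ρ.real (q ⁻¹' {i}) = ∫ x, u (q x) ∂ρ := fun ρ _ u => by
    rw [← integral_map hq.aemeasurable (f := u) (measurable_of_finite u).aestronglyMeasurable,
      integral_fintype Integrable.of_finite]
    refine Finset.sum_congr rfl fun i _ => ?_
    rw [map_measureReal_apply hq (measurableSet_singleton i), smul_eq_mul, mul_comm]
  have hEint : ∀ (ρ : Measure X) [IsProbabilityMeasure ρ], Integrable E ρ := fun ρ _ =>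
    Integrable.of_bound hEm.aestronglyMeasurable N (Eventually.of_forall hEN)
  have hbdd : ∀ u : Fin (n + 1) → ℝ, ∃ M, ∀ x, |u (q x) - E x| ≤ M := fun u =>
    ⟨∑ i, |u i| + N, fun x => (abs_sub _ _).trans (add_le_add
      (Finset.single_le_sum (f := fun i => |u i|) (fun i _ => abs_nonneg _)
        (Finset.mem_univ (q x))) (hEN x))⟩
  have hone : ∀ (ρ : Measure X) [IsProbabilityMeasure ρ],
      ∑ i, ρ.real (q ⁻¹' {i}) = 1 := fun ρ _ => by
    simpa using hsum ρ fun _ => 1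
  obtain ⟨π, hπ, hπ1, hπ2, hπc⟩ := exists_transport_plan_of_dual_le
    (p := fun i => μ.real (q ⁻¹' {i})) (q := fun i => ν.real (q ⁻¹' {i}))
    (fun i => measureReal_nonneg) (hone μ) (fun i => measureReal_nonneg) (hone ν)
    (fun i j => c (e i) (e j)) (K := K + ε / 4 + ε / 4) fun u v huv => by
      rw [hsum, hsum]
      have := h (fun x => u (q x) - E x) (fun x => v (q x) - E x)
        (((measurable_of_finite u).comp hq).sub hEm) (((measurable_of_finite v).comp hq).sub hEm)
        (hbdd u) (hbdd v) fun x y => by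
          have h1 := huv (q x) (q y)
          rw [← hrq, ← hrq] at h1
          linarith [(abs_le.1 (hcE x y)).1]
      rw [integral_sub (hint μ u) (hEint μ), integral_sub (hint ν v) (hEint ν)] at this
      linarith
  obtain ⟨γ, ⟨hγ1, hγ2⟩, hγ⟩ := exists_coupling_of_finite hq hπ hπ1 hπ2
  refine ⟨γ, ⟨hγ1, hγ2⟩, ?_⟩
  have hγp : IsProbabilityMeasure γ := by
    have : IsProbabilityMeasure (γ.map Prod.fst) := hγ1 ▸ inferInstance
    exact Measure.isProbabilityMeasure_of_map Prod.fst
  have h1 : ∫ z, c (r z.1) (r z.2) ∂γ ≤ K + ε / 4 + ε / 4 :=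
    (hγ fun i j => c (e i) (e j)).trans_le hπc
  have hE1 : Integrable (fun z : X × X => E z.1) γ :=
    Integrable.of_bound (hEm.comp measurable_fst).aestronglyMeasurable N
      (Eventually.of_forall fun z => hEN z.1)
  have hE2 : Integrable (fun z : X × X => E z.2) γ :=
    Integrable.of_bound (hEm.comp measurable_snd).aestronglyMeasurable N
      (Eventually.of_forall fun z => hEN z.2)
  have hcb : ∀ x y, ‖c x y‖ ≤ N := fun x y => by
    rw [Real.norm_of_nonneg (hc0 x y)]; exact hcN x y
  have hci : Integrable (fun z : X × X => c z.1 z.2) γ :=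
    Integrable.of_bound hcm.aestronglyMeasurable N (Eventually.of_forall fun z => hcb _ _)
  have hcr : Integrable (fun z : X × X => c (r z.1) (r z.2)) γ :=
    Integrable.of_bound (hcm.comp ((hr.comp measurable_fst).prodMk
      (hr.comp measurable_snd))).aestronglyMeasurable N (Eventually.of_forall fun z => hcb _ _)
  have h2 : ∫ z, c z.1 z.2 ∂γ ≤ ∫ z, (c (r z.1) (r z.2) + (E z.1 + E z.2)) ∂γ :=
    integral_mono hci (hcr.add (hE1.add hE2)) fun z => by
      have := (abs_le.1 (hcE z.1 z.2)).2
      dsimp only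
      linarith
  have h3 : ∫ z, (c (r z.1) (r z.2) + (E z.1 + E z.2)) ∂γ
      = ∫ z, c (r z.1) (r z.2) ∂γ + (∫ z, E z.1 ∂γ + ∫ z, E z.2 ∂γ) :=
    (integral_add hcr (hE1.add hE2)).trans (congrArg _ (integral_add hE1 hE2))
  rw [h3, ← integral_map measurable_fst.aemeasurable hEm.aestronglyMeasurable (f := E),
    ← integral_map measurable_snd.aemeasurable hEm.aestronglyMeasurable (f := E), hγ1, hγ2] at h2
  linarith

theorem abs_min_sq_sub_min_sq_le {a b R : ℝ} (ha : 0 ≤ a) (hb : 0 ≤ b) (hR : 0 ≤ R) :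
    |min a R ^ 2 - min b R ^ 2| ≤ 2 * R * |a - b| := by
  have h1 : |min a R - min b R| ≤ |a - b| := by
    simpa using abs_min_sub_min_le_max a R b R
  have h2 : |min a R + min b R| ≤ 2 * R := by
    rw [abs_of_nonneg (add_nonneg (le_min ha hR) (le_min hb hR))]
    linarith [min_le_right a R, min_le_right b R]
  rw [sq_sub_sq, abs_mul]
  exact mul_le_mul h2 h1 (abs_nonneg _) (by positivity)

theorem abs_min_dist_sq_sub_le {X : Type*} [MetricSpace X] {R : ℝ} (hR : 0 ≤ R) (x y x' y' : X) :
    |min (dist x y) R ^ 2 - min (dist x' y') R ^ 2|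
      ≤ 2 * R * dist x x' + 2 * R * dist y y' := by
  refine (abs_min_sq_sub_min_sq_le dist_nonneg dist_nonneg hR).trans ?_
  rw [← mul_add]
  exact mul_le_mul_of_nonneg_left (by simpa [Real.dist_eq] using dist_dist_dist_le x y x' y')
    (by positivity)

theorem integral_add_integral_le_of_hopfLax {X : Type*} [MetricSpace X] [MeasurableSpace X]
    [BorelSpace X] {μ ν : Measure X} [IsProbabilityMeasure μ] [IsProbabilityMeasure ν] {K : ℝ}
    (h : ∀ f : X → ℝ, (∃ L : ℝ≥0, LipschitzWith L f) → (∃ M, ∀ x, |f x| ≤ M) →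
      ∫ x, hopfLax f 1 x ∂μ - ∫ y, f y ∂ν ≤ K / 2)
    {R : ℝ} (hR : 0 ≤ R) {φ ψ : X → ℝ} (hφm : Measurable φ) (hψm : Measurable ψ)
    (hφ : ∃ M, ∀ x, |φ x| ≤ M) (hψ : ∃ M, ∀ x, |ψ x| ≤ M)
    (hφψ : ∀ x y, φ x + ψ y ≤ min (dist x y) R ^ 2) :
    ∫ x, φ x ∂μ + ∫ y, ψ y ∂ν ≤ K := by
  have : Nonempty X := μ.nonempty_of_neZero
  obtain ⟨M, hM⟩ := hφ
  obtain ⟨M', hM'⟩ := hψ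
  have hc0 : ∀ x y : X, 0 ≤ min (dist x y) R ^ 2 := fun x y => sq_nonneg _
  have hcR : ∀ x y : X, min (dist x y) R ^ 2 ≤ R ^ 2 := fun x y =>
    pow_le_pow_left₀ (le_min dist_nonneg hR) (min_le_right _ _) 2
  set f : X → ℝ := fun y => ⨆ x, (φ x - min (dist x y) R ^ 2) / 2 with hf
  have hbdd : ∀ y, BddAbove (Set.range fun x => (φ x - min (dist x y) R ^ 2) / 2) := fun y =>
    ⟨M / 2, by rintro _ ⟨x, rfl⟩; dsimp only; linarith [(abs_le.1 (hM x)).2, hc0 x y]⟩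
  have hle : ∀ x y, (φ x - min (dist x y) R ^ 2) / 2 ≤ f y := fun x y => le_ciSup (hbdd y) x
  have hfM : ∀ y, |f y| ≤ (M + R ^ 2) / 2 := fun y => by
    refine abs_le.2 ⟨?_, ciSup_le fun x => ?_⟩
    · linarith [hle y y, hcR y y, (abs_le.1 (hM y)).1]
    · linarith [hc0 x y, (abs_le.1 (hM x)).2, sq_nonneg R]
  have hfL : LipschitzWith (Real.toNNReal R) f := LipschitzWith.of_le_add_mul _ fun y y' => by
    rw [Real.coe_toNNReal _ hR]
    refine ciSup_le fun x => ?_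
    have h1 := (abs_le.1 (abs_min_dist_sq_sub_le hR x y x y')).1
    rw [dist_self, mul_zero, zero_add] at h1
    linarith [hle x y']
  have hψf : ∀ y, f y ≤ -(ψ y / 2) := fun y => ciSup_le fun x => by linarith [hφψ x y]
  have hφf : ∀ x, φ x / 2 ≤ hopfLax f 1 x := fun x => le_ciInf fun y => by
    have : min (dist x y) R ^ 2 ≤ dist x y ^ 2 :=
      pow_le_pow_left₀ (le_min dist_nonneg hR) (min_le_left _ _) 2
    linarith [hle x y]
  have hφi : Integrable (fun x => φ x / 2) μ :=
    (Integrable.of_bound hφm.aestronglyMeasurable M (Eventually.of_forall hM)).div_const 2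
  have hψi : Integrable (fun x => ψ x / 2) ν :=
    (Integrable.of_bound hψm.aestronglyMeasurable M' (Eventually.of_forall hM')).div_const 2
  have h1 := integral_mono hφi (integrable_hopfLax hfM μ one_pos) hφf
  have h2 := integral_mono (integrable_of_continuous_of_abs_le ν hfL.continuous hfM) hψi.neg hψf
  rw [integral_div] at h1
  have h3 : ∫ y, (-fun x => ψ x / 2) y ∂ν = -((∫ y, ψ y ∂ν) / 2) := by
    rw [← integral_div]; exact integral_neg _
  rw [h3] at h2
  linarith [h f ⟨_, hfL⟩ ⟨_, hfM⟩]

theorem exists_coupling_of_forall_truncated {X : Type*} [MetricSpace X] [CompleteSpace X]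
    [TopologicalSpace.SeparableSpace X] [MeasurableSpace X] [BorelSpace X]
    {μ ν : Measure X} [IsProbabilityMeasure μ] [IsProbabilityMeasure ν] {K : ℝ}
    (h : ∀ n : ℕ, ∃ γ : Measure (X × X), (γ.map Prod.fst = μ ∧ γ.map Prod.snd = ν) ∧
      ∫ z, min (dist z.1 z.2) n ^ 2 ∂γ ≤ K + 1 / ((n : ℝ) + 1)) :
    ∃ γ : Measure (X × X), (γ.map Prod.fst = μ ∧ γ.map Prod.snd = ν) ∧
      ∫⁻ z, edist z.1 z.2 ^ (2 : ℝ) ∂γ ≤ ENNReal.ofReal K := by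
  have : SecondCountableTopology X := UniformSpace.secondCountable_of_separable X
  choose γ hγ hγK using h
  have hprob : ∀ n, IsProbabilityMeasure (γ n) := fun n => by
    have : IsProbabilityMeasure ((γ n).map Prod.fst) := (hγ n).1 ▸ inferInstance
    exact Measure.isProbabilityMeasure_of_map Prod.fst
  obtain ⟨μ', hμ'⟩ : ∃ μ' : ProbabilityMeasure X, (μ' : Measure X) = μ :=
    ⟨⟨μ, inferInstance⟩, rfl⟩
  obtain ⟨ν', hν'⟩ : ∃ ν' : ProbabilityMeasure X, (ν' : Measure X) = ν :=
    ⟨⟨ν, inferInstance⟩, rfl⟩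
  let P : ℕ → ProbabilityMeasure (X × X) := fun n => ⟨γ n, hprob n⟩
  have htight : IsTightMeasureSet
      {x : Measure (X × X) | ∃ ρ ∈ Set.range P, (ρ : Measure (X × X)) = x} := by
    refine IsTightMeasureSet.prodMk
      ((isTightMeasureSet_singleton (μ := μ)).subset ?_)
      ((isTightMeasureSet_singleton (μ := ν)).subset ?_)
    · rintro _ ⟨_, ⟨_, ⟨n, rfl⟩, rfl⟩, rfl⟩
      exact (hγ n).1
    · rintro _ ⟨_, ⟨_, ⟨n, rfl⟩, rfl⟩, rfl⟩
      exact (hγ n).2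
  have hcpt := isCompact_closure_of_isTightMeasureSet htight
  obtain ⟨ρ, -, hρ⟩ := isCompact_iff_ultrafilter_le_nhds.1 hcpt ((hyperfilter ℕ).map P) (by
    rw [Ultrafilter.coe_map, le_principal_iff]
    exact mem_map.2 (univ_mem' fun n => subset_closure ⟨n, rfl⟩))
  have hρ' : Tendsto P (hyperfilter ℕ) (𝓝 ρ) := hρ
  have hU : (hyperfilter ℕ : Filter ℕ) ≤ atTop := Nat.hyperfilter_le_atTop
  refine ⟨ρ, ⟨?_, ?_⟩, ?_⟩
  · have h1 := ProbabilityMeasure.tendsto_map_of_tendsto_of_continuous P ρ hρ' continuous_fst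
    have h2 : Tendsto (fun n => (P n).map continuous_fst.measurable.aemeasurable) (hyperfilter ℕ)
        (𝓝 μ') :=
      tendsto_const_nhds.congr fun n => Subtype.ext (hμ'.trans (hγ n).1.symm)
    exact (congrArg ProbabilityMeasure.toMeasure (tendsto_nhds_unique h1 h2)).trans hμ'
  · have h1 := ProbabilityMeasure.tendsto_map_of_tendsto_of_continuous P ρ hρ' continuous_snd
    have h2 : Tendsto (fun n => (P n).map continuous_snd.measurable.aemeasurable) (hyperfilter ℕ)
        (𝓝 ν') :=
      tendsto_const_nhds.congr fun n => Subtype.ext (hν'.trans (hγ n).2.symm)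
    exact (congrArg ProbabilityMeasure.toMeasure (tendsto_nhds_unique h1 h2)).trans hν'
  · have hcont : ∀ m : ℕ, Continuous fun z : X × X => min (dist z.1 z.2) (m : ℝ) ^ 2 := fun m => by
      fun_prop
    have hbd : ∀ (m : ℕ) (z : X × X), ‖min (dist z.1 z.2) (m : ℝ) ^ 2‖ ≤ (m : ℝ) ^ 2 := fun m z => by
      rw [Real.norm_of_nonneg (sq_nonneg _)]
      exact pow_le_pow_left₀ (le_min dist_nonneg (Nat.cast_nonneg m)) (min_le_right _ _) 2
    have hint : ∀ (m : ℕ) (σ : Measure (X × X)) [IsProbabilityMeasure σ],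
        Integrable (fun z : X × X => min (dist z.1 z.2) (m : ℝ) ^ 2) σ := fun m σ _ =>
      Integrable.of_bound (hcont m).aestronglyMeasurable _ (Eventually.of_forall (hbd m))
    have hK : ∀ m : ℕ, ∫ z, min (dist z.1 z.2) (m : ℝ) ^ 2 ∂(ρ : Measure (X × X)) ≤ K := fun m => by
      have h1 := ProbabilityMeasure.tendsto_iff_forall_integral_tendsto.1 hρ'
        (BoundedContinuousFunction.ofNormedAddCommGroup _ (hcont m) _ (hbd m))
      have h2 : Tendsto (fun n : ℕ => K + 1 / ((n : ℝ) + 1)) (hyperfilter ℕ) (𝓝 (K + 0)) :=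
        (tendsto_const_nhds.add tendsto_one_div_add_atTop_nhds_zero_nat).mono_left hU
      rw [add_zero] at h2
      refine le_of_tendsto_of_tendsto h1 h2 (hU ?_)
      filter_upwards [eventually_ge_atTop m] with n hn
      refine (integral_mono (hint m (γ n)) (hint n (γ n)) fun z => ?_).trans (hγK n)
      exact pow_le_pow_left₀ (le_min dist_nonneg (Nat.cast_nonneg m))
        (min_le_min_left _ (Nat.cast_le.2 hn)) 2
    have hlim : Tendsto (fun m : ℕ =>
        ∫⁻ z, ENNReal.ofReal (min (dist z.1 z.2) (m : ℝ) ^ 2) ∂(ρ : Measure (X × X))) atTop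
        (𝓝 (∫⁻ z, edist z.1 z.2 ^ (2 : ℝ) ∂(ρ : Measure (X × X)))) := by
      refine lintegral_tendsto_of_tendsto_of_monotone
        (fun m => (hcont m).measurable.ennreal_ofReal.aemeasurable)
        (Eventually.of_forall fun z m n hmn => ENNReal.ofReal_le_ofReal ?_)
        (Eventually.of_forall fun z => ?_)
      · exact pow_le_pow_left₀ (le_min dist_nonneg (Nat.cast_nonneg m))
          (min_le_min_left _ (Nat.cast_le.2 hmn)) 2
      · obtain ⟨k, hk⟩ := exists_nat_ge (dist z.1 z.2)
        refine tendsto_const_nhds.congr' ?_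
        filter_upwards [eventually_ge_atTop k] with n hn
        rw [min_eq_left (hk.trans (Nat.cast_le.2 hn)), edist_dist, ENNReal.ofReal_pow dist_nonneg]
        exact ENNReal.rpow_natCast _ 2
    refine le_of_tendsto' hlim fun m => ?_
    rw [← ofReal_integral_eq_lintegral_ofReal (hint m ρ)
      (Eventually.of_forall fun z => sq_nonneg _)]
    exact ENNReal.ofReal_le_ofReal (hK m)

/-- Kantorovich duality for the quadratic cost, in terms of the Hopf-Lax semigroup. -/
theorem exists_coupling_of_hopfLax {X : Type*} [MetricSpace X] [CompleteSpace X]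
    [TopologicalSpace.SeparableSpace X] [MeasurableSpace X] [BorelSpace X]
    {μ ν : Measure X} [IsProbabilityMeasure μ] [IsProbabilityMeasure ν] {K : ℝ}
    (h : ∀ f : X → ℝ, (∃ L : ℝ≥0, LipschitzWith L f) → (∃ M, ∀ x, |f x| ≤ M) →
      ∫ x, hopfLax f 1 x ∂μ - ∫ y, f y ∂ν ≤ K / 2) :
    ∃ γ : Measure (X × X), (γ.map Prod.fst = μ ∧ γ.map Prod.snd = ν) ∧
      ∫⁻ z, edist z.1 z.2 ^ (2 : ℝ) ∂γ ≤ ENNReal.ofReal K := by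
  have : SecondCountableTopology X := UniformSpace.secondCountable_of_separable X
  refine exists_coupling_of_forall_truncated fun n => ?_
  have hn : (0 : ℝ) ≤ n := Nat.cast_nonneg n
  refine exists_coupling_integral_le (c := fun x y => min (dist x y) n ^ 2) (L := 2 * n)
    (N := n ^ 2) (by positivity) (by positivity) (fun x y => sq_nonneg _)
    (fun x y => pow_le_pow_left₀ (le_min dist_nonneg hn) (min_le_right _ _) 2)
    (abs_min_dist_sq_sub_le hn) ?_
    (fun φ ψ hφm hψm hφ hψ hle => integral_add_integral_le_of_hopfLax h hn hφm hψm hφ hψ hle)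
    (by positivity)
  exact Continuous.measurable (by fun_prop)

theorem integral_bind_eq {X : Type*} [MeasurableSpace X] {κ : X → Measure X}
    (hκ : Measurable κ) (μ : Measure X) {g : X → ℝ} (hg : Integrable g (μ.bind κ)) :
    ∫ z, g z ∂(μ.bind κ) = ∫ x, ∫ z, g z ∂κ x ∂μ := by
  simpa using ProbabilityTheory.Kernel.integral_comp
    (η := ⟨κ, hκ⟩) (κ := ProbabilityTheory.Kernel.const Unit μ) (a := ()) (f := g)
    (by simpa [ProbabilityTheory.Kernel.comp_apply] using hg)

theorem isProbabilityMeasure_bind_of_forall {X : Type*} [MeasurableSpace X] {κ : X → Measure X}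
    (hκ : Measurable κ) (hκprob : ∀ x, IsProbabilityMeasure (κ x)) (μ : Measure X)
    [IsProbabilityMeasure μ] : IsProbabilityMeasure (μ.bind κ) :=
  isProbabilityMeasure_bind hκ.aemeasurable (Eventually.of_forall hκprob)

section Coupling

variable {X : Type*} [MetricSpace X] [TopologicalSpace.SeparableSpace X] [MeasurableSpace X]
  [BorelSpace X]
  {C : ℝ≥0} {κ : X → Measure X}

theorem integral_bind_hopfLax_sub_le (hX : IsLengthSpace X) (hκmeas : Measurable κ)
    (hκprob : ∀ x, IsProbabilityMeasure (κ x))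
    (hLip : ∀ (f : X → ℝ) (L : ℝ≥0), LipschitzWith L f → (∃ M, ∀ x, |f x| ≤ M) →
      LipschitzWith (C * L) (fun x => ∫ y, f y ∂ κ x))
    (hBE : ∀ f : X → ℝ, (∃ L : ℝ≥0, LipschitzWith L f) → (∃ M, ∀ x, |f x| ≤ M) →
      ∀ x : X, slopeAt (fun z => ∫ y, f y ∂ κ z) x ^ 2 ≤
        (C : ℝ) ^ 2 * ∫ y, slopeAt f y ^ 2 ∂ κ x)
    {γ : Measure (X × X)} [IsProbabilityMeasure γ]
    (hγ : C = 0 ∨ ∫⁻ z, edist z.1 z.2 ^ (2 : ℝ) ∂γ ≠ ⊤)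
    {f : X → ℝ} (hf : ∃ L : ℝ≥0, LipschitzWith L f) (hfb : ∃ M, ∀ x, |f x| ≤ M) :
    ∫ x, hopfLax f 1 x ∂((γ.map Prod.fst).bind κ) - ∫ y, f y ∂((γ.map Prod.snd).bind κ)
      ≤ ((C : ℝ) ^ 2 * (∫⁻ z, edist z.1 z.2 ^ (2 : ℝ) ∂γ).toReal) / 2 := by
  have : SecondCountableTopology X := UniformSpace.secondCountable_of_separable X
  obtain ⟨L, hL⟩ := hf
  obtain ⟨M, hM⟩ := hfb
  have hp1 := Measure.isProbabilityMeasure_map (μ := γ) measurable_fst.aemeasurable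
  have hp2 := Measure.isProbabilityMeasure_map (μ := γ) measurable_snd.aemeasurable
  have hb1 := isProbabilityMeasure_bind_of_forall hκmeas hκprob (γ.map Prod.fst)
  have hb2 := isProbabilityMeasure_bind_of_forall hκmeas hκprob (γ.map Prod.snd)
  have hQL := lipschitzWith_hopfLax hM one_pos le_rfl
  have hQM : ∀ x, |hopfLax f 1 x| ≤ M := abs_hopfLax_le hM one_pos
  have hcont : ∀ {g : X → ℝ} {L' : ℝ≥0}, LipschitzWith L' g → (∀ x, |g x| ≤ M) →
      Continuous fun x => ∫ z, g z ∂κ x := fun hg hgM => (hLip _ _ hg ⟨M, hgM⟩).continuous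
  have hbound : ∀ {g : X → ℝ}, (∀ x, |g x| ≤ M) → ∀ x, |∫ z, g z ∂κ x| ≤ M := fun {g} hgM x => by
    have := norm_integral_le_of_norm_le_const (μ := κ x) (f := g) (C := M) (Eventually.of_forall hgM)
    simpa using this
  have hQc := hcont hQL hQM
  have hfc := hcont hL hM
  have hQi : Integrable (fun z : X × X => ∫ w, hopfLax f 1 w ∂κ z.1) γ :=
    integrable_of_continuous_of_abs_le γ (hQc.comp continuous_fst) fun z => hbound hQM z.1
  have hfi : Integrable (fun z : X × X => ∫ w, f w ∂κ z.2) γ :=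
    integrable_of_continuous_of_abs_le γ (hfc.comp continuous_snd) fun z => hbound hM z.2
  rw [integral_bind_eq hκmeas _ (integrable_of_continuous_of_abs_le _ hQL.continuous hQM),
    integral_bind_eq hκmeas _ (integrable_of_continuous_of_abs_le _ hL.continuous hM),
    integral_map measurable_fst.aemeasurable hQc.aestronglyMeasurable,
    integral_map measurable_snd.aemeasurable hfc.aestronglyMeasurable,
    ← integral_sub hQi hfi]
  have hsq : ∀ z : X × X, edist z.1 z.2 ^ (2 : ℝ) = ENNReal.ofReal (dist z.1 z.2 ^ 2) := fun z => by
    rw [edist_dist, ENNReal.ofReal_pow dist_nonneg]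
    exact ENNReal.rpow_natCast _ 2
  simp_rw [hsq] at hγ ⊢
  have hmeas : AEStronglyMeasurable (fun z : X × X => dist z.1 z.2 ^ 2) γ :=
    Continuous.aestronglyMeasurable (by fun_prop)
  have hint : Integrable (fun z : X × X => (C : ℝ) ^ 2 * dist z.1 z.2 ^ 2) γ := by
    rcases hγ with rfl | hfin
    · simp
    · refine Integrable.const_mul ⟨hmeas, ?_⟩ _
      rw [hasFiniteIntegral_iff_ofReal (Eventually.of_forall fun z => sq_nonneg _)]
      exact hfin.lt_top
  rw [← integral_eq_lintegral_of_nonneg_ae (Eventually.of_forall fun z => sq_nonneg _) hmeas,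
    ← integral_const_mul, ← integral_div]
  refine integral_mono (hQi.sub hfi) (hint.div_const 2) fun z => ?_
  have := integral_hopfLax_one_sub_integral_le hX hM hL hκprob hLip hBE z.1 z.2
  rwa [mul_pow] at this

theorem wassersteinDist_bind_le_of_coupling [CompleteSpace X] (hX : IsLengthSpace X)
    (hκmeas : Measurable κ)
    (hκprob : ∀ x, IsProbabilityMeasure (κ x))
    (hLip : ∀ (f : X → ℝ) (L : ℝ≥0), LipschitzWith L f → (∃ M, ∀ x, |f x| ≤ M) →
      LipschitzWith (C * L) (fun x => ∫ y, f y ∂ κ x))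
    (hBE : ∀ f : X → ℝ, (∃ L : ℝ≥0, LipschitzWith L f) → (∃ M, ∀ x, |f x| ≤ M) →
      ∀ x : X, slopeAt (fun z => ∫ y, f y ∂ κ z) x ^ 2 ≤
        (C : ℝ) ^ 2 * ∫ y, slopeAt f y ^ 2 ∂ κ x)
    (γ : Measure (X × X)) [IsProbabilityMeasure γ] :
    wassersteinDist 2 ((γ.map Prod.fst).bind κ) ((γ.map Prod.snd).bind κ)
      ≤ C * (∫⁻ z, edist z.1 z.2 ^ (2 : ℝ) ∂γ) ^ (1 / (2 : ℝ)) := by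
  by_cases hγ : C = 0 ∨ ∫⁻ z, edist z.1 z.2 ^ (2 : ℝ) ∂γ ≠ ⊤
  · have hp1 := Measure.isProbabilityMeasure_map (μ := γ) measurable_fst.aemeasurable
    have hp2 := Measure.isProbabilityMeasure_map (μ := γ) measurable_snd.aemeasurable
    have hb1 := isProbabilityMeasure_bind_of_forall hκmeas hκprob (γ.map Prod.fst)
    have hb2 := isProbabilityMeasure_bind_of_forall hκmeas hκprob (γ.map Prod.snd)
    obtain ⟨γ', hγ', hle⟩ := exists_coupling_of_hopfLax fun f hf hfb =>
      integral_bind_hopfLax_sub_le hX hκmeas hκprob hLip hBE hγ hf hfb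
    refine (iInf₂_le γ' hγ').trans
      ((ENNReal.rpow_le_rpow hle (by norm_num)).trans ?_)
    rw [ENNReal.ofReal_mul (sq_nonneg _), ENNReal.mul_rpow_of_nonneg _ _ (by norm_num),
      ENNReal.ofReal_pow C.coe_nonneg, ENNReal.ofReal_coe_nnreal, ← ENNReal.rpow_natCast,
      ← ENNReal.rpow_mul]
    norm_num
    gcongr
    exact ENNReal.ofReal_toReal_le
  · obtain ⟨hC, hI⟩ := not_or.1 hγ
    rw [not_not.1 hI, ENNReal.top_rpow_of_pos (by norm_num),
      ENNReal.mul_top (by simpa using hC)]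
    exact le_top

end Coupling

/-- Let `(X,d)` be a complete separable length metric space, `C ≥ 0`, and
`κ` a measurable map from `X` to Borel probability measures such that (i) `P̃f(x) := ∫ f dκ(x)`
is `C·Lip(f)`-Lipschitz for bounded Lipschitz `f`, and (ii) `|D(P̃f)|² ≤ C² P̃(|Df|²)` pointwise
for bounded Lipschitz `f`.  Then `W₂(κ(x),κ(y)) ≤ C d(x,y)` for all `x,y`, and consequently
`W₂(μκ, νκ) ≤ C W₂(μ,ν)` for all Borel probability measures `μ, ν`. -/
theorem stmt12 {X : Type*} [MetricSpace X] [CompleteSpace X]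
    [TopologicalSpace.SeparableSpace X] [MeasurableSpace X] [BorelSpace X]
    (hX : IsLengthSpace X)
    (C : ℝ≥0) (κ : X → Measure X) (hκmeas : Measurable κ)
    (hκprob : ∀ x, IsProbabilityMeasure (κ x))
    (hLip : ∀ (f : X → ℝ) (L : ℝ≥0), LipschitzWith L f → (∃ M, ∀ x, |f x| ≤ M) →
      LipschitzWith (C * L) (fun x => ∫ y, f y ∂ κ x))
    (hBE : ∀ f : X → ℝ, (∃ L : ℝ≥0, LipschitzWith L f) → (∃ M, ∀ x, |f x| ≤ M) →
      ∀ x : X, slopeAt (fun z => ∫ y, f y ∂ κ z) x ^ 2 ≤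
        (C : ℝ) ^ 2 * ∫ y, slopeAt f y ^ 2 ∂ κ x) :
    (∀ x y : X, wassersteinDist 2 (κ x) (κ y) ≤ (C : ℝ≥0∞) * edist x y) ∧
    (∀ μ ν : Measure X, IsProbabilityMeasure μ → IsProbabilityMeasure ν →
      wassersteinDist 2 (μ.bind κ) (ν.bind κ) ≤
        (C : ℝ≥0∞) * wassersteinDist 2 μ ν) := by
  have key := fun (γ : Measure (X × X)) (hγ : IsProbabilityMeasure γ) =>
    wassersteinDist_bind_le_of_coupling hX hκmeas hκprob hLip hBE γ
  have : SecondCountableTopology X := UniformSpace.secondCountable_of_separable X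
  refine ⟨fun x y => ?_, fun μ ν hμ hν => ?_⟩
  · have h := key (Measure.dirac (x, y)) inferInstance
    rw [Measure.map_dirac' measurable_fst, Measure.map_dirac' measurable_snd,
      Measure.dirac_bind hκmeas, Measure.dirac_bind hκmeas, lintegral_dirac,
      ← ENNReal.rpow_mul] at h
    simpa using h
  · have hcoupling : ∀ γ : Measure (X × X), γ.map Prod.fst = μ ∧ γ.map Prod.snd = ν →
        wassersteinDist 2 (μ.bind κ) (ν.bind κ) ≤
          C * (∫⁻ z, edist z.1 z.2 ^ (2 : ℝ) ∂γ) ^ (1 / (2 : ℝ)) := by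
      rintro γ ⟨rfl, rfl⟩
      exact key γ (Measure.isProbabilityMeasure_of_map Prod.fst)
    by_cases hC : C = 0
    · have h := hcoupling (μ.prod ν) (by simp)
      simpa [hC] using h
    · unfold wassersteinDist at hcoupling ⊢
      simp_rw [ENNReal.mul_iInf_of_ne (ENNReal.coe_ne_zero.2 hC) ENNReal.coe_ne_top]
      exact le_iInf₂ hcoupling
end

section
/- Let (X,d) be a complete separable metric space, let C ≥ 0, and let κ be a map from X to Borel probability measures on X, measurable for the weak topology, such that W₂(κ(x), κ(y)) ≤ C·d(x,y) for all x, y ∈ X. Then for all Borel probability measures μ, ν on X: W₂(μκ, νκ) ≤ C·W₂(μ, ν). -/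
open MeasureTheory Filter Topology
open scoped ENNReal NNReal

/-- A set of measures on a product whose marginals lie in tight sets is tight. -/
theorem isTightMeasureSet_of_marginals {X Y : Type*} [TopologicalSpace X] [T2Space X]
    [MeasurableSpace X] [OpensMeasurableSpace X] [TopologicalSpace Y] [T2Space Y]
    [MeasurableSpace Y] [OpensMeasurableSpace Y]
    {S : Set (Measure X)} {T : Set (Measure Y)} (hS : IsTightMeasureSet S)
    (hT : IsTightMeasureSet T) :
    IsTightMeasureSet {π : Measure (X × Y) | π.map Prod.fst ∈ S ∧ π.map Prod.snd ∈ T} := by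
  rw [isTightMeasureSet_iff_exists_isCompact_measure_compl_le] at hS hT ⊢
  intro ε hε
  have hε2 : 0 < ε / 2 := ENNReal.half_pos hε.ne'
  obtain ⟨K, hK, hKS⟩ := hS _ hε2
  obtain ⟨L, hL, hLT⟩ := hT _ hε2
  refine ⟨K ×ˢ L, hK.prod hL, fun π ⟨hπ₁, hπ₂⟩ => ?_⟩
  have h₁ := hKS _ hπ₁
  have h₂ := hLT _ hπ₂
  rw [Measure.map_apply measurable_fst hK.measurableSet.compl] at h₁
  rw [Measure.map_apply measurable_snd hL.measurableSet.compl] at h₂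
  calc π (K ×ˢ L)ᶜ ≤ π (Prod.fst ⁻¹' Kᶜ ∪ Prod.snd ⁻¹' Lᶜ) := by
        refine measure_mono fun z hz => ?_
        simp only [Set.mem_compl_iff, Set.mem_prod, not_and_or] at hz
        exact hz
    _ ≤ ε / 2 + ε / 2 := (measure_union_le _ _).trans (add_le_add h₁ h₂)
    _ = ε := ENNReal.add_halves ε

/-- The laws of a weakly convergent sequence on a Polish space form a tight set. -/
theorem isTightMeasureSet_range_of_tendsto {X : Type*} [PseudoMetricSpace X] [CompleteSpace X]
    [SecondCountableTopology X] [MeasurableSpace X] [BorelSpace X]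
    {μs : ℕ → ProbabilityMeasure X} {μ : ProbabilityMeasure X}
    (h : Tendsto μs atTop (𝓝 μ)) :
    IsTightMeasureSet {ν : Measure X | ∃ n, (μs n : Measure X) = ν} := by
  have hc : IsCompact (closure (Set.range μs)) :=
    h.isCompact_insert_range.closure_of_subset (Set.subset_insert _ _)
  have := isTightMeasureSet_of_isCompact_closure hc
  simpa using this

/-- Lower semicontinuity of the Wasserstein distance under weak convergence. -/
theorem wassersteinDist_le_of_tendsto {X : Type*} [MetricSpace X] [CompleteSpace X]
    [SecondCountableTopology X] [MeasurableSpace X] [BorelSpace X] {p : ℝ} (hp : 0 < p)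
    {μs νs : ℕ → ProbabilityMeasure X} {μ ν : ProbabilityMeasure X}
    (hμ : Tendsto μs atTop (𝓝 μ)) (hν : Tendsto νs atTop (𝓝 ν))
    (π : ℕ → Measure (X × X))
    (hπ : ∀ n, (π n).map Prod.fst = μs n ∧ (π n).map Prod.snd = νs n)
    {c : ℕ → ℝ≥0∞} {c' : ℝ≥0∞} (hc : Tendsto c atTop (𝓝 c'))
    (hcost : ∀ n, (∫⁻ z, edist z.1 z.2 ^ p ∂(π n)) ^ (1 / p) ≤ c n) :
    wassersteinDist p (μ : Measure X) ν ≤ c' := by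
  have hprob : ∀ n, IsProbabilityMeasure (π n) := fun n => by
    have : IsProbabilityMeasure ((π n).map Prod.fst) := by rw [(hπ n).1]; infer_instance
    exact Measure.isProbabilityMeasure_of_map Prod.fst
  let Q : ℕ → ProbabilityMeasure (X × X) := fun n => ⟨π n, hprob n⟩
  have htight := (isTightMeasureSet_of_marginals (isTightMeasureSet_range_of_tendsto hμ)
    (isTightMeasureSet_range_of_tendsto hν))
  have hcomp : IsCompact (closure (Set.range Q)) := by
    refine isCompact_closure_of_isTightMeasureSet (htight.subset ?_)
    rintro _ ⟨_, ⟨n, rfl⟩, rfl⟩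
    exact ⟨⟨n, (hπ n).1.symm⟩, ⟨n, (hπ n).2.symm⟩⟩
  obtain ⟨ρ, -, φ, hφ, hlim⟩ := hcomp.isSeqCompact (fun n => subset_closure ⟨n, rfl⟩)
  have hρ₁ : (ρ : Measure (X × X)).map Prod.fst = μ := by
    have h₁ := ProbabilityMeasure.tendsto_map_of_tendsto_of_continuous _ _ hlim continuous_fst
    have h₂ := tendsto_nhds_unique_of_eventuallyEq h₁ (hμ.comp hφ.tendsto_atTop)
      (.of_forall fun n => Subtype.ext (hπ (φ n)).1)
    exact congrArg Subtype.val h₂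
  have hρ₂ : (ρ : Measure (X × X)).map Prod.snd = ν := by
    have h₁ := ProbabilityMeasure.tendsto_map_of_tendsto_of_continuous _ _ hlim continuous_snd
    have h₂ := tendsto_nhds_unique_of_eventuallyEq h₁ (hν.comp hφ.tendsto_atTop)
      (.of_forall fun n => Subtype.ext (hπ (φ n)).2)
    exact congrArg Subtype.val h₂
  refine (iInf₂_le (ρ : Measure (X × X)) ⟨hρ₁, hρ₂⟩).trans ?_
  have hedist : ∀ z : X × X, edist z.1 z.2 ^ p = ENNReal.ofReal (dist z.1 z.2 ^ p) := fun z => by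
    rw [edist_dist, ENNReal.ofReal_rpow_of_nonneg dist_nonneg hp.le]
  have hlsc : ∫⁻ z, edist z.1 z.2 ^ p ∂(ρ : Measure (X × X)) ≤
      atTop.liminf fun n => ∫⁻ z, edist z.1 z.2 ^ p ∂(π (φ n)) := by
    simp_rw [hedist]
    exact lintegral_le_liminf_lintegral_of_forall_isOpen_measure_le_liminf_measure
      (continuous_dist.rpow_const fun _ => Or.inr hp.le)
      (fun z => Real.rpow_nonneg dist_nonneg p)
      (fun G hG => ProbabilityMeasure.le_liminf_measure_open_of_tendsto hlim hG)
  have hle : ∀ n, ∫⁻ z, edist z.1 z.2 ^ p ∂(π (φ n)) ≤ c (φ n) ^ p := fun n => by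
    rw [← ENNReal.rpow_inv_le_iff hp, ← one_div]
    exact hcost _
  have hcp : Tendsto (fun n => c (φ n) ^ p) atTop (𝓝 (c' ^ p)) :=
    (ENNReal.continuous_rpow_const.tendsto _).comp (hc.comp hφ.tendsto_atTop)
  rw [one_div, ENNReal.rpow_inv_le_iff hp, ← hcp.liminf_eq]
  exact hlsc.trans (liminf_le_liminf (.of_forall hle))

/-- To bound by a finite multiple of the Wasserstein distance, it suffices to bound by that
multiple of the cost of every coupling. -/
theorem le_mul_wassersteinDist {X : Type*} [MetricSpace X] [MeasurableSpace X] {p : ℝ}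
    {μ ν : Measure X} [IsProbabilityMeasure μ] [IsProbabilityMeasure ν] {C : ℝ≥0} {a : ℝ≥0∞}
    (h : ∀ γ : Measure (X × X), γ.map Prod.fst = μ ∧ γ.map Prod.snd = ν →
      a ≤ C * (∫⁻ z, edist z.1 z.2 ^ p ∂γ) ^ (1 / p)) :
    a ≤ C * wassersteinDist p μ ν := by
  have : Nonempty {γ : Measure (X × X) // γ.map Prod.fst = μ ∧ γ.map Prod.snd = ν} :=
    ⟨⟨μ.prod ν, by simp [Measure.map_fst_prod], by simp [Measure.map_snd_prod]⟩⟩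
  rw [wassersteinDist, iInf_subtype', ENNReal.mul_iInf fun h => (ENNReal.coe_ne_top h).elim]
  exact le_iInf fun γ => h γ.1 γ.2

/-- Kantorovich-type bound: integrals of bounded Lipschitz functions are controlled by the
Wasserstein distance. -/
theorem edist_integral_le_mul_wassersteinDist {X : Type*} [MetricSpace X]
    [SecondCountableTopology X] [MeasurableSpace X] [BorelSpace X] {p : ℝ} (hp : 1 ≤ p)
    {g : X → ℝ} {L : ℝ≥0} (hg : LipschitzWith L g)
    (μ ν : Measure X) [IsProbabilityMeasure μ] [IsProbabilityMeasure ν]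
    (hgμ : Integrable g μ) (hgν : Integrable g ν) :
    edist (∫ x, g x ∂μ) (∫ x, g x ∂ν) ≤ L * wassersteinDist p μ ν := by
  have hcoup : ∀ γ : Measure (X × X), γ.map Prod.fst = μ ∧ γ.map Prod.snd = ν →
      edist (∫ x, g x ∂μ) (∫ x, g x ∂ν) ≤ L * (∫⁻ z, edist z.1 z.2 ^ p ∂γ) ^ (1 / p) := by
    rintro γ ⟨rfl, rfl⟩
    have : IsProbabilityMeasure γ := Measure.isProbabilityMeasure_of_map Prod.fst
    rw [integral_map measurable_fst.aemeasurable hgμ.1,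
      integral_map measurable_snd.aemeasurable hgν.1, edist_eq_enorm_sub,
      ← integral_sub (f := fun z : X × X => g z.1) (hgμ.comp_measurable measurable_fst)
        (g := fun z : X × X => g z.2) (hgν.comp_measurable measurable_snd)]
    calc _ ≤ ∫⁻ z, ‖g z.1 - g z.2‖ₑ ∂γ := enorm_integral_le_lintegral_enorm _
      _ ≤ ∫⁻ z, L * edist z.1 z.2 ∂γ :=
        lintegral_mono fun z => by rw [← edist_eq_enorm_sub]; exact hg _ _
      _ = L * ∫⁻ z, edist z.1 z.2 ∂γ := lintegral_const_mul' _ _ ENNReal.coe_ne_top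
      _ ≤ L * (∫⁻ z, edist z.1 z.2 ^ p ∂γ) ^ (1 / p) := by
        gcongr
        have h := eLpNorm'_le_eLpNorm'_of_exponent_le one_pos hp γ
          (f := fun z : X × X => edist z.1 z.2) (by fun_prop)
        simpa [eLpNorm'] using h
  exact le_mul_wassersteinDist hcoup

/-- A separable metric space admits measurable maps to `ℕ` whose fibres are uniformly small. -/
theorem exists_measurable_nat_edist_le {X : Type*} [PseudoEMetricSpace X] [Nonempty X]
    [TopologicalSpace.SeparableSpace X] [MeasurableSpace X] [OpensMeasurableSpace X]
    {ε : ℝ≥0∞} (hε : 0 < ε) :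
    ∃ (N : X → ℕ) (e : ℕ → X), Measurable N ∧ ∀ x, edist x (e (N x)) ≤ ε := by
  classical
  have hex : ∀ x : X, ∃ n, edist x (TopologicalSpace.denseSeq X n) < ε := fun x => by
    obtain ⟨_, ⟨n, rfl⟩, hn⟩ :=
      EMetric.mem_closure_iff.1 (TopologicalSpace.denseRange_denseSeq X x) ε hε
    exact ⟨n, hn⟩
  refine ⟨fun x => Nat.find (hex x), TopologicalSpace.denseSeq X, ?_,
    fun x => (Nat.find_spec (hex x)).le⟩
  exact measurable_find hex fun k => measurableSet_lt (by fun_prop) measurable_const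

/-- Integration against the composition of a probability measure with a Markov kernel. -/
theorem integral_bind_of_bounded {X Y : Type*} [MeasurableSpace X] [MeasurableSpace Y]
    {μ : Measure X} [IsProbabilityMeasure μ] {κ : X → Measure Y} (hκ : Measurable κ)
    [∀ x, IsProbabilityMeasure (κ x)] {g : Y → ℝ} (hg : StronglyMeasurable g) {M : ℝ}
    (hM : ∀ y, ‖g y‖ ≤ M) :
    Integrable (fun x => ∫ y, g y ∂(κ x)) μ ∧
      ∫ y, g y ∂(μ.bind κ) = ∫ x, ∫ y, g y ∂(κ x) ∂μ := by
  let η : ProbabilityTheory.Kernel X Y := ⟨κ, hκ⟩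
  have hη : ProbabilityTheory.IsMarkovKernel η :=
    ⟨fun x => inferInstanceAs (IsProbabilityMeasure (κ x))⟩
  have heq : (ProbabilityTheory.Kernel.comp η (ProbabilityTheory.Kernel.const Unit μ)) () =
      μ.bind κ := by
    rw [ProbabilityTheory.Kernel.comp_apply, ProbabilityTheory.Kernel.const_apply]
    rfl
  have hint : Integrable g ((ProbabilityTheory.Kernel.comp η
      (ProbabilityTheory.Kernel.const Unit μ)) ()) :=
    .of_bound hg.aestronglyMeasurable M (.of_forall hM)
  have hcomp := ProbabilityTheory.Kernel.integral_comp hint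
  rw [heq, ProbabilityTheory.Kernel.const_apply] at hcomp
  have hi := hint.integral_comp
  rw [ProbabilityTheory.Kernel.const_apply] at hi
  exact ⟨hi, hcomp⟩

/-- If `κ` is Lipschitz for the Wasserstein distance and the measurable maps `f n` converge
uniformly to the identity, then `μ.bind (κ ∘ f n)` converges weakly to `μ.bind κ`. -/
theorem tendsto_bind_comp_of_wassersteinDist_le {X : Type*} [MetricSpace X]
    [SecondCountableTopology X] [MeasurableSpace X] [BorelSpace X] {p : ℝ} (hp : 1 ≤ p) {C : ℝ≥0}
    {κ : X → Measure X} (hκ : Measurable κ) [hκprob : ∀ x, IsProbabilityMeasure (κ x)]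
    (hκC : ∀ x y : X, wassersteinDist p (κ x) (κ y) ≤ C * edist x y)
    (μ : Measure X) [IsProbabilityMeasure μ] {f : ℕ → X → X} (hf : ∀ n, Measurable (f n))
    {ε : ℕ → ℝ≥0∞} (hfε : ∀ n x, edist x (f n x) ≤ ε n) (hε : Tendsto ε atTop (𝓝 0))
    {μs : ℕ → ProbabilityMeasure X} (hμs : ∀ n, (μs n : Measure X) = μ.bind (κ ∘ f n))
    {μ' : ProbabilityMeasure X} (hμ' : (μ' : Measure X) = μ.bind κ) :
    Tendsto μs atTop (𝓝 μ') := by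
  rw [tendsto_iff_forall_lipschitz_integral_tendsto]
  rintro g ⟨B, hB⟩ ⟨L, hL⟩
  obtain ⟨M, hM⟩ : ∃ M, ∀ x, ‖g x‖ ≤ M := by
    rcases isEmpty_or_nonempty X with h | ⟨⟨a⟩⟩
    · exact ⟨0, fun x => h.elim x⟩
    · refine ⟨‖g a‖ + B, fun x => ?_⟩
      have := norm_le_norm_add_norm_sub' (g x) (g a)
      rw [← dist_eq_norm] at this
      linarith [hB x a]
  have hgm : StronglyMeasurable g := hL.continuous.stronglyMeasurable
  have hint : ∀ x, Integrable g (κ x) := fun x =>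
    .of_bound hgm.aestronglyMeasurable M (.of_forall hM)
  obtain ⟨hi, hbind⟩ := integral_bind_of_bounded (μ := μ) hκ hgm hM
  have hbound : ∀ n, edist (∫ x, g x ∂(μs n : Measure X)) (∫ x, g x ∂(μ' : Measure X)) ≤
      L * (C * ε n) := fun n => by
    have : ∀ x, IsProbabilityMeasure ((κ ∘ f n) x) := fun x => hκprob (f n x)
    obtain ⟨hin, hbindn⟩ := integral_bind_of_bounded (μ := μ) (hκ.comp (hf n)) hgm hM
    rw [hμs, hμ', hbind, hbindn, edist_eq_enorm_sub, ← integral_sub hin hi]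
    calc _ ≤ ∫⁻ x, ‖∫ y, g y ∂((κ ∘ f n) x) - ∫ y, g y ∂(κ x)‖ₑ ∂μ :=
          enorm_integral_le_lintegral_enorm _
      _ ≤ ∫⁻ _, L * (C * ε n) ∂μ := lintegral_mono fun x => by
          rw [← edist_eq_enorm_sub]
          refine (edist_integral_le_mul_wassersteinDist hp hL _ _ (hint _) (hint _)).trans ?_
          gcongr
          refine (hκC _ _).trans ?_
          rw [edist_comm]
          gcongr
          exact hfε n x
      _ = L * (C * ε n) := by simp
  rw [tendsto_iff_edist_tendsto_0]
  refine tendsto_of_tendsto_of_tendsto_of_le_of_le tendsto_const_nhds ?_ (fun _ => zero_le) hbound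
  have h := ENNReal.Tendsto.const_mul (a := (L : ℝ≥0∞))
    (ENNReal.Tendsto.const_mul (a := (C : ℝ≥0∞)) hε (Or.inr ENNReal.coe_ne_top))
    (Or.inr ENNReal.coe_ne_top)
  simpa using h

/-- If `κ` is Lipschitz for the Wasserstein distance, then replacing `κ` by its discretization
`κ ∘ e ∘ N`, any coupling `γ` lifts to a coupling of the images of its marginals whose cost is at
most the Lipschitz constant times that of `γ`, up to the discretization error. -/
theorem exists_coupling_bind_comp {X : Type*} [MetricSpace X]
    [SecondCountableTopology X] [MeasurableSpace X] [BorelSpace X] {p : ℝ} (hp : 1 ≤ p) {C : ℝ≥0}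
    {κ : X → Measure X} (hκ : Measurable κ)
    (hκC : ∀ x y : X, wassersteinDist p (κ x) (κ y) ≤ C * edist x y)
    (γ : Measure (X × X)) [IsProbabilityMeasure γ] {N : X → ℕ} (hN : Measurable N) (e : ℕ → X)
    {ε : ℝ≥0∞} (hε : 0 < ε) (hNε : ∀ x, edist x (e (N x)) ≤ ε) :
    ∃ π : Measure (X × X),
      (π.map Prod.fst = (γ.map Prod.fst).bind (κ ∘ e ∘ N) ∧
        π.map Prod.snd = (γ.map Prod.snd).bind (κ ∘ e ∘ N)) ∧
      (∫⁻ z, edist z.1 z.2 ^ p ∂π) ^ (1 / p) ≤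
        C * (∫⁻ z, edist z.1 z.2 ^ p ∂γ) ^ (1 / p) + (C * (2 * ε) + ε) := by
  have hp0 : 0 < p := one_pos.trans_le hp
  have hopt : ∀ i j : ℕ, ∃ η : Measure (X × X),
      (η.map Prod.fst = κ (e i) ∧ η.map Prod.snd = κ (e j)) ∧
      (∫⁻ z, edist z.1 z.2 ^ p ∂η) ^ (1 / p) ≤ C * edist (e i) (e j) + ε := fun i j => by
    have hlt : wassersteinDist p (κ (e i)) (κ (e j)) < C * edist (e i) (e j) + ε :=
      (hκC _ _).trans_lt (ENNReal.lt_add_right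
        (ENNReal.mul_ne_top ENNReal.coe_ne_top (edist_ne_top _ _)) hε.ne')
    simp only [wassersteinDist, iInf_lt_iff] at hlt
    obtain ⟨η, hη, hlt⟩ := hlt
    exact ⟨η, hη, hlt.le⟩
  choose η hη hηcost using hopt
  let q : X × X → Measure (X × X) := fun z => η (N z.1) (N z.2)
  have hq : Measurable q :=
    (measurable_of_countable fun ij : ℕ × ℕ => η ij.1 ij.2).comp
      ((hN.comp measurable_fst).prodMk (hN.comp measurable_snd))
  have hmarg : ∀ {r s : X × X → X}, Measurable r → Measurable s →
      (∀ z, (q z).map r = κ (e (N (s z)))) →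
      (γ.bind q).map r = (γ.map s).bind (κ ∘ e ∘ N) := fun {r s} hr hs h => by
    have hκN : Measurable (κ ∘ e ∘ N) := hκ.comp (measurable_from_top.comp hN)
    ext A hA
    rw [Measure.map_apply hr hA, Measure.bind_apply (hr hA) hq.aemeasurable,
      Measure.bind_apply hA hκN.aemeasurable,
      lintegral_map (f := fun x => (κ ∘ e ∘ N) x A)
        ((Measure.measurable_coe hA).comp hκN) hs]
    refine lintegral_congr fun z => ?_
    rw [← Measure.map_apply hr hA, h]
    rfl
  refine ⟨γ.bind q, ⟨hmarg measurable_fst measurable_fst fun z => (hη _ _).1,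
    hmarg measurable_snd measurable_snd fun z => (hη _ _).2⟩, ?_⟩
  rw [Measure.lintegral_bind hq.aemeasurable (by fun_prop)]
  let u : X × X → ℝ≥0∞ := fun z => C * edist z.1 z.2
  let v : X × X → ℝ≥0∞ := fun _ => C * (2 * ε) + ε
  have hu : AEMeasurable u γ := by fun_prop
  have hv : AEMeasurable v γ := by fun_prop
  have hpt : ∀ z : X × X, ∫⁻ w, edist w.1 w.2 ^ p ∂(q z) ≤
      (u + v) z ^ p := fun z => by
    rw [← ENNReal.rpow_inv_le_iff hp0, ← one_div]
    refine (hηcost _ _).trans ?_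
    have htri : edist (e (N z.1)) (e (N z.2)) ≤ edist z.1 z.2 + 2 * ε := by
      calc _ ≤ edist (e (N z.1)) z.1 + edist z.1 z.2 + edist z.2 (e (N z.2)) :=
            edist_triangle4 _ _ _ _
        _ ≤ ε + edist z.1 z.2 + ε := by
            gcongr
            · rw [edist_comm]; exact hNε _
            · exact hNε _
        _ = edist z.1 z.2 + 2 * ε := by ring
    calc _ ≤ C * (edist z.1 z.2 + 2 * ε) + ε := by gcongr
      _ = _ := by simp only [u, v, Pi.add_apply]; ring
  calc _ ≤ (∫⁻ z, (u + v) z ^ p ∂γ) ^ (1 / p) := by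
        gcongr with z
        exact hpt z
    _ ≤ (∫⁻ z : X × X, (C * edist z.1 z.2) ^ p ∂γ) ^ (1 / p) +
          (∫⁻ _ : X × X, (C * (2 * ε) + ε) ^ p ∂γ) ^ (1 / p) :=
        ENNReal.lintegral_Lp_add_le hu hv hp
    _ = _ := by
        congr 1
        · simp_rw [ENNReal.mul_rpow_of_nonneg _ _ hp0.le]
          rw [lintegral_const_mul' _ _ (ENNReal.rpow_ne_top_of_nonneg hp0.le ENNReal.coe_ne_top),
            ENNReal.mul_rpow_of_nonneg _ _ (by positivity), one_div,
            ENNReal.rpow_rpow_inv hp0.ne']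
        · rw [lintegral_const, measure_univ, mul_one, one_div, ENNReal.rpow_rpow_inv hp0.ne']

/-- A Markov kernel on a Polish space that is Lipschitz for the Wasserstein distance acts on
probability measures as a Lipschitz map with the same constant. -/
theorem wassersteinDist_bind_le {X : Type*} [MetricSpace X] [CompleteSpace X]
    [SecondCountableTopology X] [MeasurableSpace X] [BorelSpace X] {p : ℝ} (hp : 1 ≤ p) {C : ℝ≥0}
    {κ : X → Measure X} (hκ : Measurable κ) [hκprob : ∀ x, IsProbabilityMeasure (κ x)]
    (hκC : ∀ x y : X, wassersteinDist p (κ x) (κ y) ≤ C * edist x y)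
    (μ ν : Measure X) [IsProbabilityMeasure μ] [IsProbabilityMeasure ν] :
    wassersteinDist p (μ.bind κ) (ν.bind κ) ≤ C * wassersteinDist p μ ν := by
  have : Nonempty X := nonempty_of_isProbabilityMeasure μ
  refine le_mul_wassersteinDist fun γ hγ => ?_
  have hγprob : IsProbabilityMeasure γ := by
    have : IsProbabilityMeasure (γ.map Prod.fst) := by rw [hγ.1]; infer_instance
    exact Measure.isProbabilityMeasure_of_map Prod.fst
  obtain ⟨ε, -, hε0, hε⟩ := exists_seq_strictAnti_tendsto' ENNReal.zero_lt_top
  choose N e hN hNe using fun n => exists_measurable_nat_edist_le (X := X) (hε0 n).1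
  choose π hπ hcost using fun n =>
    exists_coupling_bind_comp hp hκ hκC γ (hN n) (e n) (hε0 n).1 (hNe n)
  have hf : ∀ n, Measurable (e n ∘ N n) := fun n => measurable_from_top.comp (hN n)
  have hlim : ∀ (ρ : Measure X) [IsProbabilityMeasure ρ],
      ∃ (ρs : ℕ → ProbabilityMeasure X) (ρ' : ProbabilityMeasure X),
        (∀ n, (ρs n : Measure X) = ρ.bind (κ ∘ e n ∘ N n)) ∧ (ρ' : Measure X) = ρ.bind κ ∧
          Tendsto ρs atTop (𝓝 ρ') := fun ρ _ =>
    ⟨fun n => ⟨ρ.bind (κ ∘ e n ∘ N n), isProbabilityMeasure_bind (hκ.comp (hf n)).aemeasurable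
        (.of_forall fun x => hκprob _)⟩,
      ⟨ρ.bind κ, isProbabilityMeasure_bind hκ.aemeasurable (.of_forall hκprob)⟩,
      fun _ => rfl, rfl,
      tendsto_bind_comp_of_wassersteinDist_le hp hκ hκC ρ hf hNe hε (fun _ => rfl) rfl⟩
  obtain ⟨μs, μ', hμs, hμ', hμlim⟩ := hlim μ
  obtain ⟨νs, ν', hνs, hν', hνlim⟩ := hlim ν
  rw [← hμ', ← hν']
  refine wassersteinDist_le_of_tendsto (one_pos.trans_le hp) hμlim hνlim π
    (fun n => by simpa only [hγ.1, hγ.2, hμs, hνs] using hπ n) ?_ hcost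
  have h2ε : Tendsto (fun n => 2 * ε n) atTop (𝓝 (2 * 0)) :=
    ENNReal.Tendsto.const_mul hε (Or.inr ENNReal.ofNat_ne_top)
  have hCε : Tendsto (fun n => C * (2 * ε n)) atTop (𝓝 (C * (2 * 0))) :=
    ENNReal.Tendsto.const_mul h2ε (Or.inr ENNReal.coe_ne_top)
  simpa using (hCε.add hε).const_add (C * (∫⁻ z, edist z.1 z.2 ^ p ∂γ) ^ (1 / p))

/-- Let `(X,d)` be a complete separable metric space, `C ≥ 0`, and `κ` a
measurable map from `X` to Borel probability measures with `W₂(κ(x),κ(y)) ≤ C d(x,y)` for all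
`x, y`.  Then `W₂(μκ, νκ) ≤ C W₂(μ,ν)` for all Borel probability measures `μ, ν`. -/
theorem stmt13 {X : Type*} [MetricSpace X] [CompleteSpace X]
    [TopologicalSpace.SeparableSpace X] [MeasurableSpace X] [BorelSpace X]
    (C : ℝ≥0) (κ : X → Measure X) (hκmeas : Measurable κ)
    (hκprob : ∀ x, IsProbabilityMeasure (κ x))
    (hκcontr : ∀ x y : X, wassersteinDist 2 (κ x) (κ y) ≤ (C : ℝ≥0∞) * edist x y)
    (μ ν : Measure X) (hμ : IsProbabilityMeasure μ) (hν : IsProbabilityMeasure ν) :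
    wassersteinDist 2 (μ.bind κ) (ν.bind κ) ≤ (C : ℝ≥0∞) * wassersteinDist 2 μ ν := by
  have : SecondCountableTopology X := UniformSpace.secondCountable_of_separable X
  exact wassersteinDist_bind_le one_le_two hκmeas hκcontr μ ν
end

section
/- Let (X,d) be a complete separable metric space, let C ≥ 0, and let κ be a map from X to Borel probability measures on X, measurable for the weak topology, such that for every bounded Lipschitz f : X → ℝ the function x ↦ ∫_X f dκ(x) is Lipschitz with constant at most C·Lip(f). Then for all Borel probability measures μ, ν on X: W₁(μκ, νκ) ≤ C·W₁(μ, ν). -/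
open MeasureTheory Filter Topology
open scoped ENNReal NNReal

/-- Linear programming duality for the finite transport problem. -/
theorem exists_transport_plan_of_dual_le_s14 {ι : Type*} [Fintype ι] (c : ι → ι → ℝ)
    {a b : ι → ℝ} (ha : a ∈ stdSimplex ℝ ι) (hb : b ∈ stdSimplex ℝ ι) (K : ℝ)
    (h : ∀ f g : ι → ℝ, (∀ i j, f i + g j ≤ c i j) → ∑ i, f i * a i + ∑ j, g j * b j ≤ K) :
    ∃ π : ι × ι → ℝ, (∀ z, 0 ≤ π z) ∧ (∀ i, ∑ j, π (i, j) = a i) ∧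
      (∀ j, ∑ i, π (i, j) = b j) ∧ ∑ i, ∑ j, π (i, j) * c i j ≤ K := by
  classical
  let T : (ι × ι → ℝ) →ₗ[ℝ] (ι → ℝ) × (ι → ℝ) × ℝ :=
    { toFun := fun π => (fun i => ∑ j, π (i, j), fun j => ∑ i, π (i, j), ∑ i, ∑ j, π (i, j) * c i j)
      map_add' := fun x y => by
        simp only [Pi.add_apply, add_mul, Finset.sum_add_distrib]
        rfl
      map_smul' := fun r x => by
        simp only [Pi.smul_apply, smul_eq_mul, mul_assoc, ← Finset.mul_sum]
        rfl }
  by_contra! hcon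
  have hdisj : Disjoint (T '' stdSimplex ℝ (ι × ι)) ({a} ×ˢ {b} ×ˢ Set.Iic K) := by
    rw [Set.disjoint_left]
    rintro _ ⟨π, hπ, rfl⟩ ⟨h1, h2, h3⟩
    exact absurd h3 (not_le.2 (hcon π hπ.1 (congrFun h1) (congrFun h2)))
  obtain ⟨φ, u, v, hu, huv, hv⟩ := geometric_hahn_banach_compact_closed
    ((convex_stdSimplex ℝ (ι × ι)).linear_image T)
    ((isCompact_stdSimplex ℝ (ι × ι)).image T.continuous_of_finiteDimensional)
    ((convex_singleton a).prod ((convex_singleton b).prod (convex_Iic K)))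
    (isClosed_singleton.prod (isClosed_singleton.prod isClosed_Iic)) hdisj
  let p : ι → ℝ := fun i => φ (Pi.single i 1, 0, 0)
  let q : ι → ℝ := fun i => φ (0, Pi.single i 1, 0)
  let s : ℝ := φ (0, 0, 1)
  have hφ : ∀ x y t, φ (x, y, t) = ∑ i, p i * x i + ∑ j, q j * y j + s * t := by
    intro x y t
    have h1 : (x, y, t) = ∑ i, x i • ((Pi.single i 1, 0, 0) : (ι → ℝ) × (ι → ℝ) × ℝ)
        + ∑ i, y i • ((0, Pi.single i 1, 0) : (ι → ℝ) × (ι → ℝ) × ℝ)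
        + t • ((0, 0, 1) : (ι → ℝ) × (ι → ℝ) × ℝ) := by
      refine Prod.ext ?_ (Prod.ext ?_ ?_)
      · simp [Prod.fst_sum, ← pi_eq_sum_univ' x]
      · simp [Prod.fst_sum, Prod.snd_sum, ← pi_eq_sum_univ' y]
      · simp [Prod.snd_sum]
    rw [h1]
    simp only [map_add, map_sum, map_smul, smul_eq_mul]
    simp only [p, q, s, mul_comm]
  have hvK : ∀ t ≤ K, v < ∑ i, p i * a i + ∑ j, q j * b j + s * t := fun t ht => by
    rw [← hφ]
    exact hv _ ⟨rfl, rfl, ht⟩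
  have hprod : ∑ i, p i * a i + ∑ j, q j * b j + s * ∑ i, ∑ j, a i * b j * c i j < u := by
    rw [← hφ]
    refine hu _ ⟨fun z => a z.1 * b z.2, ⟨fun z => mul_nonneg (ha.1 _) (hb.1 _), ?_⟩, ?_⟩
    · simp [Fintype.sum_prod_type, ← Finset.mul_sum, ha.2, hb.2]
    · refine Prod.ext ?_ (Prod.ext ?_ rfl)
      · ext i
        simp [T, ← Finset.mul_sum, hb.2]
      · ext i
        simp [T, ← Finset.sum_mul, ha.2]
  have hs : s < 0 := by
    by_contra! hs
    have h1 := hvK (min K (∑ i, ∑ j, a i * b j * c i j)) (min_le_left _ _)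
    have h2 := mul_le_mul_of_nonneg_left
      (min_le_right K (∑ i, ∑ j, a i * b j * c i j)) hs
    linarith
  have hpq : ∀ i j, p i + q j + s * c i j < u := by
    intro i j
    have := hu (T (Pi.single (i, j) 1)) ⟨_, single_mem_stdSimplex ℝ (i, j), rfl⟩
    refine lt_of_eq_of_lt ?_ this
    rw [← Prod.mk.eta (p := T (Pi.single (i, j) 1)), ← Prod.mk.eta (p := (T (Pi.single (i, j) 1)).2),
      hφ]
    have hx : ∀ i' j', (Pi.single (i, j) 1 : ι × ι → ℝ) (i', j')
        = (if i' = i then 1 else 0) * (if j' = j then 1 else 0) := by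
      intro i' j'
      simp only [Pi.single_apply, Prod.mk.injEq]
      split_ifs <;> simp_all
    simp [T, hx]
  have hfg := h (fun i => (p i - u) / (-s)) (fun j => q j / (-s)) fun i j => by
    rw [← add_div, div_le_iff₀ (by linarith)]
    linarith [hpq i j]
  have hsum : ∑ i, (p i - u) / (-s) * a i + ∑ j, q j / (-s) * b j
      = (∑ i, p i * a i - u + ∑ j, q j * b j) / (-s) := by
    have e1 : ∑ i, (p i - u) / (-s) * a i = (∑ i, p i * a i - u * ∑ i, a i) / (-s) := by
      rw [Finset.mul_sum, ← Finset.sum_sub_distrib, Finset.sum_div]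
      exact Finset.sum_congr rfl fun i _ => by ring
    have e2 : ∑ j, q j / (-s) * b j = (∑ j, q j * b j) / (-s) := by
      rw [Finset.sum_div]
      exact Finset.sum_congr rfl fun i _ => by ring
    rw [e1, e2, ha.2]
    ring
  rw [hsum, div_le_iff₀ (by linarith)] at hfg
  linarith [hvK K le_rfl]

/-- Couplings of weakly convergent sequences accumulate at a coupling of the limits. -/
theorem exists_coupling_limit {X : Type*} [MetricSpace X] [CompleteSpace X]
    [SecondCountableTopology X] [MeasurableSpace X] [BorelSpace X]
    {m₀ n₀ : ProbabilityMeasure X} {γ : ℕ → ProbabilityMeasure (X × X)}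
    {m n : ℕ → ProbabilityMeasure X}
    (hm : Tendsto m atTop (𝓝 m₀)) (hn : Tendsto n atTop (𝓝 n₀))
    (hγm : ∀ k, (γ k : Measure (X × X)).map Prod.fst = m k)
    (hγn : ∀ k, (γ k : Measure (X × X)).map Prod.snd = n k) :
    ∃ (γ₀ : ProbabilityMeasure (X × X)) (U : Ultrafilter ℕ), (U : Filter ℕ) ≤ atTop ∧
      Tendsto γ U (𝓝 γ₀) ∧ (γ₀ : Measure (X × X)).map Prod.fst = m₀ ∧
      (γ₀ : Measure (X × X)).map Prod.snd = n₀ := by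
  have tight : ∀ {l : ℕ → ProbabilityMeasure X} {l₀ : ProbabilityMeasure X},
      Tendsto l atTop (𝓝 l₀) →
        IsTightMeasureSet {((μ : ProbabilityMeasure X) : Measure X) | μ ∈ Set.range l} := by
    intro l l₀ hl
    refine isTightMeasureSet_of_isCompact_closure
      (hl.isCompact_insert_range.closure_of_subset (Set.subset_insert _ _))
  have hc : IsCompact (closure (Set.range γ)) := by
    refine isCompact_closure_of_isTightMeasureSet (.prodMk ((tight hm).subset ?_)
      ((tight hn).subset ?_))
    · rintro _ ⟨_, ⟨_, ⟨k, rfl⟩, rfl⟩, rfl⟩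
      exact ⟨m k, ⟨k, rfl⟩, (hγm k).symm⟩
    · rintro _ ⟨_, ⟨_, ⟨k, rfl⟩, rfl⟩, rfl⟩
      exact ⟨n k, ⟨k, rfl⟩, (hγn k).symm⟩
  obtain ⟨γ₀, -, hγ₀⟩ := hc.ultrafilter_le_nhds' ((Ultrafilter.of atTop).map γ)
    (Filter.mem_of_superset (Filter.range_mem_map) subset_closure)
  have hU : ((Ultrafilter.of atTop : Ultrafilter ℕ) : Filter ℕ) ≤ atTop := Ultrafilter.of_le _
  refine ⟨γ₀, Ultrafilter.of atTop, hU, hγ₀, ?_, ?_⟩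
  · have h1 := ProbabilityMeasure.tendsto_map_of_tendsto_of_continuous γ γ₀ hγ₀ continuous_fst
    have h2 : (fun k => (γ k).map continuous_fst.measurable.aemeasurable) = m :=
      funext fun k => ProbabilityMeasure.toMeasure_injective (hγm k)
    rw [h2] at h1
    exact congrArg ProbabilityMeasure.toMeasure (tendsto_nhds_unique h1 (hm.mono_left hU))
  · have h1 := ProbabilityMeasure.tendsto_map_of_tendsto_of_continuous γ γ₀ hγ₀ continuous_snd
    have h2 : (fun k => (γ k).map continuous_snd.measurable.aemeasurable) = n :=
      funext fun k => ProbabilityMeasure.toMeasure_injective (hγn k)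
    rw [h2] at h1
    exact congrArg ProbabilityMeasure.toMeasure (tendsto_nhds_unique h1 (hn.mono_left hU))

/-- Kantorovich duality for probability measures on a finite space. -/
theorem exists_coupling_integral_le_of_finite {ι : Type*} [Finite ι] [MeasurableSpace ι]
    [MeasurableSingletonClass ι] (m n : Measure ι) [IsProbabilityMeasure m]
    [IsProbabilityMeasure n] (c : ι → ι → ℝ) (K : ℝ)
    (h : ∀ f g : ι → ℝ, (∀ i j, f i + g j ≤ c i j) → ∫ i, f i ∂m + ∫ j, g j ∂n ≤ K) :
    ∃ γ : Measure (ι × ι), γ.map Prod.fst = m ∧ γ.map Prod.snd = n ∧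
      ∫ z, c z.1 z.2 ∂γ ≤ K := by
  classical
  have := Fintype.ofFinite ι
  have hint : ∀ (l : Measure ι) [IsProbabilityMeasure l] (f : ι → ℝ),
      ∫ i, f i ∂l = ∑ i, f i * l.real {i} := fun l _ f => by
    rw [integral_fintype .of_finite]
    simp [mul_comm]
  have hmem : ∀ (l : Measure ι) [IsProbabilityMeasure l],
      (fun i => l.real {i}) ∈ stdSimplex ℝ ι := fun l _ => by
    refine ⟨fun i => measureReal_nonneg, ?_⟩
    simp
  obtain ⟨π, hπ, hπm, hπn, hπK⟩ := exists_transport_plan_of_dual_le_s14 c (hmem m) (hmem n) K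
    fun f g hfg => by
      rw [← hint, ← hint]
      exact h f g hfg
  let γ : Measure (ι × ι) := ∑ z, ENNReal.ofReal (π z) • Measure.dirac z
  have hγ : ∀ s : Set (ι × ι), γ s = ∑ z, if z ∈ s then ENNReal.ofReal (π z) else 0 := fun s => by
    simp [γ, Measure.dirac_apply, Set.indicator_apply]
  have hγz : ∀ z, γ {z} = ENNReal.ofReal (π z) := fun z => by simp [hγ]
  have hfin : IsFiniteMeasure γ := ⟨by simp [hγ, ENNReal.sum_lt_top]⟩
  refine ⟨γ, ?_, ?_, ?_⟩
  · refine Measure.ext_of_singleton fun i => ?_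
    rw [Measure.map_apply measurable_fst (measurableSet_singleton i), hγ, Fintype.sum_prod_type]
    simp only [Set.mem_preimage, Set.mem_singleton_iff, Finset.sum_ite_irrel,
      Finset.sum_const_zero, Finset.sum_ite_eq', Finset.mem_univ, if_true]
    rw [← ENNReal.ofReal_sum_of_nonneg fun j _ => hπ (i, j), hπm, ofReal_measureReal]
  · refine Measure.ext_of_singleton fun j => ?_
    rw [Measure.map_apply measurable_snd (measurableSet_singleton j), hγ, Fintype.sum_prod_type]
    simp only [Set.mem_preimage, Set.mem_singleton_iff, Finset.sum_ite_eq',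
      Finset.mem_univ, if_true]
    rw [← ENNReal.ofReal_sum_of_nonneg fun i _ => hπ (i, j), hπn, ofReal_measureReal]
  · rw [integral_fintype .of_finite, Fintype.sum_prod_type]
    simpa [Measure.real, hγz, hπ] using hπK

theorem min_dist_triangle {X : Type*} [PseudoMetricSpace X] {R : ℝ} (hR : 0 ≤ R) (x y z : X) :
    min (dist x z) R ≤ min (dist x y) R + min (dist y z) R := by
  have := dist_triangle x y z
  have := dist_nonneg (x := x) (y := y)
  have := dist_nonneg (x := y) (y := z)
  rcases le_total (dist x y) R with h1 | h1 <;> rcases le_total (dist y z) R with h2 | h2 <;>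
    simp only [h1, h2, min_eq_left, min_eq_right] <;>
    first
      | exact (min_le_left _ _).trans (by linarith)
      | exact (min_le_right _ _).trans (by linarith)

theorem abs_min_dist_le {X : Type*} [PseudoMetricSpace X] {R : ℝ} (hR : 0 ≤ R) (x y : X) :
    |min (dist x y) R| ≤ R := by
  rw [abs_of_nonneg (le_min dist_nonneg hR)]
  exact min_le_right _ _

/-- The `c`-transform of `g` for the truncated distance, on a finite set of points. -/
theorem exists_potential_min_dist {X ι : Type*} [PseudoMetricSpace X] [Finite ι] [Nonempty ι]
    {R : ℝ} (hR : 0 ≤ R) (e : ι → X) (f g : ι → ℝ)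
    (hfg : ∀ i j, f i + g j ≤ min (dist (e i) (e j)) R) :
    ∃ h : X → ℝ, (∀ x y, h x ≤ h y + min (dist x y) R) ∧ (∀ i, f i ≤ h (e i)) ∧
      ∀ i, g i ≤ -h (e i) := by
  have := Fintype.ofFinite ι
  let F : X → ι → ℝ := fun x j => min (dist x (e j)) R - g j
  refine ⟨fun x => Finset.univ.inf' Finset.univ_nonempty (F x), fun x y => ?_, fun i => ?_,
    fun i => ?_⟩
  · obtain ⟨j, -, hj⟩ := Finset.exists_mem_eq_inf' Finset.univ_nonempty (F y)
    have h1 := Finset.inf'_le (F x) (Finset.mem_univ j)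
    have h2 := min_dist_triangle hR x y (e j)
    simp only [F] at *
    linarith
  · refine Finset.le_inf' _ _ fun j _ => ?_
    simp only [F]
    linarith [hfg i j]
  · have h1 := Finset.inf'_le (F (e i)) (Finset.mem_univ i)
    have h2 : F (e i) i = -g i := by simp [F, hR]
    linarith

theorem lipschitzWith_one_of_le_add_min_dist {X : Type*} [PseudoMetricSpace X] {R : ℝ}
    {h : X → ℝ} (hh : ∀ x y, h x ≤ h y + min (dist x y) R) : LipschitzWith 1 h :=
  LipschitzWith.of_le_add fun x y => (hh x y).trans (by gcongr; exact min_le_left _ _)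

theorem exists_abs_le_of_le_add_min_dist {X : Type*} [PseudoMetricSpace X] {R : ℝ}
    {h : X → ℝ} (hh : ∀ x y, h x ≤ h y + min (dist x y) R) : ∃ M, ∀ x, |h x| ≤ M := by
  rcases isEmpty_or_nonempty X with _ | ⟨⟨x₀⟩⟩
  · exact ⟨0, fun x => isEmptyElim x⟩
  · refine ⟨|h x₀| + R, fun x => abs_le.2 ⟨?_, ?_⟩⟩
    · linarith [hh x₀ x, min_le_right (dist x₀ x) R, neg_abs_le (h x₀)]
    · linarith [hh x x₀, min_le_right (dist x x₀) R, le_abs_self (h x₀)]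

/-- Approximate duality for the image measures under a simple function. -/
theorem exists_coupling_map_simpleFunc {X : Type*} [MetricSpace X] [SecondCountableTopology X]
    [MeasurableSpace X] [BorelSpace X] (m n : Measure X) [IsProbabilityMeasure m]
    [IsProbabilityMeasure n] (K : ℝ)
    (h : ∀ f : X → ℝ, LipschitzWith 1 f → (∃ M, ∀ x, |f x| ≤ M) → ∫ x, f x ∂m - ∫ x, f x ∂n ≤ K)
    {R : ℝ} (hR : 0 ≤ R) (T : SimpleFunc X X) :
    ∃ γ : ProbabilityMeasure (X × X), (γ : Measure (X × X)).map Prod.fst = m.map T ∧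
      (γ : Measure (X × X)).map Prod.snd = n.map T ∧
      ∫ z, min (dist z.1 z.2) R ∂(γ : Measure (X × X)) ≤
        K + ∫ x, min (dist (T x) x) R ∂m + ∫ x, min (dist (T x) x) R ∂n := by
  have hX : Nonempty X := nonempty_of_isProbabilityMeasure m
  let S : X → T.range := fun x => ⟨T x, T.mem_range_self x⟩
  have hS : Measurable S := T.measurable.subtype_mk
  have : Nonempty T.range := hX.map S
  have := Measure.isProbabilityMeasure_map (μ := m) hS.aemeasurable
  have := Measure.isProbabilityMeasure_map (μ := n) hS.aemeasurable
  have hdint : ∀ (l : Measure X) [IsProbabilityMeasure l],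
      Integrable (fun x => min (dist (T x) x) R) l := fun l _ =>
    .of_bound ((T.measurable.dist measurable_id).min measurable_const).aestronglyMeasurable R
      (.of_forall fun x => abs_min_dist_le hR _ _)
  obtain ⟨P, hPm, hPn, hPK⟩ := exists_coupling_integral_le_of_finite (m.map S) (n.map S)
    (fun i j => min (dist (i : X) j) R)
    (K + ∫ x, min (dist (T x) x) R ∂m + ∫ x, min (dist (T x) x) R ∂n) fun f g hfg => by
      obtain ⟨φ, hφ, hφf, hφg⟩ := exists_potential_min_dist hR (fun i : T.range => (i : X)) f g hfg
      have hφL := lipschitzWith_one_of_le_add_min_dist hφ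
      obtain ⟨M, hM⟩ := exists_abs_le_of_le_add_min_dist hφ
      have hφint : ∀ (l : Measure X) [IsProbabilityMeasure l], Integrable φ l := fun l _ =>
        .of_bound hφL.continuous.aestronglyMeasurable M (.of_forall hM)
      have hSint : ∀ (l : Measure X) [IsProbabilityMeasure l] (k : T.range → ℝ),
          Integrable (fun x => k (S x)) l := fun l _ k =>
        have := Measure.isProbabilityMeasure_map (μ := l) hS.aemeasurable
        (Integrable.of_finite (μ := l.map S) (f := k)).comp_measurable hS
      rw [integral_map hS.aemeasurable (measurable_of_finite f).aestronglyMeasurable,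
        integral_map hS.aemeasurable (measurable_of_finite g).aestronglyMeasurable]
      have h1 : ∫ x, f (S x) ∂m ≤ ∫ x, (φ x + min (dist (T x) x) R) ∂m :=
        integral_mono (hSint m f) ((hφint m).add (hdint m)) fun x =>
          (hφf (S x)).trans (hφ (T x) x)
      have h2 : ∫ x, g (S x) ∂n ≤ ∫ x, (-φ x + min (dist (T x) x) R) ∂n := by
        refine integral_mono (hSint n g) ((hφint n).neg.add (hdint n)) fun x => ?_
        have h3 := hφg (S x)
        have h4 := hφ x (T x)
        rw [dist_comm] at h4
        simp only [S] at h3 ⊢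
        linarith
      rw [integral_add (hφint m) (hdint m)] at h1
      rw [integral_add (hφint n).fun_neg (hdint n), integral_neg] at h2
      linarith [h φ hφL ⟨M, hM⟩]
  have hval : Measurable (Prod.map Subtype.val Subtype.val : T.range × T.range → X × X) :=
    measurable_subtype_coe.prodMap measurable_subtype_coe
  have hP : IsProbabilityMeasure P := by
    refine ⟨?_⟩
    rw [← Set.preimage_univ (f := Prod.fst), ← Measure.map_apply measurable_fst .univ, hPm,
      measure_univ]
  refine ⟨⟨P.map (Prod.map Subtype.val Subtype.val),
    Measure.isProbabilityMeasure_map hval.aemeasurable⟩, ?_, ?_, ?_⟩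
  · rw [ProbabilityMeasure.coe_mk, Measure.map_map measurable_fst hval, Prod.map_fst',
      ← Measure.map_map measurable_subtype_coe measurable_fst, hPm,
      Measure.map_map measurable_subtype_coe hS]
    rfl
  · rw [ProbabilityMeasure.coe_mk, Measure.map_map measurable_snd hval, Prod.map_snd',
      ← Measure.map_map measurable_subtype_coe measurable_snd, hPn,
      Measure.map_map measurable_subtype_coe hS]
    rfl
  · rw [ProbabilityMeasure.coe_mk, integral_map hval.aemeasurable
      (measurable_dist.min measurable_const).aestronglyMeasurable]
    exact hPK

theorem continuous_integral_min_dist {X : Type*} [MetricSpace X] [SecondCountableTopology X]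
    [MeasurableSpace X] [BorelSpace X] {R : ℝ} (hR : 0 ≤ R) :
    Continuous fun γ : ProbabilityMeasure (X × X) =>
      ∫ z, min (dist z.1 z.2) R ∂(γ : Measure (X × X)) :=
  ProbabilityMeasure.continuous_integral_boundedContinuousFunction
    (BoundedContinuousFunction.ofNormedAddCommGroup (fun z : X × X => min (dist z.1 z.2) R)
      (by fun_prop) R fun z => abs_min_dist_le hR _ _)

/-- Kantorovich-Rubinstein duality for the truncated distance. -/
theorem exists_coupling_integral_min_dist_le {X : Type*} [MetricSpace X] [CompleteSpace X]
    [SecondCountableTopology X] [MeasurableSpace X] [BorelSpace X] (m n : ProbabilityMeasure X)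
    (K : ℝ) (h : ∀ f : X → ℝ, LipschitzWith 1 f → (∃ M, ∀ x, |f x| ≤ M) →
      ∫ x, f x ∂(m : Measure X) - ∫ x, f x ∂(n : Measure X) ≤ K) {R : ℝ} (hR : 0 ≤ R) :
    ∃ γ : ProbabilityMeasure (X × X), (γ : Measure (X × X)).map Prod.fst = m ∧
      (γ : Measure (X × X)).map Prod.snd = n ∧
      ∫ z, min (dist z.1 z.2) R ∂(γ : Measure (X × X)) ≤ K := by
  obtain ⟨x₀⟩ : Nonempty X := m.nonempty
  let T : ℕ → SimpleFunc X X :=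
    SimpleFunc.approxOn id measurable_id Set.univ x₀ (Set.mem_univ x₀)
  have hT : ∀ x, Tendsto (fun k => T k x) atTop (𝓝 x) := fun x =>
    SimpleFunc.tendsto_approxOn measurable_id (Set.mem_univ x₀) (by simp)
  have hmap : ∀ l : ProbabilityMeasure X,
      Tendsto (fun k => l.map (T k).measurable.aemeasurable) atTop (𝓝 l) := fun l => by
    refine ProbabilityMeasure.tendsto_iff_forall_integral_tendsto.2 fun f => ?_
    simp only [ProbabilityMeasure.toMeasure_map]
    simp_rw [fun k => integral_map (μ := (l : Measure X)) (T k).measurable.aemeasurable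
      f.continuous.aestronglyMeasurable]
    exact tendsto_integral_of_dominated_convergence (fun _ => ‖f‖)
      (fun k => (f.continuous.measurable.comp (T k).measurable).aestronglyMeasurable)
      (integrable_const _) (fun k => .of_forall fun x => f.norm_coe_le_norm _)
      (.of_forall fun x => (f.continuous.tendsto x).comp (hT x))
  have herr : ∀ l : ProbabilityMeasure X,
      Tendsto (fun k => ∫ x, min (dist (T k x) x) R ∂(l : Measure X)) atTop (𝓝 0) := fun l => by
    rw [← integral_zero X ℝ (μ := (l : Measure X))]
    refine tendsto_integral_of_dominated_convergence (fun _ => R)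
      (fun k => (((T k).measurable.dist measurable_id).min measurable_const).aestronglyMeasurable)
      (integrable_const _) (fun k => .of_forall fun x => abs_min_dist_le hR _ _)
      (.of_forall fun x => ?_)
    have h1 := ((hT x).dist (tendsto_const_nhds (x := x))).min (tendsto_const_nhds (x := R))
    simpa [hR] using h1
  choose γ hγm hγn hγK using fun k =>
    exists_coupling_map_simpleFunc (m : Measure X) (n : Measure X) K h hR (T k)
  obtain ⟨γ₀, U, hU, hlim, hm, hn⟩ := exists_coupling_limit (hmap m) (hmap n) hγm hγn
  refine ⟨γ₀, hm, hn, ?_⟩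
  have h1 := ((continuous_integral_min_dist hR).tendsto γ₀).comp hlim
  have h2 := (((herr m).const_add K).add (herr n)).mono_left hU
  rw [add_zero, add_zero] at h2
  exact le_of_tendsto_of_tendsto' h1 h2 hγK

/-- Kantorovich-Rubinstein duality: if the integrals of bounded `1`-Lipschitz functions against
two probability measures differ by at most `K`, some coupling has transport cost at most `K`. -/
theorem exists_coupling_lintegral_edist_le {X : Type*} [MetricSpace X] [CompleteSpace X]
    [SecondCountableTopology X] [MeasurableSpace X] [BorelSpace X] (m n : ProbabilityMeasure X)
    (K : ℝ) (h : ∀ f : X → ℝ, LipschitzWith 1 f → (∃ M, ∀ x, |f x| ≤ M) →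
      ∫ x, f x ∂(m : Measure X) - ∫ x, f x ∂(n : Measure X) ≤ K) :
    ∃ γ : Measure (X × X), γ.map Prod.fst = m ∧ γ.map Prod.snd = n ∧
      ∫⁻ z, edist z.1 z.2 ∂γ ≤ ENNReal.ofReal K := by
  choose γ hγm hγn hγK using fun k : ℕ =>
    exists_coupling_integral_min_dist_le m n K h (Nat.cast_nonneg (α := ℝ) k)
  obtain ⟨γ₀, U, hU, hlim, hm, hn⟩ :=
    exists_coupling_limit (tendsto_const_nhds (x := m)) (tendsto_const_nhds (x := n)) hγm hγn
  refine ⟨γ₀, hm, hn, ?_⟩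
  have hint : ∀ (l : ProbabilityMeasure (X × X)) (k : ℕ),
      Integrable (fun z : X × X => min (dist z.1 z.2) (k : ℝ)) (l : Measure (X × X)) :=
    fun l k => .of_bound (measurable_dist.min measurable_const).aestronglyMeasurable k
      (.of_forall fun z => abs_min_dist_le k.cast_nonneg _ _)
  have hle : ∀ k : ℕ, ∫ z, min (dist z.1 z.2) (k : ℝ) ∂(γ₀ : Measure (X × X)) ≤ K := fun k => by
    have h1 := ((continuous_integral_min_dist (X := X) (Nat.cast_nonneg (α := ℝ) k)).tendsto
      γ₀).comp hlim
    refine le_of_tendsto h1 (((eventually_ge_atTop k).filter_mono hU).mono fun j hj => ?_)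
    refine (integral_mono (hint _ _) (hint _ _) fun z => ?_).trans (hγK j)
    exact min_le_min_left _ (Nat.cast_le.2 hj)
  have hmono := lintegral_tendsto_of_tendsto_of_monotone (μ := (γ₀ : Measure (X × X)))
    (f := fun k z => ENNReal.ofReal (min (dist z.1 z.2) (k : ℝ))) (F := fun z => edist z.1 z.2)
    (fun k => (measurable_dist.min measurable_const).ennreal_ofReal.aemeasurable)
    (.of_forall fun z i j hij => ENNReal.ofReal_le_ofReal (min_le_min_left _ (Nat.cast_le.2 hij)))
    (.of_forall fun z => by
      obtain ⟨k, hk⟩ := exists_nat_ge (dist z.1 z.2)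
      refine tendsto_const_nhds.congr' ((eventually_ge_atTop k).mono fun j hj => ?_)
      simp only [min_eq_left (hk.trans (Nat.cast_le.2 hj)), edist_dist])
  refine le_of_tendsto' hmono fun k => ?_
  rw [← ofReal_integral_eq_lintegral_ofReal (hint γ₀ k)
    (.of_forall fun z => le_min dist_nonneg k.cast_nonneg)]
  exact ENNReal.ofReal_le_ofReal (hle k)

theorem integral_measure_bind {X Y : Type*} [MeasurableSpace X] [MeasurableSpace Y]
    {μ : Measure X} [IsProbabilityMeasure μ] {κ : X → Measure Y} (hκ : Measurable κ)
    (hκprob : ∀ x, IsProbabilityMeasure (κ x)) {f : Y → ℝ} (hf : Measurable f)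
    (hb : ∃ M, ∀ y, |f y| ≤ M) :
    ∫ y, f y ∂(μ.bind κ) = ∫ x, ∫ y, f y ∂(κ x) ∂μ := by
  obtain ⟨M, hM⟩ := hb
  let η : ProbabilityTheory.Kernel X Y := ⟨κ, hκ⟩
  have : ProbabilityTheory.IsMarkovKernel η := ⟨hκprob⟩
  have h1 : μ.bind κ = (μ.compProd η).map Prod.snd := (Measure.snd_compProd μ η).symm
  have hint : Integrable (fun z : X × Y => f z.2) (μ.compProd η) :=
    .of_bound (hf.comp measurable_snd).aestronglyMeasurable M (.of_forall fun z => hM z.2)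
  rw [h1, integral_map measurable_snd.aemeasurable hf.aestronglyMeasurable,
    Measure.integral_compProd hint]
  rfl

theorem integral_bind_sub_integral_bind_le {X : Type*} [MetricSpace X]
    [SecondCountableTopology X] [MeasurableSpace X] [BorelSpace X]
    (C : ℝ≥0) {κ : X → Measure X} (hκmeas : Measurable κ)
    (hκprob : ∀ x, IsProbabilityMeasure (κ x)) {f : X → ℝ} (hf : Measurable f)
    (hb : ∃ M, ∀ y, |f y| ≤ M) (hL : LipschitzWith C fun x => ∫ y, f y ∂(κ x))
    {γ : Measure (X × X)} [IsProbabilityMeasure γ]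
    (hγ : C * ∫⁻ z, edist z.1 z.2 ∂γ ≠ ∞) :
    ∫ y, f y ∂((γ.map Prod.fst).bind κ) - ∫ y, f y ∂((γ.map Prod.snd).bind κ) ≤
      (C * ∫⁻ z, edist z.1 z.2 ∂γ).toReal := by
  have := Measure.isProbabilityMeasure_map (μ := γ) measurable_fst.aemeasurable
  have := Measure.isProbabilityMeasure_map (μ := γ) measurable_snd.aemeasurable
  rw [integral_measure_bind hκmeas hκprob hf hb, integral_measure_bind hκmeas hκprob hf hb]
  obtain ⟨M, hM⟩ := hb
  set F : X → ℝ := fun x => ∫ y, f y ∂(κ x)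
  have hFM : ∀ x, ‖F x‖ ≤ M := fun x => by
    simpa using norm_integral_le_of_norm_le_const (μ := κ x) (f := f) (.of_forall hM)
  have hFm : AEStronglyMeasurable F (γ.map Prod.fst) := hL.continuous.aestronglyMeasurable
  have hFm' : AEStronglyMeasurable F (γ.map Prod.snd) := hL.continuous.aestronglyMeasurable
  have hint₁ : Integrable (fun z : X × X => F z.1) γ :=
    .of_bound (hL.continuous.comp continuous_fst).aestronglyMeasurable M
      (.of_forall fun z => hFM z.1)
  have hint₂ : Integrable (fun z : X × X => F z.2) γ :=
    .of_bound (hL.continuous.comp continuous_snd).aestronglyMeasurable M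
      (.of_forall fun z => hFM z.2)
  rw [integral_map measurable_fst.aemeasurable hFm, integral_map measurable_snd.aemeasurable hFm',
    ← integral_sub hint₁ hint₂]
  rw [← lintegral_const_mul _ (measurable_fst.edist measurable_snd)] at hγ ⊢
  refine (Real.le_norm_self _).trans ((norm_integral_le_lintegral_norm _).trans
    (ENNReal.toReal_mono hγ (lintegral_mono fun z => ?_)))
  rw [ofReal_norm, ← edist_eq_enorm_sub]
  exact hL z.1 z.2

/-- Let `(X,d)` be a complete separable metric space, `C ≥ 0`, and `κ` a
measurable map from `X` to Borel probability measures such that `x ↦ ∫ f dκ(x)` is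
`C·Lip(f)`-Lipschitz for every bounded Lipschitz `f`.  Then `W₁(μκ, νκ) ≤ C W₁(μ,ν)`
for all Borel probability measures `μ, ν`. -/
theorem stmt14 {X : Type*} [MetricSpace X] [CompleteSpace X]
    [TopologicalSpace.SeparableSpace X] [MeasurableSpace X] [BorelSpace X]
    (C : ℝ≥0) (κ : X → Measure X) (hκmeas : Measurable κ)
    (hκprob : ∀ x, IsProbabilityMeasure (κ x))
    (hLip : ∀ (f : X → ℝ) (L : ℝ≥0), LipschitzWith L f → (∃ M, ∀ x, |f x| ≤ M) →
      LipschitzWith (C * L) (fun x => ∫ y, f y ∂ κ x))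
    (μ ν : Measure X) (hμ : IsProbabilityMeasure μ) (hν : IsProbabilityMeasure ν) :
    wassersteinDist 1 (μ.bind κ) (ν.bind κ) ≤ (C : ℝ≥0∞) * wassersteinDist 1 μ ν := by
  have := UniformSpace.secondCountable_of_separable X
  have hbind : ∀ (l : Measure X) [IsProbabilityMeasure l], IsProbabilityMeasure (l.bind κ) :=
    fun l _ => isProbabilityMeasure_bind hκmeas.aemeasurable (.of_forall hκprob)
  have key : ∀ γ : Measure (X × X), γ.map Prod.fst = μ → γ.map Prod.snd = ν →
      wassersteinDist 1 (μ.bind κ) (ν.bind κ) ≤ C * ∫⁻ z, edist z.1 z.2 ∂γ := by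
    rintro γ rfl rfl
    have hγ : IsProbabilityMeasure γ := by
      refine ⟨?_⟩
      rw [← Set.preimage_univ (f := Prod.fst), ← Measure.map_apply measurable_fst .univ,
        measure_univ]
    by_cases htop : C * ∫⁻ z, edist z.1 z.2 ∂γ = ∞
    · simp [htop]
    obtain ⟨γ', h1, h2, h3⟩ := exists_coupling_lintegral_edist_le
      ⟨_, hbind (γ.map Prod.fst)⟩ ⟨_, hbind (γ.map Prod.snd)⟩ _ fun f hf hb =>
        integral_bind_sub_integral_bind_le C hκmeas hκprob hf.continuous.measurable hb
          (by simpa using hLip f 1 hf hb) htop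
    rw [ENNReal.ofReal_toReal htop] at h3
    refine (iInf₂_le γ' ⟨h1, h2⟩).trans ?_
    simpa using h3
  rcases eq_or_ne C 0 with rfl | hC
  · simpa using key (μ.prod ν) (by simp) (by simp)
  · have hC' : (C : ℝ≥0∞) ≠ 0 := by simpa using hC
    rw [wassersteinDist.eq_def 1 μ ν, ENNReal.mul_iInf_of_ne hC' ENNReal.coe_ne_top]
    refine le_iInf fun γ => ?_
    rw [ENNReal.mul_iInf_of_ne hC' ENNReal.coe_ne_top]
    exact le_iInf fun hγ => by simpa using key γ hγ.1 hγ.2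
end

section
/- Let (X,d) be a complete separable metric space and let β : [0,∞) → [0,∞) be continuous, concave and bounded with β(0) = 0 and β(r) > 0 for r > 0. Then d_β(x,y) := β(d(x,y)) is a distance on X. Moreover, if C ≥ 0 and κ is a map from X to Borel probability measures on X, measurable for the weak topology, such that for every bounded Lipschitz f : X → ℝ the function x ↦ ∫_X f dκ(x) is Lipschitz with constant at most C·Lip(f), then for all Borel probability measures μ, ν on X: W_(β)(μκ, νκ) ≤ max(C,1)·W_(β)(μ, ν), where W_(β) is the L¹-Wasserstein distance associated with the distance d_β. -/
open MeasureTheory Filter Topology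
open scoped ENNReal NNReal

/-- The Wasserstein-type transport cost associated with a cost function `c`:
the infimum of `∫ c(x₁,x₂) dγ` over all couplings `γ` of `μ` and `ν`. -/
noncomputable def transportCost {X : Type*} [MetricSpace X] [MeasurableSpace X]
    (c : X → X → ℝ≥0∞) (μ ν : Measure X) : ℝ≥0∞ :=
  ⨅ (γ : Measure (X × X)) (_ : γ.map Prod.fst = μ ∧ γ.map Prod.snd = ν),
    ∫⁻ z, c z.1 z.2 ∂γ

/-- Kantorovich duality for finite marginals, with the bound on the dual problem as a hypothesis. -/
theorem exists_finite_transport_plan {ι : Type*} [Fintype ι] (c : ι → ι → ℝ) {p q : ι → ℝ}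
    (hp : p ∈ stdSimplex ℝ ι) (hq : q ∈ stdSimplex ℝ ι) {K : ℝ}
    (hK : ∀ a b : ι → ℝ, (∀ i j, a i + b j ≤ c i j) → ∑ i, a i * p i + ∑ j, b j * q j ≤ K) :
    ∃ π : ι → ι → ℝ, (∀ i j, 0 ≤ π i j) ∧ (∀ i, ∑ j, π i j = p i) ∧ (∀ j, ∑ i, π i j = q j) ∧
      ∑ i, ∑ j, π i j * c i j ≤ K := by
  classical
  let L : (ι × ι → ℝ) →ₗ[ℝ] (ι → ℝ) × (ι → ℝ) × ℝ :=
    { toFun := fun π => (fun i => ∑ j, π (i, j), fun j => ∑ i, π (i, j),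
        ∑ i, ∑ j, π (i, j) * c i j)
      map_add' := fun x y => by
        ext <;> simp [add_mul, Finset.sum_add_distrib]
      map_smul' := fun r x => by
        ext <;> simp [Finset.mul_sum, mul_assoc] }
  let S := L '' stdSimplex ℝ (ι × ι)
  let T : Set ((ι → ℝ) × (ι → ℝ) × ℝ) := {p} ×ˢ {q} ×ˢ Set.Iic K
  by_cases hdisj : Disjoint S T
  · exfalso
    obtain ⟨f, u, v, hS, huv, hT⟩ := geometric_hahn_banach_compact_closed
      ((convex_stdSimplex ℝ (ι × ι)).linear_image L)
      ((isCompact_stdSimplex ℝ (ι × ι)).image L.continuous_of_finiteDimensional)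
      ((convex_singleton p).prod ((convex_singleton q).prod (convex_Iic K)))
      (isClosed_singleton.prod (isClosed_singleton.prod isClosed_Iic)) hdisj
    set a : ι → ℝ := fun i => f (Pi.single i 1, 0, 0) with ha
    set b : ι → ℝ := fun j => f (0, Pi.single j 1, 0) with hb
    set e : ℝ := f (0, 0, 1) with he
    have hf : ∀ x y t, f (x, y, t) = ∑ i, a i * x i + ∑ j, b j * y j + e * t := by
      intro x y t
      have h1 : (x, y, t) = ∑ i, x i • ((Pi.single i 1, 0, 0) : (ι → ℝ) × (ι → ℝ) × ℝ)
          + ∑ j, y j • ((0, Pi.single j 1, 0) : (ι → ℝ) × (ι → ℝ) × ℝ)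
          + t • ((0, 0, 1) : (ι → ℝ) × (ι → ℝ) × ℝ) := by
        ext <;> simp [Prod.fst_sum, Prod.snd_sum, Finset.sum_apply, Pi.single_apply]
      rw [h1]
      simp only [map_add, map_sum, map_smul, smul_eq_mul, ha, hb, he, mul_comm]
    have hv : ∀ t ≤ K, v < f (p, q, t) := fun t ht => hT _ ⟨rfl, rfl, ht⟩
    have hunit : ∀ i j, a i + b j + e * c i j < u := by
      intro i j
      have h1 : L (Pi.single (i, j) 1) = (Pi.single i 1, Pi.single j 1, c i j) := by
        ext k <;> simp [L, Pi.single_apply, ite_and, Finset.sum_ite_irrel]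
      have h2 := hS _ ⟨_, single_mem_stdSimplex ℝ (i, j), h1⟩
      rw [hf] at h2
      simpa [Pi.single_apply] using h2
    have hindep : ∃ t, f (p, q, t) < u := by
      have h1 : (fun z : ι × ι => p z.1 * q z.2) ∈ stdSimplex ℝ (ι × ι) := by
        refine ⟨fun z => mul_nonneg (hp.1 _) (hq.1 _), ?_⟩
        rw [Fintype.sum_prod_type]
        simp [← Finset.mul_sum, hp.2, hq.2]
      have h2 : L (fun z => p z.1 * q z.2) = (p, q, ∑ i, ∑ j, p i * q j * c i j) := by
        refine Prod.ext ?_ (Prod.ext ?_ rfl)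
        · ext i; simp [L, ← Finset.mul_sum, hq.2]
        · ext j; simp [L, ← Finset.sum_mul, hp.2]
      exact ⟨_, hS _ ⟨_, h1, h2⟩⟩
    have he0 : e < 0 := by
      obtain ⟨t, ht⟩ := hindep
      by_contra! h0
      have h1 := hv (min t K) (min_le_right _ _)
      rw [hf] at ht h1
      have := mul_le_mul_of_nonneg_left (min_le_left t K) h0
      linarith
    have h1 := hK (fun i => (a i - u) / (-e)) (fun j => b j / (-e)) fun i j => by
      rw [← add_div, div_le_iff₀ (by linarith)]
      linarith [hunit i j]
    have h2 : ∑ i, (a i - u) / (-e) * p i + ∑ j, b j / (-e) * q j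
        = (∑ i, a i * p i - u + ∑ j, b j * q j) / (-e) := by
      simp_rw [div_mul_eq_mul_div, ← Finset.sum_div, ← add_div, sub_mul, Finset.sum_sub_distrib,
        ← Finset.mul_sum, hp.2, mul_one]
    rw [h2, div_le_iff₀ (by linarith)] at h1
    have h3 := hv K le_rfl
    rw [hf] at h3
    linarith
  · obtain ⟨_, ⟨π, hπ, rfl⟩, h1, h2, h3⟩ := Set.not_disjoint_iff.1 hdisj
    exact ⟨fun i j => π (i, j), fun i j => hπ.1 _, congrFun h1, congrFun h2, h3⟩

theorem lintegral_comp_fintype {X ι : Type*} [MeasurableSpace X] [Fintype ι] [MeasurableSpace ι]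
    [MeasurableSingletonClass ι] (P : Measure X) {r : X → ι} (hr : Measurable r) (g : ι → ℝ≥0∞) :
    ∫⁻ x, g (r x) ∂P = ∑ i, g i * P (r ⁻¹' {i}) := by
  rw [← lintegral_map (measurable_of_finite g) hr, lintegral_fintype]
  simp [Measure.map_apply hr]

theorem integral_comp_fintype {X ι : Type*} [MeasurableSpace X] [Fintype ι] [MeasurableSpace ι]
    [MeasurableSingletonClass ι] (P : Measure X) [IsFiniteMeasure P] {r : X → ι}
    (hr : Measurable r) (g : ι → ℝ) :
    ∫ x, g (r x) ∂P = ∑ i, g i * P.real (r ⁻¹' {i}) := by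
  rw [← integral_map hr.aemeasurable (measurable_of_finite g).aestronglyMeasurable,
    integral_fintype (Integrable.of_finite)]
  simp [map_measureReal_apply hr, mul_comm]

/-- A transport plan between the images of `P` and `Q` under a finitely valued map lifts to a
coupling of `P` and `Q`. -/
theorem exists_coupling_of_finite_transport_plan {X ι : Type*} [MeasurableSpace X] [Fintype ι]
    [MeasurableSpace ι] [MeasurableSingletonClass ι] (P Q : Measure X) [IsFiniteMeasure P]
    [IsFiniteMeasure Q] {r : X → ι} (hr : Measurable r) {π : ι → ι → ℝ}
    (h0 : ∀ i j, 0 ≤ π i j) (h1 : ∀ i, ∑ j, π i j = P.real (r ⁻¹' {i}))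
    (h2 : ∀ j, ∑ i, π i j = Q.real (r ⁻¹' {j})) :
    ∃ γ : Measure (X × X), γ.map Prod.fst = P ∧ γ.map Prod.snd = Q ∧
      ∀ c : ι → ι → ℝ≥0∞, ∫⁻ z, c (r z.1) (r z.2) ∂γ = ∑ i, ∑ j, c i j * ENNReal.ofReal (π i j) := by
  set w : ι → ι → ℝ≥0∞ := fun i j =>
    ENNReal.ofReal (π i j) / (P (r ⁻¹' {i}) * Q (r ⁻¹' {j})) with hw
  have hp : ∀ i, ∑ j, ENNReal.ofReal (π i j) = P (r ⁻¹' {i}) := fun i => by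
    rw [← ENNReal.ofReal_sum_of_nonneg fun j _ => h0 i j, h1, ofReal_measureReal]
  have hq : ∀ j, ∑ i, ENNReal.ofReal (π i j) = Q (r ⁻¹' {j}) := fun j => by
    rw [← ENNReal.ofReal_sum_of_nonneg fun i _ => h0 i j, h2, ofReal_measureReal]
  have hpπ : ∀ i j, P (r ⁻¹' {i}) = 0 → ENNReal.ofReal (π i j) = 0 := fun i j h =>
    (Finset.sum_eq_zero_iff.1 ((hp i).trans h)) j (Finset.mem_univ j)
  have hqπ : ∀ i j, Q (r ⁻¹' {j}) = 0 → ENNReal.ofReal (π i j) = 0 := fun i j h =>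
    (Finset.sum_eq_zero_iff.1 ((hq j).trans h)) i (Finset.mem_univ i)
  have hwQ : ∀ i j, w i j * Q (r ⁻¹' {j}) = ENNReal.ofReal (π i j) / P (r ⁻¹' {i}) := by
    intro i j
    by_cases hj : Q (r ⁻¹' {j}) = 0
    · simp [hj, hqπ i j hj]
    · simp only [hw]
      rw [mul_comm, ← mul_div_assoc, mul_comm (P _),
        ENNReal.mul_div_mul_left _ _ hj (measure_ne_top _ _)]
  have hwP : ∀ i j, w i j * P (r ⁻¹' {i}) = ENNReal.ofReal (π i j) / Q (r ⁻¹' {j}) := by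
    intro i j
    by_cases hi : P (r ⁻¹' {i}) = 0
    · simp [hi, hpπ i j hi]
    · simp only [hw]
      rw [mul_comm, ← mul_div_assoc, ENNReal.mul_div_mul_left _ _ hi (measure_ne_top _ _)]
  have hpos : ∀ m : Measure X, ∀ᵐ x ∂m, m (r ⁻¹' {r x}) ≠ 0 := by
    intro m
    have : ∀ᵐ x ∂m, ∀ i, r x = i → m (r ⁻¹' {i}) ≠ 0 := by
      rw [ae_all_iff]
      intro i
      by_cases hi : m (r ⁻¹' {i}) = 0
      · filter_upwards [measure_eq_zero_iff_ae_notMem.1 hi] with x hx hxi using absurd hxi hx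
      · exact Eventually.of_forall fun _ _ => hi
    filter_upwards [this] with x hx using hx _ rfl
  have hrr : Measurable fun z : X × X => (r z.1, r z.2) :=
    (hr.comp measurable_fst).prodMk (hr.comp measurable_snd)
  have hmeas : ∀ c : ι → ι → ℝ≥0∞, Measurable fun z : X × X => c (r z.1) (r z.2) := fun c =>
    (measurable_of_finite fun y : ι × ι => c y.1 y.2).comp hrr
  refine ⟨(P.prod Q).withDensity fun z => w (r z.1) (r z.2), ?_, ?_, fun c => ?_⟩
  · ext B hB
    rw [Measure.map_apply measurable_fst hB, withDensity_apply _ (measurable_fst hB),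
      ← Set.prod_univ, ← Measure.prod_restrict, Measure.restrict_univ,
      lintegral_prod _ (hmeas w).aemeasurable]
    calc _ = ∫⁻ x in B, 1 ∂P := by
          refine lintegral_congr_ae (ae_restrict_of_ae ?_)
          filter_upwards [hpos P] with x hx
          rw [lintegral_comp_fintype Q hr (w (r x))]
          simp_rw [hwQ, div_eq_mul_inv, ← Finset.sum_mul, hp]
          exact ENNReal.mul_inv_cancel hx (measure_ne_top _ _)
      _ = P B := by simp
  · ext B hB
    rw [Measure.map_apply measurable_snd hB, withDensity_apply _ (measurable_snd hB),
      ← Set.univ_prod, ← Measure.prod_restrict, Measure.restrict_univ,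
      lintegral_prod_symm _ (hmeas w).aemeasurable]
    calc _ = ∫⁻ x in B, 1 ∂Q := by
          refine lintegral_congr_ae (ae_restrict_of_ae ?_)
          filter_upwards [hpos Q] with y hy
          rw [lintegral_comp_fintype P hr fun i => w i (r y)]
          simp_rw [hwP, div_eq_mul_inv, ← Finset.sum_mul, hq]
          exact ENNReal.mul_inv_cancel hy (measure_ne_top _ _)
      _ = Q B := by simp
  · rw [lintegral_withDensity_eq_lintegral_mul _ (hmeas w) (hmeas c)]
    rw [lintegral_prod _ ((hmeas w).mul (hmeas c)).aemeasurable]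
    refine (lintegral_congr fun x =>
      lintegral_comp_fintype Q hr fun j => w (r x) j * c (r x) j).trans ?_
    rw [lintegral_comp_fintype P hr fun i => ∑ j, w i j * c i j * Q (r ⁻¹' {j})]
    refine Finset.sum_congr rfl fun i _ => ?_
    rw [Finset.sum_mul]
    refine Finset.sum_congr rfl fun j _ => ?_
    by_cases hi : P (r ⁻¹' {i}) = 0
    · simp [hi, hpπ i j hi]
    · rw [mul_right_comm (w i j), hwQ, mul_right_comm,
        ENNReal.div_mul_cancel hi (measure_ne_top _ _), mul_comm]

theorem continuous_of_abs_sub_le {X : Type*} [TopologicalSpace X] {ρ : X → X → ℝ}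
    (hρ : Continuous fun z : X × X => ρ z.1 z.2) (h0 : ∀ x, ρ x x = 0) {f : X → ℝ}
    (hf : ∀ x y, |f x - f y| ≤ ρ x y) : Continuous f := by
  refine continuous_iff_continuousAt.2 fun x => tendsto_iff_dist_tendsto_zero.2 ?_
  have h1 : Tendsto (fun y => ρ y x) (𝓝 x) (𝓝 0) := by
    simpa [h0, Function.comp_def] using (hρ.comp (Continuous.prodMk_left x)).tendsto x
  exact squeeze_zero (fun _ => dist_nonneg) (fun y => hf y x) h1

theorem Measurable.integrable_of_abs_le {X : Type*} [MeasurableSpace X] {P : Measure X}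
    [IsFiniteMeasure P] {f : X → ℝ} (hf : Measurable f) {B : ℝ} (hB : ∀ x, |f x| ≤ B) :
    Integrable f P :=
  Integrable.of_bound hf.aestronglyMeasurable B (Eventually.of_forall hB)

section Duality

variable {X : Type*} [MetricSpace X] [SecondCountableTopology X] [MeasurableSpace X]
  [BorelSpace X] {ρ : X → X → ℝ}

theorem exists_simpleFunc_integral_le (hρ : Continuous fun z : X × X => ρ z.1 z.2)
    (h0 : ∀ x, ρ x x = 0) {M : ℝ} (hM : ∀ x y, |ρ x y| ≤ M)
    (P Q : Measure X) [IsProbabilityMeasure P] [IsFiniteMeasure Q] {δ : ℝ} (hδ : 0 < δ) :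
    ∃ r : SimpleFunc X X, ∫ x, ρ x (r x) ∂P ≤ δ ∧ ∫ x, ρ x (r x) ∂Q ≤ δ := by
  obtain ⟨x₀⟩ := P.nonempty_of_neZero
  let r : ℕ → SimpleFunc X X := SimpleFunc.approxOn id measurable_id Set.univ x₀ trivial
  have hlim : ∀ m : Measure X, IsFiniteMeasure m →
      Tendsto (fun n => ∫ x, ρ x (r n x) ∂m) atTop (𝓝 0) := by
    intro m _
    rw [← integral_zero X ℝ (μ := m)]
    refine tendsto_integral_of_dominated_convergence (fun _ => M)
      (fun n => (hρ.measurable.comp (measurable_id.prodMk (r n).measurable)).aestronglyMeasurable)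
      (integrable_const M) (fun n => Eventually.of_forall fun x => hM _ _)
      (Eventually.of_forall fun x => ?_)
    have h1 : Tendsto (fun n => r n x) atTop (𝓝 x) :=
      SimpleFunc.tendsto_approxOn measurable_id (Set.mem_univ x₀) (by simp)
    have h2 := (hρ.tendsto (x, x)).comp (tendsto_const_nhds.prodMk_nhds h1)
    simpa [h0, Function.comp_def] using h2
  obtain ⟨n, hP, hQ⟩ := (((hlim P inferInstance).eventually_le_const hδ).and
    ((hlim Q inferInstance).eventually_le_const hδ)).exists
  exact ⟨r n, hP, hQ⟩

/-- The hard inequality of Kantorovich–Rubinstein duality, for a bounded continuous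
pseudometric `ρ`. -/
theorem transportCost_le_of_forall_integral_sub_le (hρ : Continuous fun z : X × X => ρ z.1 z.2)
    (h0 : ∀ x, ρ x x = 0) (hsymm : ∀ x y, ρ x y = ρ y x)
    (htri : ∀ x y z, ρ x z ≤ ρ x y + ρ y z) {M : ℝ} (hM : ∀ x y, ρ x y ≤ M)
    (P Q : Measure X) [IsProbabilityMeasure P] [IsProbabilityMeasure Q] {K : ℝ}
    (hK : ∀ f : X → ℝ, (∀ x y, |f x - f y| ≤ ρ x y) → (∃ B, ∀ x, |f x| ≤ B) →
      ∫ x, f x ∂P - ∫ x, f x ∂Q ≤ K) :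
    transportCost (fun x y => ENNReal.ofReal (ρ x y)) P Q ≤ ENNReal.ofReal K := by
  have hnn : ∀ x y, 0 ≤ ρ x y := fun x y => by linarith [htri x y x, hsymm x y, h0 x]
  have habs : ∀ x y, |ρ x y| ≤ M := fun x y => (abs_of_nonneg (hnn x y)).trans_le (hM x y)
  obtain ⟨x₀⟩ := P.nonempty_of_neZero
  have hK0 : 0 ≤ K := by simpa using hK (fun _ => 0) (by simpa using hnn) ⟨0, by simp⟩
  refine ENNReal.le_of_forall_pos_le_add fun ε hε _ => ?_
  obtain ⟨r, hrP, hrQ⟩ := exists_simpleFunc_integral_le hρ h0 habs P Q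
    (show (0 : ℝ) < ε / 4 by positivity)
  set δ : ℝ := ε / 4 with hδ
  have hrmeas : Measurable fun x => ρ x (r x) :=
    hρ.measurable.comp (measurable_id.prodMk r.measurable)
  have hrint : ∀ m : Measure X, IsFiniteMeasure m → Integrable (fun x => ρ x (r x)) m :=
    fun m _ => hrmeas.integrable_of_abs_le fun x => habs _ _
  let ι := {x // x ∈ r.range}
  let s : X → ι := fun x => ⟨r x, r.mem_range_self x⟩
  have hs : Measurable s := r.measurable.subtype_mk
  have : Nonempty ι := ⟨s x₀⟩
  have hsimplex : ∀ m : Measure X, IsProbabilityMeasure m →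
      (fun i => m.real (s ⁻¹' {i})) ∈ stdSimplex ℝ ι := fun m _ =>
    ⟨fun i => measureReal_nonneg, by simpa using (integral_comp_fintype m hs fun _ => 1).symm⟩
  obtain ⟨π, hπ0, hπP, hπQ, hπK⟩ := exists_finite_transport_plan
    (fun i j : ι => ρ i j) (hsimplex P inferInstance) (hsimplex Q inferInstance)
    (K := K + 2 * δ) (by
      intro a b hab
      let f : X → ℝ := fun x => Finset.univ.inf' Finset.univ_nonempty fun j : ι => ρ x j - b j
      have hfle : ∀ x (j : ι), f x ≤ ρ x j - b j := fun x j => Finset.inf'_le _ (Finset.mem_univ j)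
      have hfsub : ∀ x y, f x - f y ≤ ρ x y := by
        intro x y
        obtain ⟨j, -, hj⟩ := Finset.exists_mem_eq_inf' Finset.univ_nonempty
          fun j : ι => ρ y j - b j
        have hj' : f y = ρ y j - b j := hj
        linarith [hfle x j, htri x y j]
      have hfρ : ∀ x y, |f x - f y| ≤ ρ x y := fun x y =>
        abs_sub_le_iff.2 ⟨hfsub x y, hsymm x y ▸ hfsub y x⟩
      have hfB : ∀ x, |f x| ≤ |f x₀| + M := fun x => by
        linarith [abs_sub_abs_le_abs_sub (f x) (f x₀), hfρ x x₀, hM x x₀]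
      have hfm : Measurable f := (continuous_of_abs_sub_le hρ h0 hfρ).measurable
      have hfP : Integrable f P := hfm.integrable_of_abs_le hfB
      have hfQ : Integrable f Q := hfm.integrable_of_abs_le hfB
      have hfin : ∀ (g : ι → ℝ) (m : Measure X), IsFiniteMeasure m →
          Integrable (fun x => g (s x)) m := fun g m _ =>
        Integrable.comp_measurable (g := g) Integrable.of_finite hs
      have haP : ∫ x, a (s x) ∂P ≤ ∫ x, f x ∂P + ∫ x, ρ x (r x) ∂P := by
        rw [← integral_add hfP (hrint P inferInstance)]
        refine integral_mono (hfin a P inferInstance) (hfP.add (hrint P inferInstance)) fun x => ?_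
        have h1 : a (s x) ≤ f (r x) := Finset.le_inf' _ _ fun j _ => by
          linarith [hab (s x) j, show ρ (s x) j = ρ (r x) j from rfl]
        change a (s x) ≤ f x + ρ x (r x)
        linarith [hfsub (r x) x, hsymm x (r x)]
      have hbQ : ∫ x, b (s x) ∂Q ≤ -∫ x, f x ∂Q + ∫ x, ρ x (r x) ∂Q := by
        rw [← integral_neg, ← integral_add (f := fun x => -f x) hfQ.neg (hrint Q inferInstance)]
        refine integral_mono (hfin b Q inferInstance)
          (hfQ.neg.add (hrint Q inferInstance)) fun x => ?_
        have h1 : f (r x) ≤ ρ (r x) (r x) - b (s x) := hfle (r x) (s x)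
        change b (s x) ≤ -f x + ρ x (r x)
        linarith [hfsub x (r x), h0 (r x)]
      rw [← integral_comp_fintype P hs a, ← integral_comp_fintype Q hs b]
      linarith [hK f hfρ ⟨_, hfB⟩])
  obtain ⟨γ, hγP, hγQ, hγ⟩ := exists_coupling_of_finite_transport_plan P Q hs hπ0 hπP hπQ
  have hlift : ∀ m : Measure X, IsFiniteMeasure m → ∫ x, ρ x (r x) ∂m ≤ δ →
      ∫⁻ x, ENNReal.ofReal (ρ x (r x)) ∂m ≤ ENNReal.ofReal δ := fun m hm h => by
    rw [← ofReal_integral_eq_lintegral_ofReal (hrint m hm) (Eventually.of_forall fun x => hnn _ _)]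
    exact ENNReal.ofReal_le_ofReal h
  have hm1 : Measurable fun x => ENNReal.ofReal (ρ x (r x)) := hrmeas.ennreal_ofReal
  calc transportCost (fun x y => ENNReal.ofReal (ρ x y)) P Q
      ≤ ∫⁻ z, ENNReal.ofReal (ρ z.1 z.2) ∂γ := iInf₂_le γ ⟨hγP, hγQ⟩
    _ ≤ ∫⁻ z, (ENNReal.ofReal (ρ z.1 (r z.1)) + ENNReal.ofReal (ρ z.2 (r z.2)))
          + ENNReal.ofReal (ρ (s z.1) (s z.2)) ∂γ := by
        refine lintegral_mono fun z => ?_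
        rw [← ENNReal.ofReal_add (hnn _ _) (hnn _ _),
          ← ENNReal.ofReal_add (add_nonneg (hnn _ _) (hnn _ _)) (hnn _ _)]
        refine ENNReal.ofReal_le_ofReal ?_
        change ρ z.1 z.2 ≤ ρ z.1 (r z.1) + ρ z.2 (r z.2) + ρ (r z.1) (r z.2)
        linarith [htri z.1 (r z.1) z.2, htri (r z.1) (r z.2) z.2, hsymm z.2 (r z.2)]
    _ = ∫⁻ x, ENNReal.ofReal (ρ x (r x)) ∂P + ∫⁻ x, ENNReal.ofReal (ρ x (r x)) ∂Q
          + ∑ i : ι, ∑ j : ι, ENNReal.ofReal (ρ i j) * ENNReal.ofReal (π i j) := by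
        have hfst : Measurable fun z : X × X => ENNReal.ofReal (ρ z.1 (r z.1)) :=
          hm1.comp measurable_fst
        have hsnd : Measurable fun z : X × X => ENNReal.ofReal (ρ z.2 (r z.2)) :=
          hm1.comp measurable_snd
        rw [lintegral_add_left (f := fun z : X × X => _ + _) (hfst.add hsnd), lintegral_add_left hfst,
          hγ fun i j => ENNReal.ofReal (ρ i j)]
        rw [← lintegral_map hm1 measurable_fst, ← lintegral_map hm1 measurable_snd, hγP, hγQ]
    _ ≤ ENNReal.ofReal δ + ENNReal.ofReal δ + ENNReal.ofReal (K + 2 * δ) := by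
        refine add_le_add (add_le_add (hlift P inferInstance hrP) (hlift Q inferInstance hrQ)) ?_
        simp_rw [← ENNReal.ofReal_mul (hnn _ _)]
        rw [Finset.sum_congr rfl fun i _ => (ENNReal.ofReal_sum_of_nonneg fun j _ =>
          mul_nonneg (hnn _ _) (hπ0 i j)).symm, ← ENNReal.ofReal_sum_of_nonneg fun i _ =>
          Finset.sum_nonneg fun j _ => mul_nonneg (hnn _ _) (hπ0 i j)]
        simp_rw [mul_comm (ρ _ _)]
        exact ENNReal.ofReal_le_ofReal hπK
    _ = ENNReal.ofReal K + ε := by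
        have hδ0 : 0 ≤ δ := by positivity
        rw [← ENNReal.ofReal_add hδ0 hδ0, ← ENNReal.ofReal_add (by positivity) (by positivity),
          ← ENNReal.ofReal_coe_nnreal, ← ENNReal.ofReal_add hK0 (by positivity)]
        congr 1
        rw [hδ]; ring

end Duality

/-- A bounded function which is `b`-Lipschitz up to an additive error `a` lies within `a` above
a bounded `b`-Lipschitz function. -/
theorem exists_lipschitzWith_le_of_sub_le {X : Type*} [PseudoMetricSpace X] {f : X → ℝ} {a B : ℝ}
    {b : ℝ≥0} (hf : ∀ x y, f x - f y ≤ a + b * dist x y) (hB : ∀ x, |f x| ≤ B) :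
    ∃ g : X → ℝ, LipschitzWith b g ∧ (∃ B', ∀ x, |g x| ≤ B') ∧ (∀ x, g x ≤ f x) ∧
      ∀ x, f x ≤ g x + a := by
  have hbdd : ∀ x, BddBelow (Set.range fun y => f y + b * dist x y) := fun x => by
    refine ⟨-B, ?_⟩
    rintro _ ⟨y, rfl⟩
    have : 0 ≤ b * dist x y := by positivity
    linarith [neg_le_of_abs_le (hB y)]
  let g : X → ℝ := fun x => ⨅ y, f y + b * dist x y
  have hgf : ∀ x, g x ≤ f x := fun x => (ciInf_le (hbdd x) x).trans (by simp)
  have hfg : ∀ x, f x ≤ g x + a := fun x => by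
    have : Nonempty X := ⟨x⟩
    rw [← sub_le_iff_le_add]
    exact le_ciInf fun y => by linarith [hf x y]
  refine ⟨g, LipschitzWith.of_le_add_mul b fun x y => ?_, ⟨B + |a|, fun x => ?_⟩, hgf, hfg⟩
  · have : Nonempty X := ⟨x⟩
    rw [← sub_le_iff_le_add]
    refine le_ciInf fun z => ?_
    have h1 : g x ≤ f z + b * dist x z := ciInf_le (hbdd x) z
    have h2 := mul_le_mul_of_nonneg_left (dist_triangle x y z) b.coe_nonneg
    linarith
  · have h1 := abs_le.1 (hB x)
    rw [abs_le]
    constructor <;> linarith [hgf x, hfg x, le_abs_self a, abs_nonneg a]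

/-- A concave function on `[0,∞)` which is bounded below is the infimum of the nondecreasing
affine functions above it. -/
theorem ConcaveOn.exists_affine_ge {β : ℝ → ℝ} (hnn : ∀ r ∈ Set.Ici (0 : ℝ), 0 ≤ β r)
    (hcont : ContinuousOn β (Set.Ici (0 : ℝ))) (hconc : ConcaveOn ℝ (Set.Ici (0 : ℝ)) β)
    {x δ : ℝ} (hx : 0 ≤ x) (hδ : 0 < δ) :
    ∃ (a : ℝ) (b : ℝ≥0), (∀ y, 0 ≤ y → β y ≤ a + b * y) ∧ a + b * x = β x + δ := by
  obtain ⟨c, c', h1, h2⟩ := hconc.neg.exists_affine_le_of_lt_real (x := x) (a := -β x - δ) hx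
    (by simp [hδ]) isClosed_Ici hcont.neg.lowerSemicontinuousOn
  have hc : 0 ≤ -c := by
    by_contra! hc
    have hc' : 0 < c := by linarith
    have hy : (0 : ℝ) ≤ (|c'| + 1) / c := by positivity
    have h3 := h1 _ hy
    rw [mul_div_cancel₀ _ hc'.ne'] at h3
    have h4 := hnn _ hy
    simp only [Pi.neg_apply] at h3
    linarith [neg_abs_le c']
  refine ⟨-c', (-c).toNNReal, fun y hy => ?_, ?_⟩
  · have := h1 y hy
    simp only [Pi.neg_apply] at this
    rw [Real.coe_toNNReal _ hc]
    linarith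
  · rw [Real.coe_toNNReal _ hc]
    linarith

theorem ConcaveOn.monotoneOn_of_nonneg {β : ℝ → ℝ} (hnn : ∀ r ∈ Set.Ici (0 : ℝ), 0 ≤ β r)
    (hcont : ContinuousOn β (Set.Ici (0 : ℝ))) (hconc : ConcaveOn ℝ (Set.Ici (0 : ℝ)) β) :
    MonotoneOn β (Set.Ici (0 : ℝ)) := by
  intro s hs t ht hst
  refine le_of_forall_pos_le_add fun δ hδ => ?_
  obtain ⟨a, b, h1, h2⟩ := hconc.exists_affine_ge hnn hcont ht hδ
  have := mul_le_mul_of_nonneg_left hst b.coe_nonneg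
  linarith [h1 s hs]

theorem ConcaveOn.le_add_of_zero_eq_zero {β : ℝ → ℝ} (hconc : ConcaveOn ℝ (Set.Ici (0 : ℝ)) β)
    (h0 : β 0 = 0) {s t : ℝ} (hs : 0 ≤ s) (ht : 0 ≤ t) : β (s + t) ≤ β s + β t := by
  rcases hs.eq_or_lt with rfl | hs'
  · simp [h0]
  have hst : 0 < s + t := by linarith
  have key : ∀ u v, 0 ≤ u → 0 ≤ v → u + v = s + t → u / (s + t) * β (s + t) ≤ β u := by
    intro u v hu hv huv
    have h := hconc.2 (Set.mem_Ici.2 hst.le) (Set.mem_Ici.2 le_rfl)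
      (div_nonneg hu hst.le) (div_nonneg hv hst.le) (by rw [← add_div, huv, div_self hst.ne'])
    simpa [h0, div_mul_cancel₀ _ hst.ne'] using h
  have h1 := key s t hs ht rfl
  have h2 := key t s ht hs (add_comm _ _)
  have h3 : s / (s + t) * β (s + t) + t / (s + t) * β (s + t) = β (s + t) := by
    rw [← add_mul, ← add_div, div_self hst.ne', one_mul]
  linarith

/-- Interpolation: a Markov kernel that acts boundedly on Lipschitz functions for `d` acts
boundedly on Lipschitz functions for `β ∘ d`. -/
theorem integral_sub_integral_le_of_lipschitz {X : Type*} [MetricSpace X] [MeasurableSpace X]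
    [BorelSpace X] {β : ℝ → ℝ} (hnn : ∀ r ∈ Set.Ici (0 : ℝ), 0 ≤ β r)
    (hcont : ContinuousOn β (Set.Ici (0 : ℝ))) (hconc : ConcaveOn ℝ (Set.Ici (0 : ℝ)) β)
    {C : ℝ≥0} {κ : X → Measure X} (hprob : ∀ x, IsProbabilityMeasure (κ x))
    (hκ : ∀ (f : X → ℝ) (L : ℝ≥0), LipschitzWith L f → (∃ M, ∀ x, |f x| ≤ M) →
        LipschitzWith (C * L) (fun x => ∫ y, f y ∂ κ x))
    {f : X → ℝ} (hfm : Measurable f) (hf : ∀ x y, f x - f y ≤ β (dist x y))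
    {B : ℝ} (hB : ∀ x, |f x| ≤ B) (x y : X) :
    ∫ z, f z ∂κ x - ∫ z, f z ∂κ y ≤ max (C : ℝ) 1 * β (dist x y) := by
  have hD : 0 < max (C : ℝ) 1 := lt_max_of_lt_right one_pos
  refine le_of_forall_pos_le_add fun ε hε => ?_
  obtain ⟨a, b, hab, hab'⟩ := hconc.exists_affine_ge hnn hcont (dist_nonneg (x := x) (y := y))
    (div_pos hε hD)
  have ha : 0 ≤ a := by simpa using (hnn 0 (by simp)).trans (hab 0 le_rfl)
  obtain ⟨g, hg, ⟨B', hB'⟩, hgf, hfg⟩ := exists_lipschitzWith_le_of_sub_le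
    (fun x y => (hf x y).trans (hab _ dist_nonneg)) hB
  have hgi : ∀ w, Integrable g (κ w) := fun w =>
    hg.continuous.measurable.integrable_of_abs_le hB'
  have hfi : ∀ w, Integrable f (κ w) := fun w => hfm.integrable_of_abs_le hB
  have h1 : ∫ z, f z ∂κ x ≤ ∫ z, g z ∂κ x + a := by
    have := integral_mono (hfi x) ((hgi x).add (integrable_const a)) hfg
    simpa [integral_add (hgi x) (integrable_const a)] using this
  have h2 : ∫ z, g z ∂κ y ≤ ∫ z, f z ∂κ y := integral_mono (hgi y) (hfi y) hgf
  have h3 := (le_abs_self _).trans ((hκ g b hg ⟨B', hB'⟩).dist_le_mul x y)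
  rw [NNReal.coe_mul] at h3
  have h4 : a ≤ max (C : ℝ) 1 * a := le_mul_of_one_le_left ha (le_max_right _ _)
  have h5 : C * b * dist x y ≤ max (C : ℝ) 1 * (b * dist x y) := by
    rw [mul_assoc]
    exact mul_le_mul_of_nonneg_right (le_max_left _ _) (by positivity)
  calc ∫ z, f z ∂κ x - ∫ z, f z ∂κ y ≤ max (C : ℝ) 1 * (a + b * dist x y) := by linarith
    _ = max (C : ℝ) 1 * β (dist x y) + ε := by
      rw [hab', mul_add, mul_div_cancel₀ _ hD.ne']

theorem integral_bind_of_measurable {X : Type*} [MeasurableSpace X] {κ : X → Measure X}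
    (hκ : Measurable κ) {μ : Measure X} {f : X → ℝ} (hf : Integrable f (μ.bind κ)) :
    ∫ x, f x ∂μ.bind κ = ∫ x, ∫ y, f y ∂κ x ∂μ := by
  let η : ProbabilityTheory.Kernel X X := ⟨κ, hκ⟩
  change Integrable f (μ.bind η) at hf
  change ∫ x, f x ∂μ.bind η = ∫ x, ∫ y, f y ∂η x ∂μ
  rw [Measure.comp_eq_comp_const_apply] at hf ⊢
  rw [ProbabilityTheory.Kernel.integral_comp hf, ProbabilityTheory.Kernel.const_apply]

/-- Let `(X,d)` be a complete separable metric space and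
`β : [0,∞) → [0,∞)` continuous, concave and bounded with `β(0) = 0 < β(r)` for `r > 0`.
Then `d_β(x,y) := β(d(x,y))` is a distance on `X`; moreover, for every `C ≥ 0` and every
measurable map `κ` from `X` to Borel probability measures such that `x ↦ ∫ f dκ(x)` is
`C·Lip(f)`-Lipschitz for all bounded Lipschitz `f`, one has
`W_(β)(μκ, νκ) ≤ max(C,1)·W_(β)(μ,ν)` for all Borel probability measures `μ, ν`, where
`W_(β)` is the `L¹`-Wasserstein distance for the distance `d_β`. -/
theorem stmt15 {X : Type*} [MetricSpace X] [CompleteSpace X]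
    [TopologicalSpace.SeparableSpace X] [MeasurableSpace X] [BorelSpace X]
    (β : ℝ → ℝ)
    (hβnonneg : ∀ r ∈ Set.Ici (0:ℝ), 0 ≤ β r)
    (hβcont : ContinuousOn β (Set.Ici (0:ℝ)))
    (hβconc : ConcaveOn ℝ (Set.Ici (0:ℝ)) β)
    (hβbdd : ∃ M, ∀ r ∈ Set.Ici (0:ℝ), β r ≤ M)
    (hβ0 : β 0 = 0) (hβpos : ∀ r : ℝ, 0 < r → 0 < β r) :
    ((∀ x y : X, (β (dist x y) = 0 ↔ x = y)) ∧
      (∀ x y : X, β (dist x y) = β (dist y x)) ∧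
      (∀ x y z : X, β (dist x z) ≤ β (dist x y) + β (dist y z))) ∧
    (∀ (C : ℝ≥0) (κ : X → Measure X), Measurable κ →
      (∀ x, IsProbabilityMeasure (κ x)) →
      (∀ (f : X → ℝ) (L : ℝ≥0), LipschitzWith L f → (∃ M, ∀ x, |f x| ≤ M) →
        LipschitzWith (C * L) (fun x => ∫ y, f y ∂ κ x)) →
      ∀ μ ν : Measure X, IsProbabilityMeasure μ → IsProbabilityMeasure ν →
        transportCost (fun x y => ENNReal.ofReal (β (dist x y))) (μ.bind κ) (ν.bind κ) ≤
          ((max C 1 : ℝ≥0) : ℝ≥0∞) *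
            transportCost (fun x y => ENNReal.ofReal (β (dist x y))) μ ν) := by
  have hmono := hβconc.monotoneOn_of_nonneg hβnonneg hβcont
  have hnn : ∀ x y : X, 0 ≤ β (dist x y) := fun x y => hβnonneg _ dist_nonneg
  have h0 : ∀ x : X, β (dist x x) = 0 := fun x => by rw [dist_self, hβ0]
  have hsymm : ∀ x y : X, β (dist x y) = β (dist y x) := fun x y => by rw [dist_comm]
  have htri : ∀ x y z : X, β (dist x z) ≤ β (dist x y) + β (dist y z) := fun x y z =>
    (hmono dist_nonneg (Set.mem_Ici.2 (by positivity)) (dist_triangle x y z)).trans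
      (hβconc.le_add_of_zero_eq_zero hβ0 dist_nonneg dist_nonneg)
  refine ⟨⟨fun x y => ⟨fun h => ?_, fun h => h ▸ h0 x⟩, hsymm, htri⟩, ?_⟩
  · by_contra hxy
    exact (hβpos _ (dist_pos.2 hxy)).ne' h
  intro C κ hκm hκ hκL μ ν _ _
  obtain ⟨M, hM⟩ := hβbdd
  have := UniformSpace.secondCountable_of_separable X
  have hcont : Continuous fun z : X × X => β (dist z.1 z.2) :=
    hβcont.comp_continuous continuous_dist fun z => dist_nonneg
  have hDtop : ((max C 1 : ℝ≥0) : ℝ≥0∞) ≠ ∞ := ENNReal.coe_ne_top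
  have hprob : ∀ m : Measure X, IsProbabilityMeasure m → IsProbabilityMeasure (m.bind κ) :=
    fun m _ => isProbabilityMeasure_bind hκm.aemeasurable (Eventually.of_forall hκ)
  have := hprob μ inferInstance
  have := hprob ν inferInstance
  rw [transportCost, transportCost, ENNReal.mul_iInf_of_ne (by simp) hDtop]
  refine le_iInf fun γ => ?_
  rw [ENNReal.mul_iInf_of_ne (by simp) hDtop]
  refine le_iInf fun hγ => ?_
  obtain ⟨hγμ, hγν⟩ := hγ
  have hγprob : IsProbabilityMeasure γ := by
    constructor
    rw [← measure_univ (μ := μ), ← hγμ, Measure.map_apply measurable_fst .univ, Set.preimage_univ]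
  have hβint : Integrable (fun z : X × X => β (dist z.1 z.2)) γ :=
    hcont.measurable.integrable_of_abs_le fun z =>
      (abs_of_nonneg (hnn z.1 z.2)).trans_le (hM _ dist_nonneg)
  rw [← ofReal_integral_eq_lintegral_ofReal hβint (Eventually.of_forall fun z => hnn z.1 z.2),
    ← ENNReal.ofReal_coe_nnreal, ← ENNReal.ofReal_mul (NNReal.coe_nonneg _)]
  refine transportCost_le_of_forall_integral_sub_le hcont h0 hsymm htri
    (fun x y => hM _ dist_nonneg) _ _ ?_
  rintro f hf ⟨B, hB⟩
  have hfm : Measurable f := (continuous_of_abs_sub_le hcont h0 hf).measurable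
  set F : X → ℝ := fun x => ∫ y, f y ∂κ x
  have hFsub : ∀ x y, F x - F y ≤ max (C : ℝ) 1 * β (dist x y) :=
    integral_sub_integral_le_of_lipschitz hβnonneg hβcont hβconc hκ hκL hfm
      (fun x y => (le_abs_self _).trans (hf x y)) hB
  have hFm : Measurable F := (continuous_of_abs_sub_le (hcont.const_mul (max (C : ℝ) 1))
    (fun x => by rw [h0, mul_zero]) fun x y =>
      abs_sub_le_iff.2 ⟨hFsub x y, hsymm x y ▸ hFsub y x⟩).measurable
  have hFB : ∀ x, |F x| ≤ B := fun x => by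
    simpa using norm_integral_le_of_norm_le_const (f := f) (μ := κ x) (Eventually.of_forall hB)
  rw [integral_bind_of_measurable hκm (hfm.integrable_of_abs_le hB),
    integral_bind_of_measurable hκm (hfm.integrable_of_abs_le hB)]
  change ∫ x, F x ∂μ - ∫ x, F x ∂ν ≤ _
  have hF1 : Integrable (fun z : X × X => F z.1) γ :=
    (hFm.comp measurable_fst).integrable_of_abs_le fun z => hFB z.1
  have hF2 : Integrable (fun z : X × X => F z.2) γ :=
    (hFm.comp measurable_snd).integrable_of_abs_le fun z => hFB z.2
  rw [← hγμ, ← hγν, integral_map measurable_fst.aemeasurable hFm.aestronglyMeasurable,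
    integral_map measurable_snd.aemeasurable hFm.aestronglyMeasurable, ← integral_sub hF1 hF2,
    ← integral_const_mul]
  refine integral_mono (hF1.sub hF2) (hβint.const_mul _) fun z => ?_
  simpa using hFsub z.1 z.2
end

section
/- Let (X,d) be a complete metric space with the property that every Lipschitz function ψ : X → ℝ with bounded support satisfying |Dψ|(x) ≤ 1 for every x ∈ X is 1-Lipschitz. Then (X,d) is a length space. -/
open Filter Topology
open scoped ENNReal NNReal

/-- A function is bounded by slope `1` at a point near which its increments are bounded by
distances. -/
lemma slopeAt_le_one_of_eventually {X : Type*} [MetricSpace X] {f : X → ℝ} {x : X}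
    (hf : ∀ᶠ y in 𝓝 x, |f y - f x| ≤ dist y x) : slopeAt f x ≤ 1 := by
  unfold slopeAt
  rcases (𝓝[≠] x).eq_or_neBot with hbot | hne
  · simp [hbot, limsup, limsSup]
  · refine limsup_le_of_le ?_ ?_
    · refine IsCoboundedUnder.of_frequently_ge (a := 0) (Eventually.frequently ?_)
      exact Eventually.of_forall fun y => by positivity
    · filter_upwards [hf.filter_mono nhdsWithin_le_nhds] with y hy
      exact div_le_one_of_le₀ hy dist_nonneg

/-- The slope hypothesis forces balls whose radii add up to more than the distance of the centres
to intersect. -/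
lemma exists_mem_inter_ball {X : Type*} [MetricSpace X]
    (h : ∀ ψ : X → ℝ, (∃ L : ℝ≥0, LipschitzWith L ψ) →
      (∃ (x₀ : X) (R : ℝ), ∀ x, ψ x ≠ 0 → dist x x₀ ≤ R) →
      (∀ x, slopeAt ψ x ≤ 1) → LipschitzWith 1 ψ)
    (x y : X) (r : ℝ) (hr : dist x y < 2 * r) : ∃ m, dist x m < r ∧ dist m y < r := by
  by_contra! hm
  have hr0 : 0 < r := by linarith [dist_nonneg (x := x) (y := y)]
  have hxy : r ≤ dist x y := hm x (by simpa using hr0)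
  have hlip (a z w : X) : |max 0 (r - dist w a) - max 0 (r - dist z a)| ≤ dist w z := by
    rw [max_comm 0, max_comm 0]
    refine (abs_max_sub_max_le_abs _ _ _).trans ?_
    rw [sub_sub_sub_cancel_left, abs_sub_comm]
    exact abs_dist_sub_le w z a
  have hzero (a z : X) (hz : r ≤ dist z a) : max 0 (r - dist z a) = 0 :=
    max_eq_left (by linarith)
  let ψ : X → ℝ := fun z => max 0 (r - dist z x) - max 0 (r - dist z y)
  have hψ := h ψ ⟨2, ?_⟩ ⟨x, r + dist x y, ?_⟩ ?_
  · have h1 := hψ.dist_le_mul x y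
    rw [Real.dist_eq] at h1
    have h2 := le_of_abs_le h1
    simp only [ψ, dist_self, hzero y x hxy, hzero x y (by rwa [dist_comm]), sub_zero,
      max_eq_right hr0.le, NNReal.coe_one, one_mul] at h2
    linarith
  · refine LipschitzWith.of_dist_le_mul fun w z => ?_
    have h1 := abs_le.1 (hlip x z w)
    have h2 := abs_le.1 (hlip y z w)
    rw [Real.dist_eq, abs_le]
    simp only [ψ, NNReal.coe_ofNat]
    constructor <;> linarith
  · intro z hz
    by_contra! hlt
    refine hz ?_
    have := dist_triangle_right z y x
    have := dist_triangle z y x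
    rw [dist_comm y x] at this
    simp only [ψ]
    rw [hzero x z (by linarith [dist_nonneg (x := x) (y := y)]), hzero y z (by linarith), sub_zero]
  · intro z
    apply slopeAt_le_one_of_eventually
    have hfar (w : X) (hw : dist w x < r) : r ≤ dist w y := hm w (by rwa [dist_comm])
    rcases lt_or_ge (dist z x) r with hzx | hzx
    · filter_upwards [(continuous_id.dist continuous_const).continuousAt.eventually_lt_const hzx]
        with w hw
      simpa only [ψ, hzero y z (hfar z hzx), hzero y w (hfar w hw), sub_zero] using hlip x z w
    · rcases lt_or_ge (dist z y) r with hzy | hzy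
      · filter_upwards [(continuous_id.dist continuous_const).continuousAt.eventually_lt_const hzy]
          with w hw
        have hwx : r ≤ dist w x := by
          by_contra! hlt
          exact absurd (hfar w hlt) (not_le.2 hw)
        simp only [ψ, hzero x z hzx, hzero x w hwx, zero_sub]
        rw [neg_sub_neg, abs_sub_comm]
        exact hlip y z w
      · refine Eventually.of_forall fun w => ?_
        have h1 := hlip x z w
        have h2 := hlip y z w
        simp only [ψ, hzero x z hzx, hzero y z hzy, sub_zero] at h1 h2 ⊢
        rcases lt_or_ge (dist w x) r with hwx | hwx
        · simpa only [hzero y w (hfar w hwx), sub_zero] using h1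
        · simpa only [hzero x w hwx, zero_sub, abs_neg] using h2

/-- Points with indices `k` and `k + 1` at stage `n` are joined by inserting `m` of them (at scale
`r / 2 ^ (n + 1)`) at stage `n + 1`; the starting sequence is `x, y, y, …`. -/
noncomputable def dyadicPoints {X : Type*} (m : X → X → ℝ → X) (x y : X) (r : ℝ) : ℕ → ℕ → X
  | 0, k => if k = 0 then x else y
  | n + 1, k =>
    if k % 2 = 0 then dyadicPoints m x y r n (k / 2)
    else m (dyadicPoints m x y r n (k / 2)) (dyadicPoints m x y r n (k / 2 + 1)) (r / 2 ^ (n + 1))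

section dyadicPoints

variable {X : Type*}

lemma dyadicPoints_zero_right (m : X → X → ℝ → X) (x y : X) (r : ℝ) (n : ℕ) :
    dyadicPoints m x y r n 0 = x := by
  induction n with
  | zero => simp [dyadicPoints]
  | succ n ih => simp [dyadicPoints, ih]

lemma dyadicPoints_two_pow (m : X → X → ℝ → X) (x y : X) (r : ℝ) (n : ℕ) :
    dyadicPoints m x y r n (2 ^ n) = y := by
  induction n with
  | zero => simp [dyadicPoints]
  | succ n ih => simp [dyadicPoints, pow_succ, ih]

variable [MetricSpace X] {m : X → X → ℝ → X} {x y : X} {r : ℝ}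

lemma dist_dyadicPoints_succ_lt
    (hm : ∀ x y r, dist x y < 2 * r → dist x (m x y r) < r ∧ dist (m x y r) y < r)
    (hr : dist x y < r) (n k : ℕ) :
    dist (dyadicPoints m x y r n k) (dyadicPoints m x y r n (k + 1)) < r / 2 ^ n := by
  induction n generalizing k with
  | zero =>
    have hr0 : 0 < r := dist_nonneg.trans_lt hr
    rcases k with - | k <;> simp [dyadicPoints, hr, hr0]
  | succ n ih =>
    have hmid := hm _ _ (r / 2 ^ (n + 1)) ((ih (k / 2)).trans_eq (by field_simp; ring))
    rcases Nat.mod_two_eq_zero_or_one k with hk | hk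
    · have h1 : (k + 1) % 2 = 1 := by omega
      have h2 : (k + 1) / 2 = k / 2 := by omega
      simpa [dyadicPoints, hk, h1, h2] using hmid.1
    · have h1 : (k + 1) % 2 = 0 := by omega
      have h2 : (k + 1) / 2 = k / 2 + 1 := by omega
      simpa [dyadicPoints, hk, h1, h2] using hmid.2

lemma dist_dyadicPoints_refine_le
    (hm : ∀ x y r, dist x y < 2 * r → dist x (m x y r) < r ∧ dist (m x y r) y < r)
    (hr : dist x y < r) (n k : ℕ) :
    dist (dyadicPoints m x y r n (k / 2)) (dyadicPoints m x y r (n + 1) k) ≤ r / 2 / 2 ^ n := by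
  have hr0 : 0 < r := dist_nonneg.trans_lt hr
  have hmid := hm _ _ (r / 2 ^ (n + 1))
    ((dist_dyadicPoints_succ_lt hm hr n (k / 2)).trans_eq (by field_simp; ring))
  rcases Nat.mod_two_eq_zero_or_one k with hk | hk
  · simp only [dyadicPoints, hk, if_true, dist_self]
    positivity
  · simp only [dyadicPoints, hk, one_ne_zero, if_false]
    exact hmid.1.le.trans_eq (by field_simp; ring)

lemma dist_dyadicPoints_add_le
    (hm : ∀ x y r, dist x y < 2 * r → dist x (m x y r) < r ∧ dist (m x y r) y < r)
    (hr : dist x y < r) (n k j : ℕ) :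
    dist (dyadicPoints m x y r n k) (dyadicPoints m x y r n (k + j)) ≤ j * (r / 2 ^ n) := by
  induction j with
  | zero => simp
  | succ j ih =>
    have h1 := dist_triangle (dyadicPoints m x y r n k) (dyadicPoints m x y r n (k + j))
      (dyadicPoints m x y r n (k + j + 1))
    have h2 := dist_dyadicPoints_succ_lt hm hr n (k + j)
    rw [← add_assoc]
    push_cast
    linarith

end dyadicPoints

/-- In a complete metric space with approximate midpoints, points at distance less than `r` are
joined by an `r`-Lipschitz curve. -/
lemma exists_lipschitzOnWith_curve {X : Type*} [MetricSpace X] [CompleteSpace X]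
    (hmid : ∀ (x y : X) (r : ℝ), dist x y < 2 * r → ∃ m, dist x m < r ∧ dist m y < r)
    (x y : X) (r : ℝ≥0) (hr : dist x y < r) :
    ∃ γ : ℝ → X, LipschitzOnWith r γ (Set.Icc 0 1) ∧ γ 0 = x ∧ γ 1 = y := by
  have hm' : ∀ (x y : X) (r : ℝ), ∃ m, dist x y < 2 * r → dist x m < r ∧ dist m y < r := by
    intro x y r
    by_cases hxy : dist x y < 2 * r
    · obtain ⟨m, hm⟩ := hmid x y r hxy
      exact ⟨m, fun _ => hm⟩
    · exact ⟨x, fun hlt => absurd hlt hxy⟩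
  choose m hm using hm'
  let c : ℕ → ℝ → X := fun n t => dyadicPoints m x y r n ⌊t * 2 ^ n⌋₊
  have hstep (t : ℝ) (n : ℕ) : dist (c n t) (c (n + 1) t) ≤ r / 2 / 2 ^ n := by
    have hfloor : ⌊t * 2 ^ n⌋₊ = ⌊t * 2 ^ (n + 1)⌋₊ / 2 := by
      rw [← Nat.floor_div_ofNat]
      congr 1
      rw [pow_succ]
      ring
    simp only [c, hfloor]
    exact dist_dyadicPoints_refine_le hm hr n _
  have hlim (t : ℝ) : ∃ z, Tendsto (fun n => c n t) atTop (𝓝 z) :=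
    cauchySeq_tendsto_of_complete (cauchySeq_of_le_geometric_two (hstep t))
  choose γ hγ using hlim
  have hlip {s t : ℝ} (hs : 0 ≤ s) (hst : s ≤ t) : dist (γ s) (γ t) ≤ r * (t - s) := by
    have hbound (n : ℕ) : dist (c n s) (c n t) ≤ r * (t - s) + r / 2 ^ n := by
      have hp : (0 : ℝ) < 2 ^ n := by positivity
      obtain ⟨j, hj⟩ := Nat.exists_eq_add_of_le
        (Nat.floor_mono (mul_le_mul_of_nonneg_right hst hp.le))
      have h1 := dist_dyadicPoints_add_le hm hr n ⌊s * 2 ^ n⌋₊ j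
      rw [← hj] at h1
      refine h1.trans ?_
      have h2 := Nat.lt_floor_add_one (s * 2 ^ n)
      have h3 := Nat.floor_le (mul_nonneg (hs.trans hst) hp.le)
      rw [hj] at h3
      push_cast at h3
      have h4 : (j : ℝ) ≤ (t - s) * 2 ^ n + 1 := by linarith
      calc (j : ℝ) * (r / 2 ^ n) ≤ ((t - s) * 2 ^ n + 1) * (r / 2 ^ n) := by gcongr
        _ = r * (t - s) + r / 2 ^ n := by field_simp
    have hzero : Tendsto (fun n : ℕ => (r : ℝ) * (t - s) + r / 2 ^ n) atTop
        (𝓝 (r * (t - s) + 0)) :=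
      tendsto_const_nhds.add
        (tendsto_const_nhds.div_atTop (tendsto_pow_atTop_atTop_of_one_lt one_lt_two))
    rw [add_zero] at hzero
    exact le_of_tendsto_of_tendsto' ((hγ s).dist (hγ t)) hzero hbound
  refine ⟨γ, LipschitzOnWith.of_dist_le_mul fun s hs t ht => ?_, ?_, ?_⟩
  · rcases le_total s t with hst | hts
    · rw [dist_comm s t, Real.dist_eq, abs_of_nonneg (sub_nonneg.2 hst)]
      exact hlip hs.1 hst
    · rw [dist_comm, Real.dist_eq, abs_of_nonneg (sub_nonneg.2 hts)]
      exact hlip ht.1 hts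
  · refine tendsto_nhds_unique (hγ 0) ?_
    simp [c, dyadicPoints_zero_right]
  · refine tendsto_nhds_unique (hγ 1) ?_
    have hfloor (n : ℕ) : ⌊(2 : ℝ) ^ n⌋₊ = 2 ^ n := by
      exact_mod_cast Nat.floor_natCast (R := ℝ) (2 ^ n)
    simp [c, hfloor, dyadicPoints_two_pow]

/-- An `r`-Lipschitz curve on `[0, 1]` has length at most `r`. -/
lemma LipschitzOnWith.eVariationOn_Icc_zero_one_le {X : Type*} [MetricSpace X] {γ : ℝ → X}
    {r : ℝ≥0} (hγ : LipschitzOnWith r γ (Set.Icc 0 1)) : eVariationOn γ (Set.Icc 0 1) ≤ r := by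
  have hid : eVariationOn (id : ℝ → ℝ) (Set.Icc 0 1) ≤ 1 := by
    simp
  calc eVariationOn γ (Set.Icc 0 1) ≤ r * eVariationOn id (Set.Icc 0 1) :=
        hγ.comp_eVariationOn_le (Set.mapsTo_id _)
    _ ≤ r * 1 := by gcongr
    _ = r := mul_one _

/-- Let `(X,d)` be a complete metric space such that every Lipschitz
function `ψ : X → ℝ` with bounded support satisfying `|Dψ| ≤ 1` everywhere is `1`-Lipschitz.
Then `(X,d)` is a length space. -/
theorem stmt16 {X : Type*} [MetricSpace X] [CompleteSpace X]
    (h : ∀ ψ : X → ℝ, (∃ L : ℝ≥0, LipschitzWith L ψ) →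
      (∃ (x₀ : X) (R : ℝ), ∀ x, ψ x ≠ 0 → dist x x₀ ≤ R) →
      (∀ x, slopeAt ψ x ≤ 1) → LipschitzWith 1 ψ) :
    IsLengthSpace X := by
  intro x y
  apply le_antisymm
  · refine le_iInf fun γ => le_iInf fun _ => le_iInf fun h0 => le_iInf fun h1 => ?_
    rw [← edist_dist, ← h0, ← h1]
    exact eVariationOn.edist_le γ (Set.left_mem_Icc.2 zero_le_one) (Set.right_mem_Icc.2 zero_le_one)
  · refine ENNReal.le_of_forall_pos_le_add fun ε hε _ => ?_
    have hlt : dist x y < (nndist x y + ε : ℝ≥0) := by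
      rw [dist_nndist, NNReal.coe_lt_coe]
      exact lt_add_of_pos_right _ hε
    obtain ⟨γ, hγ, h0, h1⟩ := exists_lipschitzOnWith_curve (exists_mem_inter_ball h) x y _ hlt
    refine le_trans (b := ((nndist x y + ε : ℝ≥0) : ℝ≥0∞)) ?_ ?_
    · exact iInf_le_of_le γ <| iInf_le_of_le ⟨_, hγ⟩ <| iInf_le_of_le h0 <| iInf_le_of_le h1
        hγ.eVariationOn_Icc_zero_one_le
    · rw [ENNReal.coe_add, ← edist_nndist, edist_dist]
end
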